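/- For a finite-dimensional Sp(V)-stable k-subspace M of k[V], let rad(M) denote the intersection of all maximal Sp(V)-stable proper subspaces of M, and define rad⁰(M) = M and rad^{i+1}(M) = rad(rad^i(M)). Write |s| = Σ_{j=0}^{t−1} s_j. Assume either (a) d ≠ 0 and (s,ε) ∈ S[d], or (b) d = 0 and (s,ε) ∈ S (in case (b) read Y(s,ε) etc. and take pairs in S). Then for every i ≥ 0: rad^i(Y(s,ε)[d]) = Σ Y(s'',ε'')[d], the sum over all (s'',ε'') ∈ S[d] with (s'',ε'') ≤ (s,ε) and |s''| = |s| − i (the empty sum being the zero subspace). -/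

import Mathlib

open scoped Classical

noncomputable section

/-- The `2m`-dimensional standard symplectic space over `k = F_q = GaloisField p t`:
pairs `(x,y)` of `m`-tuples; the coordinates are `x_i(v) = v.1 i`, `y_i(v) = v.2 i`. -/
abbrev SympV (p t m : ℕ) [Fact p.Prime] : Type :=
  (Fin m → GaloisField p t) × (Fin m → GaloisField p t)

/-- The nonsingular alternating bilinear form
`⟨(x,y),(x',y')⟩ = Σ_i (x_i y'_i − y_i x'_i)`. -/
def sform {p t m : ℕ} [Fact p.Prime] (v w : SympV p t m) : GaloisField p t :=
  ∑ i, (v.1 i * w.2 i - v.2 i * w.1 i)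

/-- Membership in the symplectic group `Sp(V)`: a linear automorphism of `V`
preserving the form. -/
def IsSymp {p t m : ℕ} [Fact p.Prime]
    (g : SympV p t m ≃ₗ[GaloisField p t] SympV p t m) : Prop :=
  ∀ v w, sform (g v) (g w) = sform v w

/-- A `k`-subspace `M` of `k[V]` is `Sp(V)`-stable (a `kSp(V)`-submodule) if it is
closed under the action `(g·f)(v) = f(g⁻¹v)`. -/
def SpStable {p t m : ℕ} [Fact p.Prime]
    (M : Submodule (GaloisField p t) (SympV p t m → GaloisField p t)) : Prop :=
  ∀ g : SympV p t m ≃ₗ[GaloisField p t] SympV p t m, IsSymp g →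
    ∀ h ∈ M, (fun v => h (g.symm v)) ∈ M

/-- The monomial `x^α y^β = ∏_i x_i^{α_i} y_i^{β_i}` as a function `V → k`. -/
def mono {p t m : ℕ} [Fact p.Prime] (α β : Fin m → ℕ) :
    SympV p t m → GaloisField p t :=
  fun v => ∏ i, (v.1 i ^ α i * v.2 i ^ β i)

/-- The complementary multi-index `ᾱ = (p−1−α₁,…,p−1−α_m)`. -/
def abar (p : ℕ) {m : ℕ} (α : Fin m → ℕ) : Fin m → ℕ := fun i => p - 1 - α i

/-- `α! = ∏_i α_i!`, computed in the prime field `F_p ⊆ k`. -/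
def factk (p t : ℕ) [Fact p.Prime] {m : ℕ} (α : Fin m → ℕ) : GaloisField p t :=
  ∏ i, ((α i).factorial : GaloisField p t)

/-- Allowable `j`-th digit of a symplectic basis function, of degree `lam`;
`pl` records whether this digit counts towards the signature (a monomial
`x^α y^{ᾱ}` or a '+' binomial when `lam = m(p−1)`). -/
def IsDigit (p t m lam : ℕ) [Fact p.Prime] (pl : Prop)
    (g : SympV p t m → GaloisField p t) : Prop :=
  (lam ≠ m * (p - 1) ∧ ¬pl ∧
    ∃ α β : Fin m → ℕ, (∀ i, α i ≤ p - 1) ∧ (∀ i, β i ≤ p - 1) ∧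
      (∑ i, α i) + (∑ i, β i) = lam ∧ g = mono α β) ∨
  (lam = m * (p - 1) ∧ pl ∧
    ∃ α : Fin m → ℕ, (∀ i, α i ≤ p - 1) ∧ g = mono α (abar p α)) ∨
  (lam = m * (p - 1) ∧
    ∃ α β : Fin m → ℕ, (∀ i, α i ≤ p - 1) ∧ (∀ i, β i ≤ p - 1) ∧
      (∑ i, α i) + (∑ i, β i) = m * (p - 1) ∧ β ≠ abar p α ∧
      g = mono α β +
        ((if pl then (1 : GaloisField p t) else -1) *
          ((-1) ^ ((∑ i, β i) + m) * factk p t α * factk p t β)) •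
            mono (abar p β) (abar p α))

/-- `f` is a symplectic basis function of type `λ` with signature `ε`:
`f = f₀·f₁^p⋯f_{t−1}^{p^{t−1}}` with every digit `f_j` allowable of degree `λ_j`,
and `ε` is the set of digits of '+' kind. -/
def IsSBF (p t m : ℕ) [Fact p.Prime] (lam : Fin t → ℕ) (eps : Finset (Fin t))
    (f : SympV p t m → GaloisField p t) : Prop :=
  ∃ g : Fin t → (SympV p t m → GaloisField p t),
    (∀ j, IsDigit p t m (lam j) (j ∈ eps) (g j)) ∧
    f = fun v => ∏ j, (g j v) ^ (p ^ (j : ℕ))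

/-- The `j`-th `p`-adic digit of `d`. -/
def digitp (p d j : ℕ) : ℕ := d / p ^ j % p

/-- The type `λ` attached to a tuple `s` (for `d`): `λ_j = p·s_{j+1} − s_j + d_j`,
indices mod `t`. -/
def lamOf (p t d : ℕ) [NeZero t] (s : Fin t → ℤ) (j : Fin t) : ℤ :=
  (p : ℤ) * s (j + 1) - s j + digitp p d (j : ℕ)

/-- The type of `s` as a tuple of naturals. -/
def lamOfN (p t d : ℕ) [NeZero t] (s : Fin t → ℤ) (j : Fin t) : ℕ :=
  (lamOf p t d s j).toNat

/-- Membership in `H[d]`: `0 ≤ s_j ≤ 2m−1` and `0 ≤ λ_j ≤ 2m(p−1)` for all `j`. -/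
def memHd (p t m d : ℕ) [NeZero t] (s : Fin t → ℤ) : Prop :=
  (∀ j, 0 ≤ s j ∧ s j ≤ 2 * m - 1) ∧
  (∀ j, 0 ≤ lamOf p t d s j ∧ lamOf p t d s j ≤ 2 * m * ((p : ℤ) - 1))

/-- Membership in `H`: `1 ≤ s_j ≤ 2m−1` and `0 ≤ p·s_{j+1} − s_j ≤ 2m(p−1)`. -/
def memH (p t m : ℕ) [NeZero t] (s : Fin t → ℤ) : Prop :=
  (∀ j, 1 ≤ s j ∧ s j ≤ 2 * m - 1) ∧
  (∀ j, 0 ≤ lamOf p t 0 s j ∧ lamOf p t 0 s j ≤ 2 * m * ((p : ℤ) - 1))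

/-- `J(s) = {j : λ_j = m(p−1)}`. -/
def Jset (p t m d : ℕ) [NeZero t] (s : Fin t → ℤ) : Finset (Fin t) :=
  Finset.univ.filter (fun j => lamOf p t d s j = m * ((p : ℤ) - 1))

/-- Membership in `S[d]`: `s ∈ H[d]` and `ε ⊆ J(s)`. -/
def memSd (p t m d : ℕ) [NeZero t] (s : Fin t → ℤ) (eps : Finset (Fin t)) : Prop :=
  memHd p t m d s ∧ eps ⊆ Jset p t m d s

/-- Membership in `S`: `s ∈ H` and `ε ⊆ J(s)` (with `d = 0`). -/
def memS (p t m : ℕ) [NeZero t] (s : Fin t → ℤ) (eps : Finset (Fin t)) : Prop :=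
  memH p t m s ∧ eps ⊆ Jset p t m 0 s

/-- Case distinction: for `d ≠ 0` the relevant poset is `S[d]`, for `d = 0` it is `S`. -/
def memCase (p t m d : ℕ) [NeZero t] (s : Fin t → ℤ) (eps : Finset (Fin t)) : Prop :=
  if d = 0 then memS p t m s eps else memSd p t m d s eps

/-- `Z(s',s) = {j : s'_j = s_j, s'_{j+1} = s_{j+1}, λ'_j = m(p−1)}`. -/
def Zset (p t m d : ℕ) [NeZero t] (s' s : Fin t → ℤ) : Finset (Fin t) :=
  Finset.univ.filter (fun j =>
    s' j = s j ∧ s' (j + 1) = s (j + 1) ∧ lamOf p t d s' j = m * ((p : ℤ) - 1))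

/-- The order on `S[d]` (and on `S`): `(s',ε') ≤ (s,ε)` iff `s' ≤ s` pointwise and
`ε ∩ Z(s',s) = ε' ∩ Z(s',s)`. -/
def leSd (p t m d : ℕ) [NeZero t] (s' : Fin t → ℤ) (eps' : Finset (Fin t))
    (s : Fin t → ℤ) (eps : Finset (Fin t)) : Prop :=
  (∀ j, s' j ≤ s j) ∧ eps ∩ Zset p t m d s' s = eps' ∩ Zset p t m d s' s

/-- `Y(s,ε)[d]` (for `d ≠ 0`), resp. `Y(s,ε)` (for `d = 0`): the span in `k[V]` of all
symplectic basis functions with signed `H`-type `(s',ε') ≤ (s,ε)` in `S[d]`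
(resp. in `S`). -/
def Ymod (p t m d : ℕ) [Fact p.Prime] [NeZero t] (s : Fin t → ℤ)
    (eps : Finset (Fin t)) :
    Submodule (GaloisField p t) (SympV p t m → GaloisField p t) :=
  Submodule.span (GaloisField p t)
    {f | ∃ s' eps', memCase p t m d s' eps' ∧ leSd p t m d s' eps' s eps ∧
      IsSBF p t m (lamOfN p t d s') eps' f}

/-- `Y_<(s,ε)[d]`: the span of the symplectic basis functions with signed `H`-type
strictly below `(s,ε)`. -/
def Yltmod (p t m d : ℕ) [Fact p.Prime] [NeZero t] (s : Fin t → ℤ)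
    (eps : Finset (Fin t)) :
    Submodule (GaloisField p t) (SympV p t m → GaloisField p t) :=
  Submodule.span (GaloisField p t)
    {f | ∃ s' eps', memCase p t m d s' eps' ∧ leSd p t m d s' eps' s eps ∧
      ¬(s' = s ∧ eps' = eps) ∧ IsSBF p t m (lamOfN p t d s') eps' f}

/-- The radical of an `Sp(V)`-stable subspace `M` of `k[V]`: the intersection of all
maximal `Sp(V)`-stable proper subspaces of `M` (equal to `M` when there are none). -/
def SpRad (p t m : ℕ) [Fact p.Prime]
    (M : Submodule (GaloisField p t) (SympV p t m → GaloisField p t)) :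
    Submodule (GaloisField p t) (SympV p t m → GaloisField p t) :=
  M ⊓ sInf {N | N < M ∧ SpStable N ∧
    ∀ N', SpStable N' → N < N' → N' ≤ M → N' = M}

/-- Iterated radical: `rad⁰(M) = M`, `rad^{i+1}(M) = rad(rad^i(M))`. -/
def SpRadIter (p t m : ℕ) [Fact p.Prime]
    (M : Submodule (GaloisField p t) (SympV p t m → GaloisField p t)) :
    ℕ → Submodule (GaloisField p t) (SympV p t m → GaloisField p t)
  | 0 => M
  | i + 1 => SpRad p t m (SpRadIter p t m M i)

namespace RS

section gen
variable {K : Type} [Field K] {m : ℕ}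

/-- generic symplectic space -/
abbrev VV (K : Type) (m : ℕ) : Type := (Fin m → K) × (Fin m → K)

/-- generic symplectic form -/
def sf (v w : VV K m) : K := ∑ i, (v.1 i * w.2 i - v.2 i * w.1 i)

lemma sf_add_left (a b c : VV K m) : sf (a + b) c = sf a c + sf b c := by
  simp only [sf, ← Finset.sum_add_distrib]
  refine Finset.sum_congr rfl fun i _ => ?_
  simp only [Prod.fst_add, Prod.snd_add, Pi.add_apply]; ring

lemma sf_smul_left (k : K) (b c : VV K m) : sf (k • b) c = k * sf b c := by
  simp only [sf, Finset.mul_sum]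
  refine Finset.sum_congr rfl fun i _ => ?_
  simp only [Prod.smul_fst, Prod.smul_snd, Pi.smul_apply, smul_eq_mul]; ring

lemma sf_swap (a b : VV K m) : sf a b = - sf b a := by
  simp only [sf, ← Finset.sum_neg_distrib]
  refine Finset.sum_congr rfl fun i _ => ?_
  ring

lemma sf_self (a : VV K m) : sf a a = 0 := by
  simp only [sf]
  refine Finset.sum_eq_zero fun i _ => ?_
  ring

lemma sf_add_right (a b c : VV K m) : sf a (b + c) = sf a b + sf a c := by
  rw [sf_swap, sf_add_left, sf_swap a b, sf_swap a c]; ring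

lemma sf_smul_right (k : K) (b c : VV K m) : sf b (k • c) = k * sf b c := by
  rw [sf_swap, sf_smul_left, sf_swap b c]; ring

lemma sf_neg_right (b c : VV K m) : sf b (-c) = - sf b c := by
  have := sf_smul_right (-1) b c
  simpa using this

lemma sf_sub_right (a b c : VV K m) : sf a (b - c) = sf a b - sf a c := by
  rw [sub_eq_add_neg, sf_add_right, sf_neg_right]; ring

/-- transvection -/
def tv (u : VV K m) (c : K) (v : VV K m) : VV K m := v + (c * sf v u) • u

lemma tv_sf (u : VV K m) (c : K) (v w : VV K m) : sf (tv u c v) (tv u c w) = sf v w := by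
  simp only [tv, sf_add_left, sf_add_right, sf_smul_left, sf_smul_right, sf_self]
  rw [sf_swap u w]; ring

lemma tv_inv (u : VV K m) (c : K) (v : VV K m) : tv u (-c) (tv u c v) = v := by
  simp only [tv, sf_add_left, sf_smul_left, sf_self]
  rw [mul_zero, add_zero, add_assoc, ← add_smul]
  have : c * sf v u + -c * sf v u = 0 := by ring
  rw [this, zero_smul, add_zero]

lemma tv_fix (u : VV K m) (c : K) (v : VV K m) (h : sf v u = 0) : tv u c v = v := by
  simp [tv, h]

/-- linear transvection -/
def tvL (u : VV K m) (c : K) : VV K m →ₗ[K] VV K m where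
  toFun := tv u c
  map_add' a b := by
    simp only [tv, sf_add_left, mul_add, add_smul]; abel
  map_smul' k a := by
    simp only [tv, sf_smul_left, smul_add, RingHom.id_apply, smul_smul]
    congr 2; ring

/-- linear equivalence -/
def tvE (u : VV K m) (c : K) : VV K m ≃ₗ[K] VV K m where
  __ := tvL u c
  invFun := tv u (-c)
  left_inv v := tv_inv u c v
  right_inv v := by
    have := tv_inv u (-c) v
    rwa [neg_neg] at this

lemma tv_map (w z : VV K m) (h : sf w z ≠ 0) : tv (z - w) (1 / sf w z) w = z := by
  simp only [tv, sf_sub_right, sf_self]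
  rw [sub_zero, one_div, inv_mul_cancel₀ h, one_smul]; abel

/-- form preserving linear maps -/
def Symp (g : VV K m →ₗ[K] VV K m) : Prop := ∀ v w, sf (g v) (g w) = sf v w

variable (Good : (VV K m →ₗ[K] VV K m) → Prop)

lemma step_one (hT : ∀ u c g, Symp g → Good ((tvL u c).comp g) → Good g)
    (Fx : Set (VV K m)) (g : VV K m →ₗ[K] VV K m) (hg : Symp g)
    (hfix : ∀ v ∈ Fx, g v = v) (a z : VV K m) (hga : ∀ v ∈ Fx, sf v (g a) = 0)
    (hz : ∀ v ∈ Fx, sf v z = 0) (h : sf (g a) z ≠ 0)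
    (H : ∀ g', Symp g' → (∀ v ∈ Fx, g' v = v) → g' a = z → Good g') : Good g := by
  refine hT (z - g a) (1 / sf (g a) z) g hg (H _ ?_ ?_ ?_)
  · intro v w
    exact (tv_sf _ _ _ _).trans (hg v w)
  · intro v hv
    show tv _ _ (g v) = v
    rw [hfix v hv, tv_fix]
    rw [sf_sub_right, hz v hv, hga v hv, sub_zero]
  · exact tv_map _ _ h

lemma perp_g (Fx : Set (VV K m)) (g : VV K m →ₗ[K] VV K m) (hg : Symp g)
    (hfix : ∀ v ∈ Fx, g v = v) (a : VV K m) (ha : ∀ v ∈ Fx, sf v a = 0) :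
    ∀ v ∈ Fx, sf v (g a) = 0 := by
  intro v hv
  rw [← ha v hv, ← hg v a, hfix v hv]

lemma stepA (hT : ∀ u c g, Symp g → Good ((tvL u c).comp g) → Good g)
    (Fx : Set (VV K m)) (g : VV K m →ₗ[K] VV K m) (hg : Symp g)
    (hfix : ∀ v ∈ Fx, g v = v) (a b : VV K m) (ha : ∀ v ∈ Fx, sf v a = 0)
    (hb : ∀ v ∈ Fx, sf v b = 0) (hab : sf a b ≠ 0)
    (H : ∀ g', Symp g' → (∀ v ∈ Fx, g' v = v) → g' a = a → Good g') : Good g := by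
  have hga := perp_g Fx g hg hfix a ha
  have hgb := perp_g Fx g hg hfix b hb
  by_cases h0 : sf (g a) a = 0
  · obtain ⟨z, hz, h1, h2⟩ : ∃ z, (∀ v ∈ Fx, sf v z = 0) ∧ sf (g a) z ≠ 0 ∧ sf a z ≠ 0 := by
      by_cases h1 : sf (g a) b = 0
      · by_cases h2 : sf a (g b) = 0
        · refine ⟨b + g b, fun v hv => ?_, ?_, ?_⟩
          · rw [sf_add_right, hb v hv, hgb v hv, add_zero]
          · rw [sf_add_right, h1, hg, zero_add]; exact hab
          · rw [sf_add_right, h2, add_zero]; exact hab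
        · exact ⟨g b, hgb, by rw [hg]; exact hab, h2⟩
      · exact ⟨b, hb, h1, hab⟩
    refine step_one Good hT Fx g hg hfix a z hga hz h1 ?_
    intro g' hg' hf' hga'
    refine step_one Good hT Fx g' hg' hf' a a (by rw [hga']; exact hz) ha ?_ H
    rw [hga', sf_swap]
    exact neg_ne_zero.mpr h2
  · exact step_one Good hT Fx g hg hfix a a hga ha h0 H

lemma stepB (hT : ∀ u c g, Symp g → Good ((tvL u c).comp g) → Good g)
    (Fx : Set (VV K m)) (g : VV K m →ₗ[K] VV K m) (hg : Symp g)
    (hfix : ∀ v ∈ Fx, g v = v) (a b : VV K m) (ha : ∀ v ∈ Fx, sf v a = 0)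
    (hb : ∀ v ∈ Fx, sf v b = 0) (hab : sf a b ≠ 0) (hga : g a = a)
    (H : ∀ g', Symp g' → (∀ v ∈ Fx, g' v = v) → g' a = a → g' b = b → Good g') : Good g := by
  have key : ∀ g', Symp g' → (∀ v ∈ Fx, g' v = v) → g' a = a → sf (g' b) b ≠ 0 → Good g' := by
    intro g' hg' hf' ha' hne
    refine hT (b - g' b) (1 / sf (g' b) b) g' hg' (H _ ?_ ?_ ?_ ?_)
    · intro v w
      exact (tv_sf _ _ _ _).trans (hg' v w)
    · intro v hv
      show tv _ _ (g' v) = v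
      rw [hf' v hv, tv_fix]
      rw [sf_sub_right, hb v hv, perp_g Fx g' hg' hf' b hb v hv, sub_zero]
    · show tv _ _ (g' a) = a
      rw [ha', tv_fix]
      have : sf a (g' b) = sf a b := by rw [← hg' a b, ha']
      rw [sf_sub_right, this, sub_self]
    · exact tv_map _ _ hne
  by_cases h0 : sf (g b) b = 0
  · refine hT a 1 g hg (key _ ?_ ?_ ?_ ?_)
    · intro v w
      exact (tv_sf _ _ _ _).trans (hg v w)
    · intro v hv
      show tv _ _ (g v) = v
      rw [hfix v hv, tv_fix _ _ _ (ha v hv)]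
    · show tv _ _ (g a) = a
      rw [hga, tv_fix _ _ _ (sf_self a)]
    · show sf (tv a 1 (g b)) b ≠ 0
      simp only [tv, sf_add_left, sf_smul_left, h0, zero_add, one_mul]
      have : sf (g b) a = - sf a b := by
        rw [sf_swap, ← hg a b, hga]
      rw [this]
      exact mul_ne_zero (neg_ne_zero.mpr hab) hab
  · exact key g hg hfix hga h0

/-- basis vectors -/
def ee (i : Fin m) : VV K m := (Pi.single i 1, 0)
/-- basis vectors -/
def ff (i : Fin m) : VV K m := (0, Pi.single i 1)

lemma sf_ee_ee (i j : Fin m) : sf (ee i : VV K m) (ee j) = 0 := by simp [sf, ee]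
lemma sf_ff_ff (i j : Fin m) : sf (ff i : VV K m) (ff j) = 0 := by simp [sf, ff]
lemma sf_ee_ff (i j : Fin m) : sf (ee i : VV K m) (ff j) = if i = j then 1 else 0 := by
  simp [sf, ee, ff, Pi.single_apply, eq_comm]

theorem sp_gen (hT : ∀ u c g, Symp g → Good ((tvL u c).comp g) → Good g)
    (h1 : Good LinearMap.id) : ∀ g, Symp g → Good g := by
  have main : ∀ B : Finset (Fin m), ∀ g, Symp g →
      (∀ i ∉ B, g (ee i) = ee i ∧ g (ff i) = ff i) → Good g := by
    intro B
    induction B using Finset.induction with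
    | empty =>
      intro g hg hfix
      have : g = LinearMap.id := by
        apply LinearMap.prod_ext
        · apply LinearMap.pi_ext'
          intro i
          ext : 1
          exact (hfix i (by simp)).1
        · apply LinearMap.pi_ext'
          intro i
          ext : 1
          exact (hfix i (by simp)).2
      rw [this]; exact h1
    | insert r B hr ih =>
      intro g hg hfix
      set Fx : Set (VV K m) := {v | ∃ i, i ∉ insert r B ∧ (v = ee i ∨ v = ff i)} with hFx
      have f0 : ∀ v ∈ Fx, g v = v := by
        rintro v ⟨i, hi, rfl | rfl⟩
        · exact (hfix i hi).1
        · exact (hfix i hi).2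
      have fa : ∀ v ∈ Fx, sf v (ee r) = 0 := by
        rintro v ⟨i, hi, rfl | rfl⟩
        · exact sf_ee_ee _ _
        · rw [sf_swap, sf_ee_ff, if_neg, neg_zero]
          rintro rfl; simp at hi
      have fb : ∀ v ∈ Fx, sf v (ff r) = 0 := by
        rintro v ⟨i, hi, rfl | rfl⟩
        · rw [sf_ee_ff, if_neg]
          rintro rfl; simp at hi
        · exact sf_ff_ff _ _
      have hab : sf (ee r : VV K m) (ff r) ≠ 0 := by rw [sf_ee_ff]; simp
      refine stepA Good hT Fx g hg f0 (ee r) (ff r) fa fb hab ?_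
      intro g1 hg1 f1 ha1
      refine stepB Good hT Fx g1 hg1 f1 (ee r) (ff r) fa fb hab ha1 ?_
      intro g2 hg2 f2 ha2 hb2
      refine ih g2 hg2 ?_
      intro i hi
      by_cases hir : i = r
      · subst hir; exact ⟨ha2, hb2⟩
      · have : i ∉ insert r B := by simp [hir, hi]
        exact ⟨f2 _ ⟨i, this, Or.inl rfl⟩, f2 _ ⟨i, this, Or.inr rfl⟩⟩
  intro g hg
  exact main Finset.univ g hg (by simp)

/-- Stability under all transvections of a space of functions implies stability under
all form preserving linear maps. -/
theorem stable_of_tv (M : Submodule K (VV K m → K))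
    (hM : ∀ u c, ∀ f ∈ M, (fun v => f (tv u c v)) ∈ M) :
    ∀ g : VV K m →ₗ[K] VV K m, Symp g → ∀ f ∈ M, (fun v => f (g v)) ∈ M := by
  refine sp_gen (fun g => ∀ f ∈ M, (fun v => f (g v)) ∈ M) ?_ (fun f hf => hf)
  intro u c g _ h f hf
  have h2 := h _ (hM u (-c) f hf)
  have : (fun v => f (tv u (-c) (((tvL u c).comp g) v))) = fun v => f (g v) := by
    funext v
    show f (tv u (-c) (tv u c (g v))) = _
    rw [tv_inv]
  rwa [this] at h2

end gen

end RS

namespace RS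

section poly
open MvPolynomial
variable {K : Type} [Field K] {m : ℕ}

/-- variables -/
abbrev ZZ (m : ℕ) : Type := Fin m ⊕ Fin m
/-- digit polynomials -/
abbrev PP (K : Type) [Field K] (m : ℕ) : Type := MvPolynomial (Fin m ⊕ Fin m) K

/-- coordinates of a vector -/
def pt (v : VV K m) : ZZ m → K := Sum.elim v.1 v.2

/-- evaluation -/
def ev (h : PP K m) (v : VV K m) : K := eval (pt v) h

/-- dual variable -/
def LL (z : ZZ m) : PP K m := Sum.elim (fun i => - X (Sum.inr i)) (fun i => X (Sum.inl i)) z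

/-- the linear form attached to `u` -/
def ell (u : VV K m) : PP K m := ∑ z, C (pt u z) * LL z

lemma ev_ell (u v : VV K m) : ev (ell u) v = sf v u := by
  simp only [ev, ell, sf, Fintype.sum_sum_type, pt, LL, Sum.elim_inl,
    Sum.elim_inr, ← Finset.sum_add_distrib, map_sum]
  refine Finset.sum_congr rfl fun i _ => ?_
  simp only [map_add, map_mul, eval_C, map_neg, eval_X, Sum.elim_inl, Sum.elim_inr]
  ring

/-- derivation `ell u * d_u` -/
def Qd (u : VV K m) : Derivation K (PP K m) (PP K m) :=
  mkDerivation K (fun z => C (pt u z) * ell u)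

lemma Qd_X (u : VV K m) (z : ZZ m) : Qd u (X z) = C (pt u z) * ell u := by
  simp [Qd]

lemma Qd_eq (u : VV K m) (h : PP K m) :
    Qd u h = ell u * ∑ z, C (pt u z) * pderiv z h := by
  have hC : ∀ a : K, Qd u (C a) = 0 := fun a => by
    have := (Qd u).map_algebraMap a
    simpa [MvPolynomial.algebraMap_eq] using this
  induction h using MvPolynomial.induction_on with
  | C a => simp [hC]
  | add f g hf hg =>
    simp only [map_add, hf, hg, mul_add, Finset.sum_add_distrib]
  | mul_X f w hf =>
    rw [Derivation.leibniz, hf, Qd_X]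
    simp only [Derivation.leibniz, smul_eq_mul, mul_add, Finset.sum_add_distrib]
    congr 1
    · rw [Finset.sum_eq_single w]
      · rw [pderiv_X_self]; ring
      · intro b _ hb
        rw [pderiv_X_of_ne hb.symm, mul_zero, mul_zero]
      · simp
    · rw [Finset.mul_sum, Finset.mul_sum, Finset.mul_sum]
      refine Finset.sum_congr rfl fun z _ => by ring

lemma Qd_C (u : VV K m) (a : K) : Qd u (C a) = 0 := by
  have := (Qd u).map_algebraMap a
  simp

lemma Qd_ell (u : VV K m) : Qd u (ell u) = 0 := by
  have e : Qd u (ell u) = ∑ z, C (pt u z) * Qd u (LL z) := by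
    conv_lhs => rw [ell]
    rw [map_sum]
    refine Finset.sum_congr rfl fun z _ => ?_
    rw [Derivation.leibniz, Qd_C, smul_zero, add_zero, smul_eq_mul]
  rw [e, Fintype.sum_sum_type, ← Finset.sum_add_distrib]
  refine Finset.sum_eq_zero fun i _ => ?_
  simp only [LL, Sum.elim_inl, Sum.elim_inr, map_neg, Qd_X]
  ring

lemma ell_pow_dvd (u : VV K m) (h : PP K m) (r : ℕ) : ell u ^ r ∣ (Qd u)^[r] h := by
  induction r with
  | zero => simp
  | succ r ih =>
    rw [Function.iterate_succ_apply']
    obtain ⟨g, hg⟩ := ih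
    rw [hg, Derivation.leibniz, Derivation.leibniz_pow, Qd_ell, smul_zero, smul_zero, smul_zero,
      add_zero, Qd_eq, smul_eq_mul, pow_succ]
    exact mul_dvd_mul_left _ (Dvd.intro _ rfl)

/-- algebra endomorphism realising a transvection -/
def th (u : VV K m) (c : K) : PP K m →ₐ[K] PP K m :=
  aeval (fun z => X z + C (c * pt u z) * ell u)

lemma ev_th (u : VV K m) (c : K) (h : PP K m) (v : VV K m) :
    ev (th u c h) v = ev h (tv u c v) := by
  have e1 : ∀ z, pt (tv u c v) z = eval (pt v) (X z + C (c * pt u z) * ell u) := by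
    intro z
    have := ev_ell u v
    rw [ev] at this
    rw [map_add, map_mul, eval_X, eval_C, this]
    rcases z with i | i <;> simp [pt, tv] <;> ring
  have : (eval (pt v)).comp (th u c).toRingHom = eval (pt (tv u c v)) := by
    apply MvPolynomial.ringHom_ext
    · intro r
      simp [th]
    · intro z
      rw [eval_X, e1]
      simp [th]
  exact congrArg (fun f => f h) this

/-- the ideal generated by `p`-th powers of the variables -/
def II (K : Type) [Field K] (m p : ℕ) : Ideal (PP K m) :=
  Ideal.span ((fun s => (monomial s) (1 : K)) '' {e | ∃ z, e = Finsupp.single z p})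

lemma mem_II {p : ℕ} {h : PP K m} : h ∈ II K m p ↔ ∀ e ∈ h.support, ∃ z, p ≤ e z := by
  rw [II, mem_ideal_span_monomial_image]
  refine forall₂_congr fun e _ => ?_
  constructor
  · rintro ⟨_, ⟨z, rfl⟩, hle⟩
    refine ⟨z, ?_⟩
    have := hle z
    simpa using this
  · rintro ⟨z, hz⟩
    exact ⟨_, ⟨z, rfl⟩, by simpa using hz⟩

lemma X_pow_mem_II (p : ℕ) (z : ZZ m) : (X z ^ p : PP K m) ∈ II K m p := by
  apply Ideal.subset_span
  exact ⟨_, ⟨z, rfl⟩, by rw [X_pow_eq_monomial]⟩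

lemma ell_hom (u : VV K m) : (ell u).IsHomogeneous 1 := by
  rw [ell]
  refine IsHomogeneous.sum _ _ _ fun z _ => ?_
  refine IsHomogeneous.C_mul ?_ _
  rcases z with i | i
  · exact (isHomogeneous_X K _).neg
  · exact isHomogeneous_X K _

lemma th_hom (u : VV K m) (c : K) {h : PP K m} {n : ℕ} (hh : h.IsHomogeneous n) :
    (th u c h).IsHomogeneous n := by
  have := hh.aeval (S := K) (fun z => X z + C (c * pt u z) * ell u) (n := 1) (fun z => by
    exact (isHomogeneous_X K _).add ((ell_hom u).C_mul _))
  rwa [one_mul] at this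

lemma Qd_hom (u : VV K m) {h : PP K m} {n : ℕ} (hh : h.IsHomogeneous n) :
    (Qd u h).IsHomogeneous n := by
  rw [Qd_eq]
  rcases n with _ | n
  · have : h = C (coeff 0 h) := by
      apply totalDegree_eq_zero_iff_eq_C.mp
      exact Nat.le_zero.mp hh.totalDegree_le
    rw [this]
    simp [isHomogeneous_zero]
  · rw [add_comm n 1]
    refine (ell_hom u).mul ?_
    refine IsHomogeneous.sum _ _ _ fun z _ => ?_
    exact IsHomogeneous.C_mul (by simpa using hh.pderiv (i := z)) _

variable {p : ℕ} [hp : Fact p.Prime] [CharP K p]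

lemma ell_pow_mem (u : VV K m) : ell u ^ p ∈ II K m p := by
  haveI : ExpChar (PP K m) p := ExpChar.prime hp.out
  rw [ell, sum_pow_char]
  refine Ideal.sum_mem _ fun z _ => ?_
  rw [mul_pow]
  refine Ideal.mul_mem_left _ _ ?_
  rcases z with i | i
  · simp only [LL, Sum.elim_inl]
    rw [neg_pow]
    exact Ideal.mul_mem_left _ _ (X_pow_mem_II p _)
  · exact X_pow_mem_II p _

lemma deriv_mem_II (D : Derivation K (PP K m) (PP K m)) {h : PP K m} (hh : h ∈ II K m p) :
    D h ∈ II K m p := by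
  rw [II] at hh
  refine Submodule.span_induction (p := fun h _ => D h ∈ II K m p) ?_ ?_ ?_ ?_ hh
  · rintro _ ⟨_, ⟨z, rfl⟩, rfl⟩
    have : (monomial (Finsupp.single z p)) (1 : K) = X z ^ p := by rw [X_pow_eq_monomial]
    simp only [this]
    rw [Derivation.leibniz_pow, nsmul_eq_mul]
    have : ((p : ℕ) : PP K m) = 0 := CharP.cast_eq_zero _ p
    rw [this, zero_mul]
    exact Ideal.zero_mem _
  · simp
  · intro x y _ _ hx hy
    rw [map_add]; exact Ideal.add_mem _ hx hy
  · intro a x hx hDx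
    rw [smul_eq_mul, Derivation.leibniz, smul_eq_mul, smul_eq_mul]
    refine Ideal.add_mem _ (Ideal.mul_mem_left _ _ hDx) (Ideal.mul_mem_right _ _ ?_)
    exact hx

lemma Qd_iter_mul_X (u : VV K m) (h : PP K m) (z : ZZ m) (r : ℕ) :
    (Qd u)^[r] (h * X z) = (Qd u)^[r] h * X z +
      (r : PP K m) * ((Qd u)^[r - 1] h * (C (pt u z) * ell u)) := by
  have hC : Qd u (C (pt u z) * ell u) = 0 := by
    rw [Derivation.leibniz, Qd_ell]
    have := (Qd u).map_algebraMap (pt u z)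
    simp only [MvPolynomial.algebraMap_eq] at this
    rw [this]; simp
  induction r with
  | zero => simp
  | succ r ih =>
    rw [Function.iterate_succ_apply', ih, map_add, Derivation.leibniz, Qd_X]
    rw [Derivation.leibniz, Derivation.leibniz _ _ (C (pt u z) * ell u), hC]
    have hn : Qd u (r : PP K m) = 0 := by
      exact (Qd u).map_natCast r
    rw [hn]
    simp only [smul_eq_mul, ← Function.iterate_succ_apply' (⇑(Qd u))]
    rcases r with _ | r
    · simp; ring
    · simp only [Nat.add_sub_cancel, Nat.succ_eq_add_one]
      push_cast
      ring

/-- truncated exponential -/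
def tay (p : ℕ) (u : VV K m) (c : K) (h : PP K m) : PP K m :=
  ∑ r ∈ Finset.range p, C (c ^ r / (r.factorial : K)) * (Qd u)^[r] h

lemma tay_mul_X (u : VV K m) (c : K) (h : PP K m) (z : ZZ m) :
    tay p u c (h * X z) - tay p u c h * (X z + C (c * pt u z) * ell u) ∈ II K m p := by
  obtain ⟨n, rfl⟩ : ∃ n, p = n + 1 := ⟨p - 1, by have := hp.out.pos; omega⟩
  have hfac : ∀ r, r < n + 1 → (r.factorial : K) ≠ 0 := by
    intro r hr h0
    rw [CharP.cast_eq_zero_iff K (n + 1), hp.out.dvd_factorial] at h0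
    omega
  have e1 : tay (n + 1) u c (h * X z) = tay (n + 1) u c h * X z +
      ∑ r ∈ Finset.range n, C (c ^ r / (r.factorial : K)) * (Qd u)^[r] h *
        (C (c * pt u z) * ell u) := by
    simp only [tay, Qd_iter_mul_X, mul_add, Finset.sum_add_distrib, Finset.sum_mul]
    congr 1
    · refine Finset.sum_congr rfl fun r _ => by ring
    · rw [Finset.sum_range_succ']
      simp only [Nat.cast_zero, zero_mul, mul_zero, add_zero, Nat.add_sub_cancel]
      refine Finset.sum_congr rfl fun r hr => ?_
      have hr' := Finset.mem_range.mp hr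
      have h1 := hfac (r + 1) (by omega)
      have : (C (c ^ (r + 1) / ((r + 1).factorial : K)) : PP K m) * ((r + 1 : ℕ) : PP K m) =
          C (c ^ r / (r.factorial : K)) * C c := by
        rw [show ((r + 1 : ℕ) : PP K m) = C ((r + 1 : ℕ) : K) by simp, ← C_mul, ← C_mul]
        congr 1
        have h2 := hfac r (by omega)
        rw [Nat.factorial_succ, Nat.cast_mul] at h1 ⊢
        have h3 : ((r + 1 : ℕ) : K) ≠ 0 := left_ne_zero_of_mul h1
        field_simp
        rw [pow_succ]
      rw [C_mul, ← mul_assoc, this]; ring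
  have e2 : tay (n + 1) u c h * (X z + C (c * pt u z) * ell u) = tay (n + 1) u c h * X z +
      (∑ r ∈ Finset.range n, C (c ^ r / (r.factorial : K)) * (Qd u)^[r] h *
        (C (c * pt u z) * ell u)) +
      C (c ^ n / (n.factorial : K)) * (Qd u)^[n] h * (C (c * pt u z) * ell u) := by
    rw [mul_add, add_assoc]
    congr 1
    rw [tay, Finset.sum_range_succ, add_mul, Finset.sum_mul]
  rw [e1, e2, sub_add_cancel_left, neg_mem_iff]
  obtain ⟨g, hg⟩ := ell_pow_dvd u h n
  rw [hg]
  have := Ideal.mul_mem_left (II K m (n + 1))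
    (C (c ^ n / (n.factorial : K)) * g * C (c * pt u z)) (ell_pow_mem (p := n + 1) u)
  convert this using 1
  ring

lemma taylor (u : VV K m) (c : K) (h : PP K m) : th u c h - tay p u c h ∈ II K m p := by
  induction h using MvPolynomial.induction_on with
  | C a =>
    have hC : Qd u (C a) = 0 := by
      have := (Qd u).map_algebraMap a
      simpa [MvPolynomial.algebraMap_eq] using this
    have h0 : ∀ r, (Qd u)^[r] (0 : PP K m) = 0 := by
      intro r
      induction r with
      | zero => rfl
      | succ r ih => rw [Function.iterate_succ_apply, map_zero, ih]
    have : tay p u c (C a : PP K m) = C a := by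
      rw [tay, Finset.sum_eq_single 0]
      · simp
      · intro r _ hr
        obtain ⟨r, rfl⟩ := Nat.exists_eq_succ_of_ne_zero hr
        rw [Function.iterate_succ_apply, hC, h0, mul_zero]
      · intro h; simp [hp.out.ne_zero] at h
    rw [this]
    simp [th]
  | add f g hf hg =>
    have hadd : ∀ r, (Qd u)^[r] (f + g) = (Qd u)^[r] f + (Qd u)^[r] g := by
      intro r
      induction r with
      | zero => rfl
      | succ r ih => simp only [Function.iterate_succ_apply', ih, map_add]
    have : tay p u c (f + g) = tay p u c f + tay p u c g := by
      simp only [tay, hadd, mul_add, Finset.sum_add_distrib]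
    rw [this, map_add, add_sub_add_comm]
    exact Ideal.add_mem _ hf hg
  | mul_X f z hf =>
    have h1 := tay_mul_X (p := p) u c f z
    have h2 := Ideal.mul_mem_right (X z + C (c * pt u z) * ell u) _ hf
    have h3 : th u c (f * X z) = th u c f * (X z + C (c * pt u z) * ell u) := by
      rw [map_mul]; congr 1; simp [th]
    rw [h3]
    have := Ideal.sub_mem _ h2 h1
    convert this using 1
    ring

end poly

end RS

namespace RS

section four
open MvPolynomial
variable {K : Type} [Field K] {m : ℕ}

/-- exponent of the Fourier image -/
def bar (p : ℕ) (e : ZZ m →₀ ℕ) : ZZ m →₀ ℕ :=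
  Finsupp.equivFunOnFinite.symm (Sum.elim (fun i => e (Sum.inl i)) (fun i => p - 1 - e (Sum.inr i)))

@[simp] lemma bar_inl (p : ℕ) (e : ZZ m →₀ ℕ) (i : Fin m) : bar p e (Sum.inl i) = e (Sum.inl i) := rfl
@[simp] lemma bar_inr (p : ℕ) (e : ZZ m →₀ ℕ) (i : Fin m) :
    bar p e (Sum.inr i) = p - 1 - e (Sum.inr i) := rfl

/-- factorial factor -/
def fac (K : Type) [Field K] (e : ZZ m →₀ ℕ) : K := ∏ i, ((e (Sum.inr i)).factorial : K)

/-- partial Fourier transform -/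
def FF (K : Type) [Field K] (m p : ℕ) : PP K m →ₗ[K] PP K m :=
  (basisMonomials (ZZ m) K).constr K (fun e => monomial (bar p e) (fac K e))

lemma FF_monomial (p : ℕ) (e : ZZ m →₀ ℕ) (c : K) :
    FF K m p (monomial e c) = monomial (bar p e) (c * fac K e) := by
  have h1 : FF K m p (monomial e 1) = monomial (bar p e) (fac K e) := by
    have := (basisMonomials (ZZ m) K).constr_basis K (fun e => monomial (bar p e) (fac K e)) e
    rwa [coe_basisMonomials] at this
  have h2 : (monomial e c : PP K m) = c • monomial e 1 := by
    rw [smul_monomial, smul_eq_mul, mul_one]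
  rw [h2, map_smul, h1, smul_monomial, smul_eq_mul]

lemma fac_add (e : ZZ m →₀ ℕ) (i : Fin m) :
    fac K (e + Finsupp.single (Sum.inr i) 1) = (e (Sum.inr i) + 1) * fac K e := by
  rw [fac, fac, ← Finset.mul_prod_erase Finset.univ _ (Finset.mem_univ i),
    ← Finset.mul_prod_erase Finset.univ (fun i => ((e (Sum.inr i)).factorial : K)) (Finset.mem_univ i),
    ← mul_assoc]
  congr 1
  · simp [Nat.factorial_succ]
  · refine Finset.prod_congr rfl fun j hj => ?_
    have : j ≠ i := Finset.ne_of_mem_erase hj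
    simp [Finsupp.single_apply, this.symm]

lemma fac_add_inl (e : ZZ m →₀ ℕ) (i : Fin m) :
    fac K (e + Finsupp.single (Sum.inl i) 1) = fac K e := by
  simp [fac]

lemma fac_sub_inl (e : ZZ m →₀ ℕ) (i : Fin m) :
    fac K (e - Finsupp.single (Sum.inl i) 1) = fac K e := by
  simp [fac]

lemma fac_sub (e : ZZ m →₀ ℕ) (i : Fin m) (h : 1 ≤ e (Sum.inr i)) :
    (e (Sum.inr i) : K) * fac K (e - Finsupp.single (Sum.inr i) 1) = fac K e := by
  have := fac_add (K := K) (e - Finsupp.single (Sum.inr i) 1) i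
  rw [tsub_add_cancel_of_le (by simpa using h)] at this
  rw [this]
  congr 1
  simp only [Finsupp.coe_tsub, Pi.sub_apply, Finsupp.single_eq_same]
  rw [Nat.cast_sub h]; simp

/-- Fourier side of multiplication by the dual variable -/
def LLh (z : ZZ m) : PP K m →ₗ[K] PP K m :=
  Sum.elim (fun i => - (pderiv (Sum.inr i) : Derivation K (PP K m) (PP K m)).toLinearMap)
    (fun i => LinearMap.mulLeft K (X (Sum.inl i) : PP K m)) z

/-- Fourier side of partial derivative -/
def dh (z : ZZ m) : PP K m →ₗ[K] PP K m :=
  Sum.elim (fun i => (pderiv (Sum.inl i) : Derivation K (PP K m) (PP K m)).toLinearMap)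
    (fun i => - LinearMap.mulLeft K (X (Sum.inr i) : PP K m)) z

@[simp] lemma LLh_inl (i : Fin m) (f : PP K m) : LLh (Sum.inl i) f = - pderiv (Sum.inr i) f := rfl
@[simp] lemma LLh_inr (i : Fin m) (f : PP K m) : LLh (Sum.inr i) f = X (Sum.inl i) * f := rfl
@[simp] lemma dh_inl (i : Fin m) (f : PP K m) : dh (Sum.inl i) f = pderiv (Sum.inl i) f := rfl
@[simp] lemma dh_inr (i : Fin m) (f : PP K m) : dh (Sum.inr i) f = - (X (Sum.inr i) * f) := rfl

lemma X_mul_mon (z : ZZ m) (e : ZZ m →₀ ℕ) (c : K) :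
    (X z * monomial e c : PP K m) = monomial (e + Finsupp.single z 1) c := by
  rw [X, monomial_mul, one_mul, add_comm]

lemma pderiv_comm (a b : ZZ m) (f : PP K m) : pderiv a (pderiv b f) = pderiv b (pderiv a f) := by
  ext e
  simp only [coeff_pderiv]
  rw [add_right_comm]
  by_cases h : a = b
  · subst h; rfl
  · simp [Finsupp.single_apply, h, Ne.symm h]; ring

/-- commutator scalars -/
def om (K : Type) [Field K] (w z : ZZ m) : K :=
  match w, z with
  | Sum.inl i, Sum.inr l => if i = l then 1 else 0
  | Sum.inr i, Sum.inl l => if i = l then -1 else 0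
  | _, _ => 0

lemma dh_LLh (w z : ZZ m) (f : PP K m) : dh w (LLh z f) = LLh z (dh w f) + om K w z • f := by
  rcases w with i | i <;> rcases z with l | l
  · simp [om, pderiv_comm]
  · simp only [om, dh_inl, LLh_inr, Derivation.leibniz, smul_eq_mul]
    congr 1
    by_cases h : i = l
    · subst h; simp
    · simp [pderiv_X, Pi.single_apply, h, Ne.symm h]
  · simp only [om, dh_inr, LLh_inl, map_neg, Derivation.leibniz, smul_eq_mul]
    by_cases h : i = l
    · subst h; simp
    · simp [pderiv_X, Pi.single_apply, h, Ne.symm h]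
  · simp [om]; ring

/-- summed version -/
def LLu (u : VV K m) : PP K m →ₗ[K] PP K m := ∑ z, pt u z • LLh z
/-- summed version -/
def du (u : VV K m) : PP K m →ₗ[K] PP K m := ∑ z, pt u z • dh z

lemma LLu_apply (u : VV K m) (f : PP K m) : LLu u f = ∑ z, pt u z • LLh z f := by
  simp [LLu, LinearMap.sum_apply]
lemma du_apply (u : VV K m) (f : PP K m) : du u f = ∑ z, pt u z • dh z f := by
  simp [du, LinearMap.sum_apply]

lemma du_LLu (u : VV K m) (f : PP K m) : du u (LLu u f) = LLu u (du u f) := by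
  have e1 : du u (LLu u f) = ∑ w, ∑ z, (pt u w * pt u z) • dh w (LLh z f) := by
    rw [du_apply]
    refine Finset.sum_congr rfl fun w _ => ?_
    rw [LLu_apply, map_sum, Finset.smul_sum]
    refine Finset.sum_congr rfl fun z _ => ?_
    rw [map_smul, smul_smul]
  have e2 : LLu u (du u f) = ∑ w, ∑ z, (pt u w * pt u z) • LLh z (dh w f) := by
    rw [LLu_apply, Finset.sum_comm]
    refine Finset.sum_congr rfl fun w _ => ?_
    rw [du_apply, map_sum, Finset.smul_sum]
    refine Finset.sum_congr rfl fun z _ => ?_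
    rw [map_smul, smul_smul, mul_comm]
  rw [e1, e2]
  simp only [dh_LLh, smul_add, Finset.sum_add_distrib, smul_smul, ← Finset.sum_smul]
  have : ∑ w, ∑ z, pt u w * pt u z * om K w z = 0 := by
    simp [Fintype.sum_sum_type, om, Finset.sum_ite_eq]
    rw [← Finset.sum_neg_distrib, ← Finset.sum_add_distrib]
    refine Finset.sum_eq_zero fun i _ => ?_
    ring
  rw [this, zero_smul, add_zero]

/-- exchange of the two groups of variables -/
def sw (K : Type) [Field K] (m : ℕ) : PP K m →ₐ[K] PP K m := rename Sum.swap

/-- exchange on exponents -/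
def swE (e : ZZ m →₀ ℕ) : ZZ m →₀ ℕ := Finsupp.mapDomain Sum.swap e

@[simp] lemma swE_apply (e : ZZ m →₀ ℕ) (z : ZZ m) : swE e z = e (Sum.swap z) := by
  have := Finsupp.mapDomain_equiv_apply (f := Equiv.sumComm (Fin m) (Fin m)) e z
  exact this

@[simp] lemma swE_swE (e : ZZ m →₀ ℕ) : swE (swE e) = e := by
  ext z; simp

lemma sw_monomial (e : ZZ m →₀ ℕ) (c : K) : sw K m (monomial e c) = monomial (swE e) c :=
  rename_monomial _ _ _

@[simp] lemma sw_sw (f : PP K m) : sw K m (sw K m f) = f := by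
  rw [sw, rename_rename]
  simp

lemma sw_LLh (z : ZZ m) (f : PP K m) : sw K m (LLh z f) = - dh z (sw K m f) := by
  rcases z with i | i
  · simp only [LLh_inl, dh_inl, map_neg]
    rw [sw, ← pderiv_rename (Function.LeftInverse.injective Sum.swap_leftInverse)]
    rfl
  · simp [sw]

lemma sw_dh (z : ZZ m) (f : PP K m) : sw K m (dh z f) = - LLh z (sw K m f) := by
  have := sw_LLh z (sw K m f)
  rw [sw_sw] at this
  have h2 : dh z f = - sw K m (LLh z (sw K m f)) := by rw [this, neg_neg]
  rw [h2, map_neg, sw_sw]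

/-- Fourier side of `Qd` -/
def Qh (u : VV K m) : PP K m →ₗ[K] PP K m := (LLu u).comp (du u)

lemma sw_Qh (u : VV K m) (f : PP K m) : sw K m (Qh u f) = Qh u (sw K m f) := by
  have h1 : ∀ f, sw K m (LLu u f) = - du u (sw K m f) := by
    intro f
    rw [LLu_apply, du_apply, map_sum, ← Finset.sum_neg_distrib]
    refine Finset.sum_congr rfl fun z _ => ?_
    rw [map_smul, sw_LLh, smul_neg]
  have h2 : ∀ f, sw K m (du u f) = - LLu u (sw K m f) := by
    intro f
    rw [LLu_apply, du_apply, map_sum, ← Finset.sum_neg_distrib]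
    refine Finset.sum_congr rfl fun z _ => ?_
    rw [map_smul, sw_dh, smul_neg]
  rw [Qh, LinearMap.comp_apply, h1, h2, map_neg, neg_neg, du_LLu]
  rfl

/-- signed Fourier transform -/
def SS (m p : ℕ) (c : K) : PP K m →ₗ[K] PP K m :=
  FF K m p + c • (FF K m p).comp (sw K m).toLinearMap

lemma SS_apply (p : ℕ) (c : K) (f : PP K m) :
    SS m p c f = FF K m p f + c • FF K m p (sw K m f) := rfl

/-- charge of an exponent -/
def chg (e : ZZ m →₀ ℕ) : ℤ := (∑ i, (e (Sum.inl i) : ℤ)) - ∑ i, (e (Sum.inr i) : ℤ)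

/-- polynomials of given charge -/
def CH (K : Type) [Field K] (m : ℕ) (n : ℤ) : Submodule K (PP K m) where
  carrier := {f | ∀ e, coeff e f ≠ 0 → chg e = n}
  add_mem' {f g} hf hg e he := by
    by_contra hn
    have h1 : coeff e f = 0 := by by_contra h; exact hn (hf e h)
    have h2 : coeff e g = 0 := by by_contra h; exact hn (hg e h)
    exact he (by rw [coeff_add, h1, h2, add_zero])
  zero_mem' e he := by simp at he
  smul_mem' c f hf e he := by
    apply hf e
    intro h
    exact he (by rw [coeff_smul, h, smul_zero])

lemma mon_mem_CH {n : ℤ} {e : ZZ m →₀ ℕ} (c : K) (h : chg e = n) : monomial e c ∈ CH K m n := by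
  intro e' he'
  rw [coeff_monomial] at he'
  split_ifs at he' with h1
  · rw [← h1]; exact h
  · exact absurd rfl he'

lemma chg_add (e e' : ZZ m →₀ ℕ) : chg (e + e') = chg e + chg e' := by
  simp [chg, Finset.sum_add_distrib]; ring
lemma chg_inl (i : Fin m) (k : ℕ) : chg (Finsupp.single (Sum.inl i : ZZ m) k) = k := by
  simp [chg, Finsupp.single_apply]
lemma chg_inr (i : Fin m) (k : ℕ) : chg (Finsupp.single (Sum.inr i : ZZ m) k) = -k := by
  simp [chg, Finsupp.single_apply]
lemma chg_swE (e : ZZ m →₀ ℕ) : chg (swE e) = - chg e := by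
  simp [chg]

lemma X_mul_CH (z : ZZ m) {n : ℤ} {f : PP K m} (hf : f ∈ CH K m n) :
    X z * f ∈ CH K m (n + chg (Finsupp.single z 1)) := by
  intro e he
  rw [coeff_X_mul'] at he
  split_ifs at he with h
  · have := hf _ he
    rw [← this, ← chg_add, tsub_add_cancel_of_le]
    simpa [Nat.one_le_iff_ne_zero] using h
  · exact absurd rfl he

lemma pderiv_CH (z : ZZ m) {n : ℤ} {f : PP K m} (hf : f ∈ CH K m n) :
    pderiv z f ∈ CH K m (n - chg (Finsupp.single z 1)) := by
  intro e he
  rw [coeff_pderiv] at he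
  have := hf _ (left_ne_zero_of_mul he)
  rw [← this, chg_add]; ring

lemma LLh_CH (z : ZZ m) {n : ℤ} {f : PP K m} (hf : f ∈ CH K m n) :
    LLh z f ∈ CH K m (n + 1) := by
  rcases z with i | i
  · have := pderiv_CH (Sum.inr i) hf
    rw [chg_inr] at this
    simpa using this
  · have := X_mul_CH (Sum.inl i) hf
    rw [chg_inl] at this
    simpa using this

lemma dh_CH (z : ZZ m) {n : ℤ} {f : PP K m} (hf : f ∈ CH K m n) :
    dh z f ∈ CH K m (n - 1) := by
  rcases z with i | i
  · have := pderiv_CH (Sum.inl i) hf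
    rw [chg_inl] at this
    simpa using this
  · have := X_mul_CH (Sum.inr i) hf
    rw [chg_inr] at this
    simpa [sub_eq_add_neg] using this

lemma Qh_CH (u : VV K m) {n : ℤ} {f : PP K m} (hf : f ∈ CH K m n) : Qh u f ∈ CH K m n := by
  have h1 : du u f ∈ CH K m (n - 1) := by
    rw [du_apply]
    exact Submodule.sum_mem _ fun z _ => Submodule.smul_mem _ _ (dh_CH z hf)
  have h2 : LLu u (du u f) ∈ CH K m (n - 1 + 1) := by
    rw [LLu_apply]
    exact Submodule.sum_mem _ fun z _ => Submodule.smul_mem _ _ (LLh_CH z h1)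
  rwa [sub_add_cancel] at h2

lemma sw_CH {n : ℤ} {f : PP K m} (hf : f ∈ CH K m n) : sw K m f ∈ CH K m (-n) := by
  intro e he
  have : coeff e (sw K m f) = coeff (swE e) f := by
    have := coeff_rename_mapDomain Sum.swap
      (Function.LeftInverse.injective (Sum.swap_leftInverse (α := Fin m) (β := Fin m))) f (swE e)
    rw [← this]
    congr 1
    exact (swE_swE e).symm
  rw [this] at he
  have := hf _ he
  rw [chg_swE] at this
  omega

/-- reduced exponents -/
def red (p : ℕ) (e : ZZ m →₀ ℕ) : Prop := ∀ z, e z ≤ p - 1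

variable {p : ℕ} [hp : Fact p.Prime] [CharP K p]

lemma fact_eq_zero (n : ℕ) : (n.factorial : K) = 0 ↔ p ≤ n := by
  rw [CharP.cast_eq_zero_iff K p, hp.out.dvd_factorial]

lemma fac_ne_zero {e : ZZ m →₀ ℕ} (h : ∀ i, e (Sum.inr i) ≤ p - 1) : fac K e ≠ 0 := by
  rw [fac, Finset.prod_ne_zero_iff]
  intro i _ h0
  rw [fact_eq_zero (p := p)] at h0
  have := h i
  have := hp.out.pos
  omega

lemma fac_eq_zero {e : ZZ m →₀ ℕ} (i : Fin m) (h : p ≤ e (Sum.inr i)) : fac K e = 0 := by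
  rw [fac, Finset.prod_eq_zero (Finset.mem_univ i)]
  rwa [fact_eq_zero (p := p)]

lemma FF_LLh (z : ZZ m) (f : PP K m) : LL z * FF K m p f - FF K m p (LLh z f) ∈ II K m p := by
  induction f using MvPolynomial.induction_on' with
  | add f g hf hg =>
    have := Ideal.add_mem _ hf hg
    convert this using 1
    simp only [map_add]; ring
  | monomial e c =>
    rcases z with l | l
    · simp only [LL, Sum.elim_inl, LLh_inl, pderiv_monomial, map_neg, FF_monomial]
      rw [neg_mul, X_mul_mon]
      by_cases h : e (Sum.inr l) = 0
      · simp only [h, Nat.cast_zero, mul_zero, zero_mul, monomial_zero, neg_zero, sub_zero]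
        rw [neg_mem_iff, mem_II]
        intro e' he'
        have h2 := support_monomial_subset he'
        rw [Finset.mem_singleton] at h2
        refine ⟨Sum.inr l, ?_⟩
        have := hp.out.pos
        simp [h2, h]; omega
      · rw [mul_assoc, fac_sub _ _ (Nat.one_le_iff_ne_zero.mpr h)]
        by_cases h3 : p ≤ e (Sum.inr l)
        · rw [fac_eq_zero (p := p) l h3]; simp
        · have : bar p (e - Finsupp.single (Sum.inr l) 1) = bar p e + Finsupp.single (Sum.inr l) 1 := by
            ext w
            rcases w with w | w
            · simp
            · by_cases hw : l = w
              · subst hw; simp; omega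
              · simp [Finsupp.single_apply, hw]
          rw [this]; simp
    · simp only [LL, Sum.elim_inr, LLh_inr]
      rw [X_mul_mon, FF_monomial, FF_monomial, X_mul_mon, fac_add_inl]
      have : bar p (e + Finsupp.single (Sum.inl l) 1) = bar p e + Finsupp.single (Sum.inl l) 1 := by
        ext w
        rcases w with w | w <;> simp
      rw [this]; simp

lemma FF_dh (z : ZZ m) (f : PP K m) : pderiv z (FF K m p f) = FF K m p (dh z f) := by
  induction f using MvPolynomial.induction_on' with
  | add f g hf hg => simp only [map_add, hf, hg]
  | monomial e c =>
    rcases z with l | l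
    · simp only [dh_inl, pderiv_monomial, FF_monomial, fac_sub_inl]
      have : bar p (e - Finsupp.single (Sum.inl l) 1) = bar p e - Finsupp.single (Sum.inl l) 1 := by
        ext w
        rcases w with w | w <;> simp
      rw [this]
      congr 1
      simp; ring
    · simp only [dh_inr, map_neg]
      rw [X_mul_mon, FF_monomial, FF_monomial, pderiv_monomial, fac_add, ← map_neg]
      have : bar p (e + Finsupp.single (Sum.inr l) 1) = bar p e - Finsupp.single (Sum.inr l) 1 := by
        ext w
        rcases w with w | w
        · simp
        · by_cases hw : l = w
          · subst hw; simp; omega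
          · simp [Finsupp.single_apply, hw]
      rw [this]
      congr 1
      by_cases h3 : p ≤ e (Sum.inr l)
      · rw [fac_eq_zero (p := p) l h3]; simp
      · have h4 : ((bar p e (Sum.inr l) : ℕ) : K) = - (e (Sum.inr l) + 1) := by
          rw [bar_inr, Nat.cast_sub (by omega), Nat.cast_sub hp.out.one_lt.le, CharP.cast_eq_zero]
          simp; ring
        rw [h4]; ring

lemma FF_Qh (u : VV K m) (f : PP K m) : Qd u (FF K m p f) - FF K m p (Qh u f) ∈ II K m p := by
  have h1 : Qd u (FF K m p f) = ell u * FF K m p (du u f) := by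
    rw [Qd_eq, du_apply, map_sum]
    congr 1
    refine Finset.sum_congr rfl fun z _ => ?_
    rw [map_smul, FF_dh, smul_eq_C_mul]
  rw [h1, Qh, LinearMap.comp_apply, LLu_apply, map_sum, ell, Finset.sum_mul, ← Finset.sum_sub_distrib]
  refine Ideal.sum_mem _ fun z _ => ?_
  rw [map_smul, smul_eq_C_mul, mul_assoc, ← mul_sub]
  exact Ideal.mul_mem_left _ _ (FF_LLh z _)

lemma SS_Qh (c : K) (u : VV K m) (f : PP K m) :
    Qd u (SS m p c f) - SS m p c (Qh u f) ∈ II K m p := by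
  rw [SS_apply, SS_apply, map_add, Derivation.map_smul, sw_Qh]
  have h1 := FF_Qh (p := p) u f
  have h2 := Ideal.mul_mem_left _ (C c) (FF_Qh (p := p) u (sw K m f))
  have := Ideal.add_mem _ h1 h2
  convert this using 1
  simp only [smul_eq_C_mul]; ring

lemma FF_hom {n : ℕ} {c : ℤ} (hc : c = n - m * ((p : ℤ) - 1)) {f : PP K m} (hf : f ∈ CH K m c) :
    (FF K m p f).IsHomogeneous n := by
  rw [← support_sum_monomial_coeff f, map_sum]
  refine IsHomogeneous.sum _ _ _ fun e he => ?_
  rw [FF_monomial]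
  by_cases h : ∀ i, e (Sum.inr i) ≤ p - 1
  · apply isHomogeneous_monomial
    rw [Finsupp.degree_eq_sum, Fintype.sum_sum_type]
    have h1 := hf e (mem_support_iff.mp he)
    simp only [bar_inl, bar_inr]
    zify
    have h2 : ∀ i, ((p - 1 - e (Sum.inr i) : ℕ) : ℤ) = ((p : ℤ) - 1) - e (Sum.inr i) := by
      intro i
      have := h i
      have := hp.out.pos
      omega
    simp only [h2, Finset.sum_sub_distrib, Finset.sum_const, Finset.card_univ, Fintype.card_fin,
      smul_sub, nsmul_eq_mul]
    rw [chg] at h1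
    rw [hc] at h1
    linarith
  · push Not at h
    obtain ⟨i, hi⟩ := h
    rw [fac_eq_zero (p := p) i (by omega), mul_zero, monomial_zero]
    exact isHomogeneous_zero _ _ _

lemma SS_hom {n : ℕ} {c : ℤ} {k : K} (hc : c = n - m * ((p : ℤ) - 1)) (hk : k = 0 ∨ c = 0)
    {f : PP K m} (hf : f ∈ CH K m c) : (SS m p k f).IsHomogeneous n := by
  rw [SS_apply]
  rcases hk with rfl | rfl
  · rw [zero_smul, add_zero]; exact FF_hom hc hf
  · refine (FF_hom hc hf).add ?_
    rw [smul_eq_C_mul]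
    refine IsHomogeneous.C_mul (FF_hom hc ?_) _
    simpa using sw_CH hf

lemma FF_nonred {e : ZZ m →₀ ℕ} (h : ¬ red p e) (c : K) : FF K m p (monomial e c) ∈ II K m p := by
  rw [FF_monomial]
  simp only [red, not_forall] at h
  obtain ⟨z, hz⟩ := h
  rcases z with i | i
  · rw [mem_II]
    intro e' he'
    have h2 := support_monomial_subset he'
    rw [Finset.mem_singleton] at h2
    refine ⟨Sum.inl i, ?_⟩
    rw [h2, bar_inl]; omega
  · rw [fac_eq_zero (p := p) i (by omega), mul_zero, monomial_zero]
    exact Ideal.zero_mem _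

lemma red_swE {e : ZZ m →₀ ℕ} : red p (swE e) ↔ red p e := by
  constructor
  · intro h z; simpa using h (Sum.swap z)
  · intro h z; simpa using h (Sum.swap z)

lemma SS_nonred {e : ZZ m →₀ ℕ} (h : ¬ red p e) (k c : K) :
    SS m p k (monomial e c) ∈ II K m p := by
  rw [SS_apply, sw_monomial, smul_eq_C_mul]
  refine Ideal.add_mem _ (FF_nonred h c) (Ideal.mul_mem_left _ _ (FF_nonred ?_ c))
  rwa [red_swE]

/-- digit spaces -/
def DD (m p : ℕ) (k : K) (n : ℕ) : Submodule K (PP K m) where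
  carrier := {h | h.IsHomogeneous n ∧
    ∃ f ∈ CH K m ((n : ℤ) - m * ((p : ℤ) - 1)), h - SS m p k f ∈ II K m p}
  add_mem' := by
    rintro a b ⟨h1, f1, h2, h3⟩ ⟨h4, f2, h5, h6⟩
    refine ⟨h1.add h4, f1 + f2, Submodule.add_mem _ h2 h5, ?_⟩
    have := Ideal.add_mem _ h3 h6
    convert this using 1
    rw [map_add]; ring
  zero_mem' := ⟨isHomogeneous_zero _ _ _, 0, Submodule.zero_mem _, by simp⟩
  smul_mem' := by
    rintro c a ⟨h1, f1, h2, h3⟩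
    refine ⟨by rw [smul_eq_C_mul]; exact h1.C_mul _, c • f1, Submodule.smul_mem _ _ h2, ?_⟩
    have := Ideal.mul_mem_left _ (C c) h3
    convert this using 1
    rw [map_smul, smul_eq_C_mul, smul_eq_C_mul]; ring

lemma DD_hom {k : K} {n : ℕ} {h : PP K m} (hh : h ∈ DD m p k n) : h.IsHomogeneous n := hh.1

lemma DD_Qd (u : VV K m) {k : K} {n : ℕ} {h : PP K m} (hh : h ∈ DD m p k n) :
    Qd u h ∈ DD m p k n := by
  obtain ⟨h1, f, h2, h3⟩ := hh
  refine ⟨Qd_hom u h1, Qh u f, Qh_CH u h2, ?_⟩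
  have h4 := deriv_mem_II (Qd u) h3
  rw [map_sub] at h4
  have := Ideal.add_mem _ h4 (SS_Qh (p := p) k u f)
  rwa [sub_add_sub_cancel] at this

lemma DD_Qd_iter (u : VV K m) {k : K} {n : ℕ} {h : PP K m} (hh : h ∈ DD m p k n) (r : ℕ) :
    (Qd u)^[r] h ∈ DD m p k n := by
  induction r with
  | zero => exact hh
  | succ r ih => rw [Function.iterate_succ_apply']; exact DD_Qd u ih

lemma DD_of_II {k : K} {n : ℕ} {h : PP K m} (h1 : h.IsHomogeneous n) (h2 : h ∈ II K m p) :
    h ∈ DD m p k n :=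
  ⟨h1, 0, Submodule.zero_mem _, by simpa using h2⟩

lemma DD_tay (u : VV K m) (c : K) {k : K} {n : ℕ} {h : PP K m} (hh : h ∈ DD m p k n) :
    tay p u c h ∈ DD m p k n := by
  rw [tay]
  refine Submodule.sum_mem _ fun r _ => ?_
  rw [← smul_eq_C_mul]
  exact Submodule.smul_mem _ _ (DD_Qd_iter u hh r)

lemma DD_th (u : VV K m) (c : K) {k : K} {n : ℕ} {h : PP K m} (hh : h ∈ DD m p k n) :
    th u c h ∈ DD m p k n := by
  have h1 := DD_tay u c hh
  have h2 : th u c h - tay p u c h ∈ DD m p k n :=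
    DD_of_II ((th_hom u c hh.1).sub h1.1) (taylor u c h)
  have := Submodule.add_mem _ h2 h1
  rwa [sub_add_cancel] at this

lemma SS_DD {n : ℕ} {k : K} (hk : k = 0 ∨ (n : ℤ) - m * ((p : ℤ) - 1) = 0)
    {f : PP K m} (hf : f ∈ CH K m ((n : ℤ) - m * ((p : ℤ) - 1))) : SS m p k f ∈ DD m p k n :=
  ⟨SS_hom rfl hk hf, f, hf, by simp⟩

/-- the bar involution on reduced exponents -/
lemma bar_bar {e : ZZ m →₀ ℕ} (h : red p e) : bar p (bar p e) = e := by
  ext z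
  rcases z with i | i
  · simp
  · have := h (Sum.inr i)
    simp; omega

lemma red_bar {e : ZZ m →₀ ℕ} (h : red p e) : red p (bar p e) := by
  intro z
  rcases z with i | i
  · exact h _
  · simp

lemma chg_bar {e : ZZ m →₀ ℕ} (h : red p e) :
    chg (bar p e) = e.degree - m * ((p : ℤ) - 1) := by
  have h2 : ∀ i, ((p - 1 - e (Sum.inr i) : ℕ) : ℤ) = ((p : ℤ) - 1) - e (Sum.inr i) := by
    intro i
    have := h (Sum.inr i)
    have := hp.out.pos
    omega
  simp only [chg, bar_inl, bar_inr, h2, Finsupp.degree_eq_sum, Fintype.sum_sum_type,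
    Finset.sum_sub_distrib, Finset.sum_const, Finset.card_univ, Fintype.card_fin, nsmul_eq_mul]
  push_cast
  ring

lemma DD_zero {n : ℕ} {h : PP K m} (hh : h.IsHomogeneous n) : h ∈ DD m p (0 : K) n := by
  rw [← support_sum_monomial_coeff h]
  refine Submodule.sum_mem _ fun e he => ?_
  have hdeg : e.degree = n := by
    have := hh (mem_support_iff.mp he)
    rw [← this, Finsupp.degree_eq_weight_one]; rfl
  set c := coeff e h
  have hm : (monomial e c : PP K m).IsHomogeneous n := isHomogeneous_monomial _ hdeg
  by_cases hr : red p e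
  · refine ⟨hm, monomial (bar p e) (c / fac K (bar p e)), mon_mem_CH _ ?_, ?_⟩
    · rw [chg_bar hr, hdeg]
    · rw [SS_apply, zero_smul, add_zero, FF_monomial, bar_bar hr, div_mul_cancel₀, sub_self]
      · exact Ideal.zero_mem _
      · exact fac_ne_zero (p := p) fun i => red_bar hr _
  · refine DD_of_II hm ?_
    rw [mem_II]
    intro e' he'
    have h2 := support_monomial_subset he'
    rw [Finset.mem_singleton] at h2
    simp only [red, not_forall] at hr
    obtain ⟨z, hz⟩ := hr
    exact ⟨z, by rw [h2]; omega⟩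

/-- Spanning sets for digit spaces. -/
def DX (m p : ℕ) (k : K) (n : ℕ) : Set (PP K m) :=
  {h | (∃ e : ZZ m →₀ ℕ, red p e ∧ chg e = (n : ℤ) - m * ((p : ℤ) - 1) ∧
    h = SS m p k (monomial e 1)) ∨ (h.IsHomogeneous n ∧ h ∈ II K m p)}

lemma DD_le_span {n : ℕ} {k : K} (hk : k = 0 ∨ (n : ℤ) - m * ((p : ℤ) - 1) = 0) :
    DD m p k n ≤ Submodule.span K (DX m p k n) := by
  rintro h ⟨h1, f, hf, h3⟩
  have e1 : h = (h - SS m p k f) + SS m p k f := by ring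
  rw [e1]
  refine Submodule.add_mem _ (Submodule.subset_span (Or.inr ⟨h1.sub (SS_hom rfl hk hf), h3⟩)) ?_
  rw [← support_sum_monomial_coeff f, map_sum]
  refine Submodule.sum_mem _ fun e he => ?_
  have he' := hf e (mem_support_iff.mp he)
  have e2 : (monomial e (coeff e f) : PP K m) = coeff e f • monomial e 1 := by
    rw [smul_monomial, smul_eq_mul, mul_one]
  rw [e2, map_smul]
  refine Submodule.smul_mem _ _ (Submodule.subset_span ?_)
  by_cases hr : red p e
  · exact Or.inl ⟨e, hr, he', rfl⟩
  · exact Or.inr ⟨SS_hom rfl hk (mon_mem_CH _ he'), SS_nonred hr _ _⟩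

lemma DX_sub {n : ℕ} {k : K} (hk : k = 0 ∨ (n : ℤ) - m * ((p : ℤ) - 1) = 0)
    {h : PP K m} (hh : h ∈ DX m p k n) : h ∈ DD m p k n := by
  rcases hh with ⟨e, _, he, rfl⟩ | ⟨h1, h2⟩
  · exact SS_DD hk (mon_mem_CH _ he)
  · exact DD_of_II h1 h2

end four

end RS

namespace RS

section raise
open MvPolynomial
variable {K : Type} [Field K] {m : ℕ}

/-- monomials -/
def mo (K : Type) [Field K] {m : ℕ} (e : ZZ m →₀ ℕ) : PP K m := monomial e 1

/-- first kind of variables -/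
def xa (i : Fin m) : ZZ m →₀ ℕ := Finsupp.single (Sum.inl i) 1
/-- second kind of variables -/
def xb (i : Fin m) : ZZ m →₀ ℕ := Finsupp.single (Sum.inr i) 1

lemma xa_inl (i l : Fin m) : xa i (Sum.inl l) = if i = l then 1 else 0 := by
  simp [xa, Finsupp.single_apply]
@[simp] lemma xa_inr (i l : Fin m) : xa i (Sum.inr l) = 0 := by
  simp [xa, Finsupp.single_apply]
lemma xb_inr (i l : Fin m) : xb i (Sum.inr l) = if i = l then 1 else 0 := by
  simp [xb, Finsupp.single_apply]
@[simp] lemma xb_inl (i l : Fin m) : xb i (Sum.inl l) = 0 := by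
  simp [xb, Finsupp.single_apply]
@[simp] lemma swE_xa (i : Fin m) : swE (xa i) = xb i := by
  ext z; rcases z with z | z <;> simp [xa_inl, xb_inr]
@[simp] lemma swE_xb (i : Fin m) : swE (xb i) = xa i := by
  ext z; rcases z with z | z <;> simp [xa_inl, xb_inr]
lemma swE_add (e e' : ZZ m →₀ ℕ) : swE (e + e') = swE e + swE e' := by
  ext z; simp
@[simp] lemma chg_xa (i : Fin m) : chg (xa i) = 1 := by simp [xa, chg_inl]
@[simp] lemma chg_xb (i : Fin m) : chg (xb i) = -1 := by simp [xb, chg_inr]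

lemma X_mo_inl (i : Fin m) (e : ZZ m →₀ ℕ) : X (Sum.inl i) * mo K e = mo K (e + xa i) := X_mul_mon _ _ _
lemma X_mo_inr (i : Fin m) (e : ZZ m →₀ ℕ) : X (Sum.inr i) * mo K e = mo K (e + xb i) := X_mul_mon _ _ _

lemma pd_mo_inl (i : Fin m) (e : ZZ m →₀ ℕ) :
    pderiv (Sum.inl i) (mo K (e + xa i)) = ((e (Sum.inl i) : K) + 1) • mo K e := by
  rw [mo, pderiv_monomial, mo, smul_monomial]
  simp [xa]
lemma pd_mo_inr (i : Fin m) (e : ZZ m →₀ ℕ) :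
    pderiv (Sum.inr i) (mo K (e + xb i)) = ((e (Sum.inr i) : K) + 1) • mo K e := by
  rw [mo, pderiv_monomial, mo, smul_monomial]
  simp [xb]
lemma pd_mo_zero (z : ZZ m) (e : ZZ m →₀ ℕ) (h : e z = 0) :
    pderiv z (mo K e) = 0 := by
  rw [mo, pderiv_monomial, h]; simp

lemma LLu_ee (i : Fin m) (f : PP K m) : LLu (ee i) f = - pderiv (Sum.inr i) f := by
  simp [LLu_apply, Fintype.sum_sum_type, pt, ee, Pi.single_apply]
lemma LLu_ff (i : Fin m) (f : PP K m) : LLu (ff i) f = X (Sum.inl i) * f := by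
  simp [LLu_apply, Fintype.sum_sum_type, pt, ff, Pi.single_apply]
lemma du_ee (i : Fin m) (f : PP K m) : du (ee i) f = pderiv (Sum.inl i) f := by
  simp [du_apply, Fintype.sum_sum_type, pt, ee, Pi.single_apply]
lemma du_ff (i : Fin m) (f : PP K m) : du (ff i) f = - (X (Sum.inr i) * f) := by
  simp [du_apply, Fintype.sum_sum_type, pt, ff, Pi.single_apply]

lemma pt_add (u w : VV K m) (z : ZZ m) : pt (u + w) z = pt u z + pt w z := by
  rcases z with z | z <;> simp [pt]
lemma LLu_add (u w : VV K m) (f : PP K m) : LLu (u + w) f = LLu u f + LLu w f := by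
  simp [LLu_apply, pt_add, add_smul, Finset.sum_add_distrib]
lemma du_add (u w : VV K m) (f : PP K m) : du (u + w) f = du u f + du w f := by
  simp [du_apply, pt_add, add_smul, Finset.sum_add_distrib]

lemma Qh_pol (u w : VV K m) (f : PP K m) :
    Qh (u + w) f - Qh u f - Qh w f = LLu u (du w f) + LLu w (du u f) := by
  simp only [Qh, LinearMap.comp_apply, LLu_add, du_add, map_add]
  abel

/-- raising operators -/
def rr (i l : Fin m) (f : PP K m) : PP K m :=
  X (Sum.inl i) * (X (Sum.inr l) * f) + X (Sum.inl l) * (X (Sum.inr i) * f)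
/-- lowering operators -/
def dl (i l : Fin m) (f : PP K m) : PP K m :=
  pderiv (Sum.inr i) (pderiv (Sum.inl l) f) + pderiv (Sum.inr l) (pderiv (Sum.inl i) f)
/-- weight operators -/
def gg (i l : Fin m) (f : PP K m) : PP K m :=
  X (Sum.inl i) * pderiv (Sum.inl l) f + pderiv (Sum.inr l) (X (Sum.inr i) * f)

lemma rr_Qh (i l : Fin m) (f : PP K m) :
    rr i l f = - (Qh (ff i + ff l) f - Qh (ff i) f - Qh (ff l) f) := by
  rw [Qh_pol, LLu_ff, LLu_ff, du_ff, du_ff, rr]; ring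
lemma dl_Qh (i l : Fin m) (f : PP K m) :
    dl i l f = - (Qh (ee i + ee l) f - Qh (ee i) f - Qh (ee l) f) := by
  rw [Qh_pol, LLu_ee, LLu_ee, du_ee, du_ee, dl]; ring
lemma gg_Qh (i l : Fin m) (f : PP K m) :
    gg i l f = (Qh (ee l + ff i) f - Qh (ee l) f - Qh (ff i) f) := by
  rw [Qh_pol, LLu_ff, LLu_ee, du_ff, du_ee, gg, map_neg]; ring

lemma rr_mem {M : Submodule K (PP K m)} (hQ : ∀ u, ∀ f ∈ M, Qh u f ∈ M)
    (i l : Fin m) {f : PP K m} (hf : f ∈ M) : rr i l f ∈ M := by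
  rw [rr_Qh]
  exact M.neg_mem (M.sub_mem (M.sub_mem (hQ _ _ hf) (hQ _ _ hf)) (hQ _ _ hf))
lemma dl_mem {M : Submodule K (PP K m)} (hQ : ∀ u, ∀ f ∈ M, Qh u f ∈ M)
    (i l : Fin m) {f : PP K m} (hf : f ∈ M) : dl i l f ∈ M := by
  rw [dl_Qh]
  exact M.neg_mem (M.sub_mem (M.sub_mem (hQ _ _ hf) (hQ _ _ hf)) (hQ _ _ hf))
lemma gg_mem {M : Submodule K (PP K m)} (hQ : ∀ u, ∀ f ∈ M, Qh u f ∈ M)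
    (i l : Fin m) {f : PP K m} (hf : f ∈ M) : gg i l f ∈ M := by
  rw [gg_Qh]
  exact (M.sub_mem (M.sub_mem (hQ _ _ hf) (hQ _ _ hf)) (hQ _ _ hf))

lemma R_mem {M : Submodule K (PP K m)} (hQ : ∀ u, ∀ f ∈ M, Qh u f ∈ M)
    (i l : Fin m) {e : ZZ m →₀ ℕ} (he : mo K e ∈ M) :
    mo K (e + xa i + xb l) + mo K (e + xa l + xb i) ∈ M := by
  have := rr_mem hQ i l he
  rw [rr, X_mo_inr, X_mo_inr, X_mo_inl, X_mo_inl] at this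
  convert this using 3 <;> abel

lemma Gx_mem {M : Submodule K (PP K m)} (hQ : ∀ u, ∀ f ∈ M, Qh u f ∈ M)
    {i l : Fin m} (hil : i ≠ l) {e : ZZ m →₀ ℕ} (he : mo K (e + xa l) ∈ M)
    (h0 : e (Sum.inr l) = 0) (h1 : (e (Sum.inl l) : K) + 1 ≠ 0) : mo K (e + xa i) ∈ M := by
  have := gg_mem hQ i l he
  rw [gg, pd_mo_inl, X_mo_inr, mul_smul_comm, X_mo_inl, pd_mo_zero, add_zero] at this
  · exact (Submodule.smul_mem_iff _ h1).mp this
  · simp [h0, xb_inr, hil]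

lemma Gy_mem {M : Submodule K (PP K m)} (hQ : ∀ u, ∀ f ∈ M, Qh u f ∈ M)
    {i l : Fin m} (hil : i ≠ l) {e : ZZ m →₀ ℕ} (he : mo K (e + xb l) ∈ M)
    (h0 : e (Sum.inl l) = 0) (h1 : (e (Sum.inr l) : K) + 1 ≠ 0) : mo K (e + xb i) ∈ M := by
  have := gg_mem hQ i l he
  rw [gg, pd_mo_zero, mul_zero, zero_add, X_mo_inr, add_right_comm, pd_mo_inr] at this
  · refine (Submodule.smul_mem_iff _ ?_).mp this
    simpa [xb_inr, hil] using h1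
  · simp [h0]

lemma D_mem {M : Submodule K (PP K m)} (hQ : ∀ u, ∀ f ∈ M, Qh u f ∈ M)
    (h2 : (2 : K) ≠ 0) {i : Fin m} {e : ZZ m →₀ ℕ} (he : mo K (e + xa i + xb i) ∈ M)
    (h0 : e (Sum.inl i) = 0) (h1 : e (Sum.inr i) = 0) : mo K e ∈ M := by
  have := dl_mem hQ i i he
  rw [dl, add_right_comm, pd_mo_inl, Derivation.map_smul, pd_mo_inr] at this
  simp only [Finsupp.coe_add, Pi.add_apply, h0, h1, xb_inl, add_zero, Nat.cast_zero, zero_add,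
    one_smul] at this
  rw [← two_smul K] at this
  exact (Submodule.smul_mem_iff _ h2).mp this

/-- main raising induction -/
lemma raise_main {M : Submodule K (PP K m)} (hQ : ∀ u, ∀ f ∈ M, Qh u f ∈ M)
    (h2 : (2 : K) ≠ 0) (c : ℤ)
    (hP : ∀ e : ZZ m →₀ ℕ, chg e = c → ((∀ i, e (Sum.inl i) = 0) ∨ ∀ i, e (Sum.inr i) = 0) → mo K e ∈ M)
    (hX : c = 0 → ∀ i l : Fin m, i ≠ l → mo K (xa i + xb l) ∈ M) :
    ∀ n, ∀ e : ZZ m →₀ ℕ, e.degree = n → chg e = c → mo K e ∈ M := by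
  intro n
  induction n using Nat.strong_induction_on with
  | _ n ih =>
  have dxa : ∀ i : Fin m, (xa i).degree = 1 := fun i => by simp [xa]
  have dxb : ∀ i : Fin m, (xb i).degree = 1 := fun i => by simp [xb]
  have ih' : ∀ e : ZZ m →₀ ℕ, e.degree < n → chg e = c → mo K e ∈ M := fun e h h' => ih _ h e rfl h'
  have splita : ∀ (e : ZZ m →₀ ℕ) i, 1 ≤ e (Sum.inl i) → ∃ e', e = e' + xa i := fun e i h =>
    ⟨e - xa i, (tsub_add_cancel_of_le (by simpa [xa] using h)).symm⟩
  have splitb : ∀ (e : ZZ m →₀ ℕ) i, 1 ≤ e (Sum.inr i) → ∃ e', e = e' + xb i := fun e i h =>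
    ⟨e - xb i, (tsub_add_cancel_of_le (by simpa [xb] using h)).symm⟩
  have A : ∀ e : ZZ m →₀ ℕ, e.degree = n → chg e = c → ∀ i, 1 ≤ e (Sum.inl i) → 1 ≤ e (Sum.inr i) →
      mo K e ∈ M := by
    intro e hd hc i ha hb
    obtain ⟨e1, rfl⟩ := splita e i ha
    obtain ⟨e2, rfl⟩ := splitb e1 i (by simpa using hb)
    simp only [map_add, dxa, dxb, chg_add, chg_xa, chg_xb] at hd hc
    have := R_mem hQ i i (ih' e2 (by omega) (by omega))
    rw [← two_smul K, Submodule.smul_mem_iff _ h2] at this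
    rwa [add_right_comm]
  intro e hd hc
  by_cases hp1 : ∀ i, e (Sum.inl i) = 0
  · exact hP e hc (Or.inl hp1)
  by_cases hp2 : ∀ i, e (Sum.inr i) = 0
  · exact hP e hc (Or.inr hp2)
  push Not at hp1 hp2
  obtain ⟨i, hi⟩ := hp1
  obtain ⟨l, hl⟩ := hp2
  by_cases hdis : ∃ i, 1 ≤ e (Sum.inl i) ∧ 1 ≤ e (Sum.inr i)
  · obtain ⟨i, h1, h2⟩ := hdis
    exact A e hd hc i h1 h2
  push Not at hdis
  have hil : i ≠ l := by
    rintro rfl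
    have := hdis i (by omega)
    omega
  obtain ⟨e1, rfl⟩ := splita e i (by omega)
  have hl' : 1 ≤ e1 (Sum.inr l) := by simp at hl; omega
  obtain ⟨e2, rfl⟩ := splitb e1 l hl'
  simp only [map_add, dxa, dxb, chg_add, chg_xa, chg_xb] at hd hc
  have key := R_mem hQ i l (ih' e2 (by omega) (by omega))
  have hdeg' : (e2 + xa l + xb i).degree = n := by
    simp only [map_add, dxa, dxb]; omega
  have hchg' : chg (e2 + xa l + xb i) = c := by
    simp only [chg_add, chg_xa, chg_xb]; omega
  rw [add_right_comm]
  have fin : mo K (e2 + xa l + xb i) ∈ M → mo K (e2 + xa i + xb l) ∈ M := by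
    intro h
    have := M.sub_mem key h
    rwa [add_sub_cancel_right] at this
  by_cases hi2 : 1 ≤ e2 (Sum.inl i)
  · exact fin (A _ hdeg' hchg' i (by simp; omega) (by simp [xb_inr]))
  by_cases hl2 : 1 ≤ e2 (Sum.inr l)
  · exact fin (A _ hdeg' hchg' l (by simp [xa_inl]) (by simp; omega))
  by_cases h0 : e2 = 0
  · subst h0
    rw [zero_add]
    refine hX ?_ i l hil
    rw [← hc]; simp [chg]
  obtain ⟨z, hz⟩ := Finsupp.ne_iff.mp h0
  simp only [Finsupp.coe_zero, Pi.zero_apply] at hz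
  rcases z with k | k
  · obtain ⟨e3, rfl⟩ := splita e2 k (by omega)
    have hki : k ≠ i := by rintro rfl; omega
    simp only [map_add, dxa, dxb, chg_add, chg_xa, chg_xb] at hd hc
    have k2 := R_mem hQ i k (ih' (e3 + xa l) (by simp only [map_add, dxa]; omega)
      (by simp only [chg_add, chg_xa]; omega))
    have k3 := R_mem hQ k l (ih' (e3 + xa i) (by simp only [map_add, dxa]; omega)
      (by simp only [chg_add, chg_xa]; omega))
    have := M.add_mem (M.sub_mem key k2) k3
    rw [← Submodule.smul_mem_iff _ h2]
    convert this using 1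
    have e1 : e3 + xa l + xa k + xb i = e3 + xa k + xa l + xb i := by abel
    have e2 : e3 + xa i + xa l + xb k = e3 + xa l + xa i + xb k := by abel
    have e4 : e3 + xa k + xa i + xb l = e3 + xa i + xa k + xb l := by abel
    rw [e1, e2, e4, two_smul]
    abel
  · obtain ⟨e3, rfl⟩ := splitb e2 k (by omega)
    have hki : k ≠ l := by rintro rfl; omega
    simp only [map_add, dxa, dxb, chg_add, chg_xa, chg_xb] at hd hc
    have k2 := R_mem hQ l k (ih' (e3 + xb i) (by simp only [map_add, dxb]; omega)
      (by simp only [chg_add, chg_xb]; omega))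
    have k3 := R_mem hQ i k (ih' (e3 + xb l) (by simp only [map_add, dxb]; omega)
      (by simp only [chg_add, chg_xb]; omega))
    have := M.add_mem (M.sub_mem key k2) k3
    rw [← Submodule.smul_mem_iff _ h2]
    convert this using 1
    have e1 : e3 + xb i + xa l + xb k = e3 + xb k + xa l + xb i := by abel
    have e2 : e3 + xb i + xa k + xb l = e3 + xb l + xa k + xb i := by abel
    have e4 : e3 + xb l + xa i + xb k = e3 + xb k + xa i + xb l := by abel
    rw [e1, e2, e4, two_smul]
    abel

variable {p : ℕ} [hp : Fact p.Prime] [CharP K p]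

lemma cast_succ_ne {n : ℕ} (h : n + 1 ≤ p - 1) : (n : K) + 1 ≠ 0 := by
  have : ((n + 1 : ℕ) : K) ≠ 0 := by
    rw [Ne, CharP.cast_eq_zero_iff K p]
    intro h1
    have := Nat.le_of_dvd (by omega) h1
    have := hp.out.pos
    omega
  push_cast at this
  exact this

/-- moving exponents around, first kind -/
lemma pure_x {M : Submodule K (PP K m)} (hQ : ∀ u, ∀ f ∈ M, Qh u f ∈ M) (c : ℤ)
    (hN : ∀ e : ZZ m →₀ ℕ, ¬ red p e → chg e = c → mo K e ∈ M) {e' : ZZ m →₀ ℕ}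
    (hc' : chg e' = c) (hy' : ∀ i, e' (Sum.inr i) = 0) :
    ∀ n, ∀ e : ZZ m →₀ ℕ, red p e → (∀ i, e (Sum.inr i) = 0) → chg e = c →
      (∑ i, (e (Sum.inl i) - e' (Sum.inl i))) = n → mo K e ∈ M → mo K e' ∈ M := by
  by_cases hr' : red p e'
  swap
  · intros; exact hN e' hr' hc'
  intro n
  induction n with
  | zero =>
    intro e hr hy hc hn he
    have hle : ∀ i, e (Sum.inl i) ≤ e' (Sum.inl i) := by
      intro i
      have := (Finset.sum_eq_zero_iff.mp hn) i (Finset.mem_univ i)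
      omega
    have : e = e' := by
      simp only [chg, hy, hy'] at hc hc'
      have hs : ∑ i, (e (Sum.inl i) : ℤ) = ∑ i, (e' (Sum.inl i) : ℤ) := by
        simp at hc hc'; omega
      have h3 := (Finset.sum_eq_sum_iff_of_le (fun i _ => by exact_mod_cast hle i)).mp hs
      ext z
      rcases z with z | z
      · exact_mod_cast h3 z (Finset.mem_univ z)
      · rw [hy, hy']
    rwa [← this]
  | succ n ih =>
    intro e hr hy hc hn he
    have h1 : ∃ l, e' (Sum.inl l) < e (Sum.inl l) := by
      by_contra h
      push Not at h
      have : (∑ i, (e (Sum.inl i) - e' (Sum.inl i))) = 0 :=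
        Finset.sum_eq_zero fun i _ => by have := h i; omega
      omega
    obtain ⟨l, hl⟩ := h1
    have h2 : ∃ i, e (Sum.inl i) < e' (Sum.inl i) := by
      by_contra h
      push Not at h
      have : ∑ i, (e' (Sum.inl i) : ℤ) < ∑ i, (e (Sum.inl i) : ℤ) :=
        Finset.sum_lt_sum (fun i _ => by exact_mod_cast h i) ⟨l, Finset.mem_univ _, by exact_mod_cast hl⟩
      simp only [chg, hy, hy'] at hc hc'
      simp at hc hc'
      omega
    obtain ⟨i, hi⟩ := h2
    have hil : i ≠ l := by rintro rfl; omega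
    obtain ⟨e1, rfl⟩ : ∃ e1, e = e1 + xa l :=
      ⟨e - xa l, (tsub_add_cancel_of_le (by simp [xa]; omega)).symm⟩
    have hl1 := hr (Sum.inl l)
    simp only [Finsupp.coe_add, Pi.add_apply, xa_inl, if_pos, xa_inr, add_zero] at hl hy hl1
    have hi1 : e1 (Sum.inl i) < e' (Sum.inl i) := by
      simpa [xa_inl, hil.symm] using hi
    refine ih (e1 + xa i) ?_ (by simpa using hy) ?_ ?_ (Gx_mem hQ hil he (hy l) (cast_succ_ne (p := p) hl1))
    · intro z
      rcases z with z | z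
      · by_cases hz : i = z
        · subst hz
          have := hr' (Sum.inl i)
          simp [xa_inl]; omega
        · have := hr (Sum.inl z)
          simp [xa_inl, hz] at this ⊢
          omega
      · simp [hy]
    · simpa [chg_add] using hc
    · have key : ∀ j, ((e1 + xa l) (Sum.inl j) - e' (Sum.inl j)) =
          ((e1 + xa i) (Sum.inl j) - e' (Sum.inl j)) + if j = l then 1 else 0 := by
        intro j
        by_cases hj : l = j
        · subst hj; simp [xa_inl, hil]; omega
        · by_cases hj2 : i = j
          · subst hj2; simp [xa_inl, hil, hj]; omega
          · simp [xa_inl, hj2, hj, Ne.symm hj]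
      rw [Finset.sum_congr rfl fun j _ => key j, Finset.sum_add_distrib] at hn
      simp at hn
      exact hn

/-- moving exponents around, second kind -/
lemma pure_y {M : Submodule K (PP K m)} (hQ : ∀ u, ∀ f ∈ M, Qh u f ∈ M) (c : ℤ)
    (hN : ∀ e : ZZ m →₀ ℕ, ¬ red p e → chg e = c → mo K e ∈ M) {e' : ZZ m →₀ ℕ}
    (hc' : chg e' = c) (hy' : ∀ i, e' (Sum.inl i) = 0) {e : ZZ m →₀ ℕ} (hr : red p e)
    (hy : ∀ i, e (Sum.inl i) = 0) (hc : chg e = c) (he : mo K e ∈ M) : mo K e' ∈ M := by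
  set M' : Submodule K (PP K m) := M.comap (sw K m).toLinearMap with hM'
  have mm : ∀ e : ZZ m →₀ ℕ, mo K e ∈ M' ↔ mo K (swE e) ∈ M := by
    intro e
    rw [hM', Submodule.mem_comap]
    show sw K m (monomial e 1) ∈ M ↔ _
    rw [sw_monomial]; rfl
  have hQ' : ∀ u, ∀ f ∈ M', Qh u f ∈ M' := by
    intro u f hf
    show sw K m (Qh u f) ∈ M
    rw [sw_Qh]
    exact hQ u _ hf
  have := pure_x (p := p) hQ' (-c) (fun e h1 h2 => (mm e).mpr (hN _ (by rwa [red_swE])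
    (by rw [chg_swE]; omega))) (e' := swE e') (by rw [chg_swE]; omega) (by simpa using hy') _
    (swE e) (by rwa [red_swE]) (by simpa using hy) (by rw [chg_swE]; omega) rfl ((mm _).mpr (by simpa using he))
  rw [mm] at this
  simpa using this

/-- generating exponents -/
def Gn (p : ℕ) (k : K) (c : ℤ) (e : ZZ m →₀ ℕ) : Prop :=
  red p e ∧ chg e = c ∧
  ((c ≠ 0 ∧ ((∀ i, e (Sum.inl i) = 0) ∨ ∀ i, e (Sum.inr i) = 0)) ∨
   (k = 1 ∧ e = 0) ∨
   (k = -1 ∧ ∃ i l, i ≠ l ∧ e = xa i + xb l) ∨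
   (k = 0 ∧ ∃ e' : ZZ m →₀ ℕ, ∃ i l, i ≠ l ∧ (∀ j, e' (Sum.inr j) = 0) ∧ e' (Sum.inl l) = 0 ∧
      e = e' + xa i + xb l))

lemma mo_all_pairs {M : Submodule K (PP K m)} (hQ : ∀ u, ∀ f ∈ M, Qh u f ∈ M)
    (h1 : mo K (0 : ZZ m →₀ ℕ) ∈ M) {i l : Fin m} (hil : i ≠ l) (h : mo K (xa i + xb l) ∈ M)
    {i' l' : Fin m} (hil' : i' ≠ l') : mo K (xa i' + xb l') ∈ M := by
  have mx : ∀ a b c : Fin m, a ≠ b → a ≠ c → mo K (xa a + xb b) ∈ M → mo K (xa c + xb b) ∈ M := by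
    intro a b c hab hac hm
    rw [add_comm] at hm ⊢
    exact Gx_mem hQ hac.symm hm (by simp [xb_inr, hab.symm]) (by simp)
  have my : ∀ a b c : Fin m, a ≠ b → b ≠ c → mo K (xa a + xb b) ∈ M → mo K (xa a + xb c) ∈ M := by
    intro a b c hab hac hm
    exact Gy_mem hQ hac.symm hm (by simp [xa_inl, hab]) (by simp)
  have sws : ∀ a b : Fin m, mo K (xa a + xb b) ∈ M → mo K (xa b + xb a) ∈ M := by
    intro a b hm
    have := R_mem hQ a b h1
    rw [zero_add, zero_add] at this
    have := M.sub_mem this hm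
    rwa [add_sub_cancel_left] at this
  have mx' : ∀ a b c : Fin m, a ≠ b → mo K (xa a + xb b) ∈ M → mo K (xa c + xb b) ∈ M := by
    intro a b c hab hm
    by_cases h : a = c
    · subst h; exact hm
    · exact mx a b c hab h hm
  have my' : ∀ a b c : Fin m, a ≠ b → mo K (xa a + xb b) ∈ M → mo K (xa a + xb c) ∈ M := by
    intro a b c hab hm
    by_cases h : b = c
    · subst h; exact hm
    · exact my a b c hab h hm
  by_cases h3 : i' = l
  · subst h3
    by_cases h4 : l' = i
    · subst h4; exact sws _ _ h
    · exact mx' i l' i' (Ne.symm h4) (my' i i' l' hil h)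
  · exact my' i' l l' h3 (mx' i l i' hil h)

theorem raise {M : Submodule K (PP K m)} (hQ : ∀ u, ∀ f ∈ M, Qh u f ∈ M) (h2 : (2 : K) ≠ 0)
    (c : ℤ) (k : K)
    (hN : ∀ e : ZZ m →₀ ℕ, ¬ red p e → chg e = c → mo K e ∈ M)
    (hk : k = 0 ∨ c = 0)
    (hS : k ≠ 0 → ∀ e : ZZ m →₀ ℕ, chg e = 0 → mo K e - k • mo K (swE e) ∈ M)
    {e0 : ZZ m →₀ ℕ} (hG : Gn p k c e0) (h0 : mo K e0 ∈ M) :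
    ∀ e : ZZ m →₀ ℕ, chg e = c → mo K e ∈ M := by
  obtain ⟨hr, hc, hG⟩ := hG
  have chg_x : ∀ e : ZZ m →₀ ℕ, (∀ i, e (Sum.inr i) = 0) → 0 ≤ chg e := by
    intro e he
    simp only [chg, he]
    simp
    exact Finset.sum_nonneg fun i _ => by positivity
  have chg_y : ∀ e : ZZ m →₀ ℕ, (∀ i, e (Sum.inl i) = 0) → chg e ≤ 0 := by
    intro e he
    simp only [chg, he]
    simp
    exact Finset.sum_nonneg fun i _ => by positivity
  have zero_of : ∀ e : ZZ m →₀ ℕ, chg e = 0 → ((∀ i, e (Sum.inl i) = 0) ∨ ∀ i, e (Sum.inr i) = 0) → e = 0 := by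
    intro e he h
    rcases h with h | h
    · have h3 : ∑ i, (e (Sum.inr i) : ℤ) = 0 := by
        simp only [chg, h] at he; simpa using he
      rw [Finset.sum_eq_zero_iff_of_nonneg (fun i _ => by positivity)] at h3
      ext z
      rcases z with z | z
      · exact h z
      · exact_mod_cast h3 z (Finset.mem_univ _)
    · have h3 : ∑ i, (e (Sum.inl i) : ℤ) = 0 := by
        simp only [chg, h] at he; simpa using he
      rw [Finset.sum_eq_zero_iff_of_nonneg (fun i _ => by positivity)] at h3
      ext z
      rcases z with z | z
      · exact_mod_cast h3 z (Finset.mem_univ _)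
      · exact h z
  -- the case of nonzero charge from a pure monomial
  have pureCase : c ≠ 0 → ∀ e1 : ZZ m →₀ ℕ, red p e1 → chg e1 = c →
      ((∀ i, e1 (Sum.inl i) = 0) ∨ ∀ i, e1 (Sum.inr i) = 0) → mo K e1 ∈ M →
      ∀ e : ZZ m →₀ ℕ, chg e = c → mo K e ∈ M := by
    intro hc0 e1 hr1 hc1 hp1 h1 e he
    refine raise_main hQ h2 c ?_ (fun h => absurd h hc0) _ e rfl he
    intro e' he' hp'
    rcases hp1 with hp1 | hp1 <;> rcases hp' with hp' | hp'
    · exact pure_y hQ c hN he' hp' hr1 hp1 hc1 h1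
    · have := chg_x e' hp'; have := chg_y e1 hp1; omega
    · have := chg_y e' hp'; have := chg_x e1 hp1; omega
    · exact pure_x hQ c hN he' hp' _ e1 hr1 hp1 hc1 rfl h1
  have zeroCase : c = 0 → mo K (0 : ZZ m →₀ ℕ) ∈ M → (∀ i l : Fin m, i ≠ l → mo K (xa i + xb l) ∈ M) →
      ∀ e : ZZ m →₀ ℕ, chg e = c → mo K e ∈ M := by
    intro hc0 h1 h3 e he
    refine raise_main hQ h2 c ?_ (fun _ => h3) _ e rfl he
    intro e' he' hp'
    rw [zero_of e' (by omega) hp']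
    exact h1
  rcases hG with ⟨hc0, hp1⟩ | ⟨rfl, rfl⟩ | ⟨rfl, i, l, hil, rfl⟩ | ⟨rfl, e', i, l, hil, hy, hl, rfl⟩
  · exact pureCase hc0 e0 hr hc hp1 h0
  · have hc0 : c = 0 := by rw [← hc]; simp [chg]
    refine zeroCase hc0 h0 ?_
    intro i l hil
    have a1 := R_mem hQ i l h0
    have a2 := hS one_ne_zero (xa i + xb l) (by simp [chg_add])
    rw [swE_add, swE_xa, swE_xb, one_smul] at a2
    have := M.add_mem a1 a2
    rw [← Submodule.smul_mem_iff _ h2]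
    convert this using 1
    rw [two_smul, zero_add, zero_add, add_comm (xb i) (xa l)]
    abel
  · have hc0 : c = 0 := by rw [← hc]; simp [chg_add]
    have h1 : mo K (0 : ZZ m →₀ ℕ) ∈ M := by
      have a2 := hS (by simp) (0 : ZZ m →₀ ℕ) (by simp [chg])
      have : swE (0 : ZZ m →₀ ℕ) = 0 := by ext z; simp
      rw [this] at a2
      rw [← Submodule.smul_mem_iff _ h2]
      convert a2 using 1
      rw [two_smul]; simp
    exact zeroCase hc0 h1 (fun i' l' h' => mo_all_pairs hQ h1 hil h0 h')
  · have hi := hr (Sum.inl i)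
    have s1 : mo K (e' + xa l + xb l) ∈ M := by
      rw [add_right_comm]
      refine Gx_mem hQ hil.symm (by rwa [add_right_comm] at h0) ?_ (cast_succ_ne (p := p) ?_)
      · simp [hy, xb_inr, hil.symm]
      · simpa [xa_inl] using hi
    have s2 : mo K e' ∈ M := D_mem hQ h2 s1 hl (hy l)
    have hc' : chg e' = c := by rw [← hc]; simp [chg_add]
    by_cases hc0 : c = 0
    · have : e' = 0 := zero_of e' (by omega) (Or.inr hy)
      subst this
      rw [zero_add] at h0
      exact zeroCase hc0 s2 (fun i' l' h' => mo_all_pairs hQ s2 hil h0 h')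
    · refine pureCase hc0 e' ?_ hc' (Or.inr hy) s2
      intro z
      exact le_trans (by simp [add_assoc]) (hr z)

end raise

end RS

namespace RS

section lower
open MvPolynomial
variable {K : Type} [Field K] {m t : ℕ}

/-- polynomials in all digits -/
abbrev TP (K : Type) [Field K] (m t : ℕ) : Type := MvPolynomial (Fin t × ZZ m) K
/-- exponents for all digits -/
abbrev TE (m t : ℕ) : Type := (Fin t × ZZ m) →₀ ℕ

/-- the digit exponents -/
def dg (E : TE m t) (j : Fin t) : ZZ m →₀ ℕ :=
  Finsupp.equivFunOnFinite.symm fun z => E (j, z)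

@[simp] lemma dg_apply (E : TE m t) (j : Fin t) (z : ZZ m) : dg E j z = E (j, z) := rfl

lemma dg_ext {E F : TE m t} (h : ∀ j, dg E j = dg F j) : E = F := by
  ext ⟨j, z⟩
  have := DFunLike.congr_fun (h j) z
  simpa using this

/-- variables -/
def ta (j : Fin t) (i : Fin m) : TE m t := Finsupp.single (j, Sum.inl i) 1
/-- variables -/
def tb (j : Fin t) (i : Fin m) : TE m t := Finsupp.single (j, Sum.inr i) 1

lemma ta_inl (j j' : Fin t) (i i' : Fin m) :
    ta j i (j', Sum.inl i') = if j = j' ∧ i = i' then 1 else 0 := by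
  simp [ta, Finsupp.single_apply]
@[simp] lemma ta_inr (j j' : Fin t) (i i' : Fin m) : ta j i (j', Sum.inr i') = 0 := by
  simp [ta, Finsupp.single_apply]
lemma tb_inr (j j' : Fin t) (i i' : Fin m) :
    tb j i (j', Sum.inr i') = if j = j' ∧ i = i' then 1 else 0 := by
  simp [tb, Finsupp.single_apply]
@[simp] lemma tb_inl (j j' : Fin t) (i i' : Fin m) : tb j i (j', Sum.inl i') = 0 := by
  simp [tb, Finsupp.single_apply]

lemma dg_add (E F : TE m t) (j : Fin t) : dg (E + F) j = dg E j + dg F j := by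
  ext z; simp
lemma dg_ta (j j' : Fin t) (i : Fin m) : dg (ta j i) j' = if j = j' then xa i else 0 := by
  ext z; rcases z with z | z <;> by_cases h : j = j' <;> simp [ta_inl, xa_inl, h]
lemma dg_tb (j j' : Fin t) (i : Fin m) : dg (tb j i) j' = if j = j' then xb i else 0 := by
  ext z; rcases z with z | z <;> by_cases h : j = j' <;> simp [tb_inr, xb_inr, h]

/-- swap in digit `j` -/
def swP (m : ℕ) (j : Fin t) (x : Fin t × ZZ m) : Fin t × ZZ m :=
  if x.1 = j then (x.1, Sum.swap x.2) else x

lemma swP_swP (j : Fin t) (x : Fin t × ZZ m) : swP m j (swP m j x) = x := by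
  obtain ⟨a, b⟩ := x
  by_cases h : a = j <;> simp [swP, h]

/-- swap as an equivalence -/
def swQ (m : ℕ) (j : Fin t) : Fin t × ZZ m ≃ Fin t × ZZ m :=
  ⟨swP m j, swP m j, swP_swP j, swP_swP j⟩

/-- swap on exponents -/
def swT (j : Fin t) (E : TE m t) : TE m t := Finsupp.mapDomain (swP m j) E

lemma swT_apply (j : Fin t) (E : TE m t) (x : Fin t × ZZ m) : swT j E x = E (swP m j x) :=
  Finsupp.mapDomain_equiv_apply (f := swQ m j) E x

@[simp] lemma swT_swT (j : Fin t) (E : TE m t) : swT j (swT j E) = E := by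
  ext x; simp [swT_apply, swP_swP]

lemma dg_swT (j j' : Fin t) (E : TE m t) :
    dg (swT j E) j' = if j' = j then swE (dg E j') else dg E j' := by
  ext z
  by_cases h : j' = j <;> simp [swT_apply, swP, h]

/-- swap on polynomials -/
def swA (K : Type) [Field K] (m : ℕ) (j : Fin t) : TP K m t →ₐ[K] TP K m t := rename (swP m j)

lemma swA_monomial (j : Fin t) (E : TE m t) (c : K) :
    swA K m j (monomial E c) = monomial (swT j E) c := rename_monomial _ _ _

lemma coeff_swA (j : Fin t) (E : TE m t) (u : TP K m t) :
    coeff E (swA K m j u) = coeff (swT j E) u := by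
  have := coeff_rename_mapDomain (swP m j) (swQ m j).injective u (swT j E)
  rw [← this]
  congr 1
  exact (swT_swT j E).symm

lemma swA_swA (j : Fin t) (u : TP K m t) : swA K m j (swA K m j u) = u := by
  ext E; simp [coeff_swA]

lemma swT_comm (j j' : Fin t) (E : TE m t) : swT j (swT j' E) = swT j' (swT j E) := by
  refine dg_ext fun i => ?_
  simp only [dg_swT]
  split_ifs <;> rfl

lemma swA_comm (j j' : Fin t) (u : TP K m t) :
    swA K m j (swA K m j' u) = swA K m j' (swA K m j u) := by
  ext E; simp [coeff_swA, swT_comm]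

/-- lowering operators -/
def Dl (j : Fin t) (i l : Fin m) (u : TP K m t) : TP K m t :=
  pderiv (j, Sum.inr i) (pderiv (j, Sum.inl l) u) + pderiv (j, Sum.inr l) (pderiv (j, Sum.inl i) u)

/-- weights -/
def wt (E : TE m t) (j : Fin t) (i : Fin m) : ℕ := E (j, Sum.inl i) + E (j, Sum.inr i)

/-- weight operators -/
def Gd (j : Fin t) (i : Fin m) (u : TP K m t) : TP K m t :=
  X (j, Sum.inl i) * pderiv (j, Sum.inl i) u + X (j, Sum.inr i) * pderiv (j, Sum.inr i) u

lemma coeff_X_pd (x : Fin t × ZZ m) (u : TP K m t) (E : TE m t) :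
    coeff E (X x * pderiv x u) = E x * coeff E u := by
  rw [coeff_X_mul']
  split_ifs with h
  · rw [coeff_pderiv]
    have h1 : Finsupp.single x 1 ≤ E := by
      simpa [Nat.one_le_iff_ne_zero] using h
    rw [tsub_add_cancel_of_le h1, mul_comm]
    congr 1
    have h2 : 1 ≤ E x := by simpa using h1
    simp only [Finsupp.coe_tsub, Pi.sub_apply, Finsupp.single_eq_same]
    rw [Nat.cast_sub h2]; simp
  · have : E x = 0 := by simpa using h
    simp [this]

lemma coeff_Gd (j : Fin t) (i : Fin m) (u : TP K m t) (E : TE m t) :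
    coeff E (Gd j i u) = wt E j i * coeff E u := by
  rw [Gd, coeff_add, coeff_X_pd, coeff_X_pd, wt]
  push_cast; ring

lemma coeff_Dl (j : Fin t) (i l : Fin m) (u : TP K m t) (E : TE m t) :
    coeff E (Dl j i l u) =
      coeff (E + ta j l + tb j i) u * ((E (j, Sum.inl l) : K) + 1) * ((E (j, Sum.inr i) : K) + 1) +
      coeff (E + ta j i + tb j l) u * ((E (j, Sum.inl i) : K) + 1) * ((E (j, Sum.inr l) : K) + 1) := by
  rw [Dl, coeff_add, coeff_pderiv, coeff_pderiv, coeff_pderiv, coeff_pderiv]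
  rw [add_right_comm E (ta j l), add_right_comm E (ta j i)]
  simp [ta, tb]

variable (k : Fin t → K) (c : Fin t → ℤ) (p : ℕ)

/-- good charge -/
def gcE (E : TE m t) : Prop := ∀ j, chg (dg E j) = c j
/-- reduced -/
def rdE (E : TE m t) : Prop := ∀ j, red p (dg E j)

/-- trivial elements -/
def N0 (m : ℕ) : Submodule K (TP K m t) := Submodule.span K
  ({u | ∃ E : TE m t, gcE c E ∧ ¬ rdE p E ∧ u = monomial E 1} ∪
   {u | ∃ E : TE m t, ∃ j, gcE c E ∧ k j ≠ 0 ∧ u = monomial (swT j E) 1 - k j • monomial E 1})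

/-- the class of symmetric truncated polynomials -/
structure Cl (u : TP K m t) : Prop where
  gc : ∀ E, coeff E u ≠ 0 → gcE c E
  rd : ∀ E, coeff E u ≠ 0 → rdE p E
  sy : ∀ j, k j ≠ 0 → ∀ E, coeff (swT j E) u = k j * coeff E u
  ne : u ≠ 0

variable {k c p}

lemma gcE_swT (hkc : ∀ j, k j ≠ 0 → c j = 0) {j : Fin t} (hj : k j ≠ 0) {E : TE m t} :
    gcE c (swT j E) ↔ gcE c E := by
  refine forall_congr' fun i => ?_
  rw [dg_swT]
  split_ifs with h
  · subst h
    rw [chg_swE, hkc i hj]; omega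
  · rfl

lemma rdE_swT [Fact p.Prime] {j : Fin t} {E : TE m t} : rdE p (swT j E) ↔ rdE p E := by
  refine forall_congr' fun i => ?_
  rw [dg_swT]
  split_ifs with h
  · exact ⟨fun h z => by simpa using h (Sum.swap z), fun h z => by simpa using h (Sum.swap z)⟩
  · rfl

lemma sym_step (h2 : (2 : K) ≠ 0) (hk1 : ∀ j, k j ≠ 0 → k j * k j = 1)
    (hkc : ∀ j, k j ≠ 0 → c j = 0) {u0 : TP K m t} (hu0 : ∀ E, coeff E u0 ≠ 0 → gcE c E)
    (B : Finset (Fin t)) : ∃ u : TP K m t, u0 - u ∈ N0 k c p m ∧ (∀ E, coeff E u ≠ 0 → gcE c E) ∧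
      ∀ j ∈ B, k j ≠ 0 → swA K m j u = k j • u := by
  induction B using Finset.induction_on with
  | empty => exact ⟨u0, by simp, hu0, by simp⟩
  | insert b B hb ih =>
    obtain ⟨u, h1, h3, h4⟩ := ih
    by_cases hkb : k b = 0
    · refine ⟨u, h1, h3, ?_⟩
      intro j hj hj0
      rcases Finset.mem_insert.mp hj with rfl | hj
      · exact absurd hkb hj0
      · exact h4 j hj hj0
    · refine ⟨(2 : K)⁻¹ • (u + k b • swA K m b u), ?_, ?_, ?_⟩
      · have e1 : u0 - (2 : K)⁻¹ • (u + k b • swA K m b u) =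
            (u0 - u) - ((2 : K)⁻¹ * k b) • (swA K m b u - k b • u) := by
          have e2 : ((2 : K)⁻¹ * k b) • (swA K m b u - k b • u) =
              (2 : K)⁻¹ • (k b • swA K m b u) - (2 : K)⁻¹ • u := by
            rw [smul_sub, smul_smul, smul_smul, mul_assoc, hk1 b hkb, mul_one]
          have e3 : u = (2 : K)⁻¹ • u + (2 : K)⁻¹ • u := by
            rw [← add_smul, ← two_mul, mul_inv_cancel₀ h2, one_smul]
          rw [e2, smul_add]
          conv_rhs => rw [sub_eq_add_neg u0 u]; rw [show -u = -((2 : K)⁻¹ • u + (2 : K)⁻¹ • u) by rw [← e3]]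
          abel
        rw [e1]
        refine Submodule.sub_mem _ h1 (Submodule.smul_mem _ _ ?_)
        have e5 : swA K m b u - k b • u = ∑ E ∈ u.support, coeff E u •
            (monomial (swT b E) 1 - k b • monomial E 1 : TP K m t) := by
          conv_lhs => rw [← support_sum_monomial_coeff u]
          rw [map_sum, Finset.smul_sum, ← Finset.sum_sub_distrib]
          refine Finset.sum_congr rfl fun E _ => ?_
          rw [swA_monomial, smul_sub, smul_monomial, smul_monomial, smul_monomial, smul_monomial]
          simp [mul_comm]
        rw [e5]
        refine Submodule.sum_mem _ fun E hE => Submodule.smul_mem _ _ (Submodule.subset_span ?_)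
        exact Or.inr ⟨E, b, h3 E (mem_support_iff.mp hE), hkb, rfl⟩
      · intro E hE
        by_contra hn
        have a1 : coeff E u = 0 := by by_contra h; exact hn (h3 E h)
        have a2 : coeff (swT b E) u = 0 := by
          by_contra h; exact hn ((gcE_swT hkc hkb).mp (h3 _ h))
        apply hE
        simp [coeff_swA, a1, a2]
      · intro j hj hj0
        rcases Finset.mem_insert.mp hj with rfl | hj
        · rw [map_smul, map_add, map_smul, swA_swA, smul_comm (k j)]
          congr 1
          rw [smul_add, smul_smul, hk1 j hj0, one_smul, add_comm]
        · rw [map_smul, map_add, map_smul, swA_comm, h4 j hj hj0, map_smul, smul_comm (k j) (2 : K)⁻¹,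
            smul_add (k j), smul_comm (k j) (k b)]

lemma exists_Cl [hp : Fact p.Prime] (h2 : (2 : K) ≠ 0) (hk1 : ∀ j, k j ≠ 0 → k j * k j = 1)
    (hkc : ∀ j, k j ≠ 0 → c j = 0) {u0 : TP K m t} (hu0 : ∀ E, coeff E u0 ≠ 0 → gcE c E)
    (hn : u0 ∉ N0 k c p m) : ∃ u : TP K m t, u0 - u ∈ N0 k c p m ∧ Cl k c p u := by
  obtain ⟨u, h1, h3, h4⟩ := sym_step (p := p) h2 hk1 hkc hu0 Finset.univ
  set v : TP K m t := ∑ E ∈ u.support with rdE p E, monomial E (coeff E u) with hv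
  have cv : ∀ E, coeff E v = if rdE p E then coeff E u else 0 := by
    intro E
    rw [hv, coeff_sum]
    simp only [coeff_monomial]
    rw [Finset.sum_ite_eq']
    simp only [Finset.mem_filter, mem_support_iff]
    by_cases ha : coeff E u = 0 <;> by_cases hb : rdE p E <;> simp [ha, hb]
  have huv : u0 - v ∈ N0 k c p m := by
    have : u0 - v = (u0 - u) + (u - v) := by ring
    rw [this]
    refine Submodule.add_mem _ h1 ?_
    have : u - v = ∑ E ∈ u.support with ¬ rdE p E, coeff E u • monomial E 1 := by
      conv_lhs => rw [← support_sum_monomial_coeff u]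
      rw [hv, ← Finset.sum_filter_add_sum_filter_not u.support (rdE p),
        add_sub_cancel_left]
      refine Finset.sum_congr rfl fun E _ => ?_
      rw [smul_monomial, smul_eq_mul, mul_one]
    rw [this]
    refine Submodule.sum_mem _ fun E hE => Submodule.smul_mem _ _ (Submodule.subset_span ?_)
    rw [Finset.mem_filter] at hE
    exact Or.inl ⟨E, h3 E (mem_support_iff.mp hE.1), hE.2, rfl⟩
  refine ⟨v, huv, ?_, ?_, ?_, ?_⟩
  · intro E hE
    rw [cv] at hE
    split_ifs at hE
    · exact h3 E hE
    · exact absurd rfl hE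
  · intro E hE
    rw [cv] at hE
    split_ifs at hE with h
    · exact h
    · exact absurd rfl hE
  · intro j hj E
    rw [cv, cv]
    have := congrArg (coeff E) (h4 j (Finset.mem_univ _) hj)
    rw [coeff_swA, coeff_smul, smul_eq_mul] at this
    by_cases h : rdE p E
    · rw [if_pos h, if_pos (rdE_swT.mpr h), this]
    · rw [if_neg h, if_neg (fun h' => h (rdE_swT.mp h')), mul_zero]
  · intro h0
    rw [h0, sub_zero] at huv
    exact hn huv

/-- shape of minimal exponents -/
def Gs (p : ℕ) (k : K) (c : ℤ) (e : ZZ m →₀ ℕ) : Prop :=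
  red p e ∧ chg e = c ∧
  ((c ≠ 0 ∧ ((∀ i, e (Sum.inl i) = 0) ∨ ∀ i, e (Sum.inr i) = 0)) ∨
   (k = 1 ∧ e = 0) ∨
   (k = -1 ∧ ∃ i l, i ≠ l ∧ e = xa i + xb l))

lemma Gs.gn {p : ℕ} {k : K} {c : ℤ} {e : ZZ m →₀ ℕ} (h : Gs p k c e) : Gn p k c e := by
  obtain ⟨h1, h2, h3⟩ := h
  refine ⟨h1, h2, ?_⟩
  rcases h3 with h | h | h
  · exact Or.inl h
  · exact Or.inr (Or.inl h)
  · exact Or.inr (Or.inr (Or.inl h))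

lemma Gs.wt {p : ℕ} {k : K} {c : ℤ} {e : ZZ m →₀ ℕ} (h : Gs p k c e) (i : Fin m) :
    e (Sum.inl i) = 0 ∨ e (Sum.inr i) = 0 := by
  obtain ⟨h1, h2, h3⟩ := h
  rcases h3 with ⟨_, h | h⟩ | ⟨_, h⟩ | ⟨_, a, b, hab, h⟩
  · exact Or.inl (h i)
  · exact Or.inr (h i)
  · left; rw [h]; rfl
  · rw [h]
    simp only [Finsupp.coe_add, Pi.add_apply, xa_inl, xb_inr, xa_inr, xb_inl]
    by_cases hai : a = i
    · right
      have : b ≠ i := by rintro rfl; exact hab hai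
      simp [this]
    · left; simp [hai]

lemma chg_nonneg {e : ZZ m →₀ ℕ} (he : ∀ i, e (Sum.inr i) = 0) : 0 ≤ chg e := by
  simp only [chg, he]
  simp
  exact Finset.sum_nonneg fun i _ => by positivity

lemma chg_nonpos {e : ZZ m →₀ ℕ} (he : ∀ i, e (Sum.inl i) = 0) : chg e ≤ 0 := by
  simp only [chg, he]
  simp
  exact Finset.sum_nonneg fun i _ => by positivity

lemma pair_cmp {a b a' b' : Fin m} (hab : a ≠ b)
    (hw : ∀ i, (if a = i then 1 else 0) + (if b = i then 1 else 0) =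
      (if a' = i then 1 else 0) + (if b' = i then 1 else 0)) :
    (a = a' ∧ b = b') ∨ (a = b' ∧ b = a') := by
  have w1 := hw a
  have w2 := hw b
  rw [if_pos rfl, if_neg hab.symm] at w1
  rw [if_pos rfl, if_neg hab] at w2
  by_cases h1 : a' = a
  · have h2 : ¬ a' = b := fun h => hab (h1.symm.trans h)
    rw [if_neg h2] at w2
    by_cases h3 : b' = b
    · exact Or.inl ⟨h1.symm, h3.symm⟩
    · rw [if_neg h3] at w2; omega
  · rw [if_neg h1] at w1
    by_cases h3 : b' = a
    · have h2 : ¬ b' = b := fun h => hab (h3.symm.trans h)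
      rw [if_neg h2] at w2
      by_cases h4 : a' = b
      · exact Or.inr ⟨h3.symm, h4.symm⟩
      · rw [if_neg h4] at w2; omega
    · rw [if_neg h3] at w1; omega

lemma Gs_cmp {p : ℕ} {k : K} {c : ℤ} (h2 : (2 : K) ≠ 0)
    (hk : (k = 0 ∧ c ≠ 0) ∨ (k = 1 ∧ c = 0) ∨ (k = -1 ∧ c = 0)) {e e0 : ZZ m →₀ ℕ}
    (he : Gs p k c e) (he0 : Gs p k c e0)
    (hw : ∀ i, e (Sum.inl i) + e (Sum.inr i) = e0 (Sum.inl i) + e0 (Sum.inr i)) :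
    e = e0 ∨ (k = -1 ∧ e = swE e0) := by
  have h11 : (1 : K) ≠ -1 := fun h => h2 (by linear_combination h)
  obtain ⟨_, hc, h⟩ := he
  obtain ⟨_, hc0, h0⟩ := he0
  rcases hk with ⟨hk, hcc⟩ | ⟨hk, hcc⟩ | ⟨hk, hcc⟩
  · left
    have hk1 : k ≠ 1 := by rw [hk]; exact zero_ne_one
    have hk2 : k ≠ -1 := by rw [hk]; simp
    simp only [hk1, hk2, false_and, or_false, hcc, ne_eq, not_false_iff, true_and] at h h0
    have key : ((∀ i, e (Sum.inl i) = 0) ∧ ∀ i, e0 (Sum.inl i) = 0) ∨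
        ((∀ i, e (Sum.inr i) = 0) ∧ ∀ i, e0 (Sum.inr i) = 0) := by
      rcases h with h | h <;> rcases h0 with h0 | h0
      · exact Or.inl ⟨h, h0⟩
      · exfalso; have := chg_nonpos h; have := chg_nonneg h0; omega
      · exfalso; have := chg_nonneg h; have := chg_nonpos h0; omega
      · exact Or.inr ⟨h, h0⟩
    ext z
    rcases key with ⟨a, b⟩ | ⟨a, b⟩ <;> rcases z with i | i <;> have w := hw i <;>
      have a' := a i <;> have b' := b i <;> omega
  · left
    have hk2 : k ≠ -1 := by rw [hk]; exact h11
    simp only [hk2, false_and, or_false, hcc, ne_eq, not_true, false_or] at h h0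
    rw [h.2, h0.2]
  · have hk2 : k ≠ 1 := by rw [hk]; exact h11.symm
    simp only [hk2, false_and, hcc, ne_eq, not_true, false_or] at h h0
    obtain ⟨_, a, b, hab, rfl⟩ := h
    obtain ⟨_, a', b', hab', rfl⟩ := h0
    simp only [Finsupp.coe_add, Pi.add_apply, xa_inl, xb_inr, xa_inr, xb_inl, add_zero, zero_add] at hw
    rcases pair_cmp hab hw with ⟨rfl, rfl⟩ | ⟨rfl, rfl⟩
    · exact Or.inl rfl
    · refine Or.inr ⟨hk, ?_⟩
      rw [swE_add, swE_xa, swE_xb, add_comm]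

/-- consequences of being killed by the lowering operators -/
lemma killed_shape [hp : Fact p.Prime] [CharP K p] (h2 : (2 : K) ≠ 0)
    (hk : ∀ j, (k j = 0 ∧ c j ≠ 0) ∨ (k j = 1 ∧ c j = 0) ∨ (k j = -1 ∧ c j = 0))
    {u : TP K m t} (hu : Cl k c p u) (hD : ∀ j i l, Dl j i l u = 0) (F : TE m t)
    (hF : coeff F u ≠ 0) (j : Fin t) : Gs p (k j) (c j) (dg F j) := by
  have neg_self : ∀ a : K, a = -a → a = 0 := by
    intro a ha
    have : 2 * a = 0 := by rw [two_mul]; nth_rewrite 1 [ha]; ring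
    exact (mul_eq_zero.mp this).resolve_left h2
  have splita : ∀ (e : TE m t) i, 1 ≤ e (j, Sum.inl i) → ∃ e', e = e' + ta j i := fun e i h =>
    ⟨e - ta j i, (tsub_add_cancel_of_le (by simpa [ta] using h)).symm⟩
  have splitb : ∀ (e : TE m t) i, 1 ≤ e (j, Sum.inr i) → ∃ e', e = e' + tb j i := fun e i h =>
    ⟨e - tb j i, (tsub_add_cancel_of_le (by simpa [tb] using h)).symm⟩
  have key : ∀ (E : TE m t) i l, coeff (E + ta j l + tb j i) u * ((E (j, Sum.inl l) : K) + 1) * ((E (j, Sum.inr i) : K) + 1) +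
      coeff (E + ta j i + tb j l) u * ((E (j, Sum.inl i) : K) + 1) * ((E (j, Sum.inr l) : K) + 1) = 0 := by
    intro E i l
    rw [← coeff_Dl, hD]; simp
  have cne : ∀ (E : TE m t) i l, coeff (E + ta j i + tb j l) u ≠ 0 →
      ((E (j, Sum.inl i) : K) + 1) ≠ 0 ∧ ((E (j, Sum.inr l) : K) + 1) ≠ 0 := by
    intro E i l h
    have h1 := hu.rd _ h j (Sum.inl i)
    have h3 := hu.rd _ h j (Sum.inr l)
    simp [ta_inl, tb_inr] at h1 h3
    exact ⟨cast_succ_ne (p := p) h1, cast_succ_ne (p := p) h3⟩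
  have f1 : ∀ (F : TE m t) i, coeff F u ≠ 0 → 1 ≤ F (j, Sum.inl i) → 1 ≤ F (j, Sum.inr i) → False := by
    intro F i hF ha hb
    obtain ⟨E1, rfl⟩ := splita F i ha
    obtain ⟨E2, rfl⟩ := splitb E1 i (by simpa using hb)
    rw [add_right_comm] at hF
    obtain ⟨c1, c2⟩ := cne _ _ _ hF
    have := key E2 i i
    rw [← two_mul] at this
    exact (mul_ne_zero h2 (mul_ne_zero (mul_ne_zero hF c1) c2)) this
  have f2 : ∀ (E : TE m t) i l, i ≠ l → coeff (E + ta j i + tb j l) u ≠ 0 →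
      E (j, Sum.inl i) = 0 ∧ E (j, Sum.inr l) = 0 ∧ E (j, Sum.inr i) = 0 ∧ E (j, Sum.inl l) = 0 ∧
      coeff (E + ta j l + tb j i) u = - coeff (E + ta j i + tb j l) u := by
    intro E i l hil hF
    obtain ⟨c1, c2⟩ := cne _ _ _ hF
    have hk1 := key E i l
    have hF' : coeff (E + ta j l + tb j i) u ≠ 0 := by
      intro h0
      rw [h0, zero_mul, zero_mul, zero_add] at hk1
      exact (mul_ne_zero (mul_ne_zero hF c1) c2) hk1
    have a1 : E (j, Sum.inl i) = 0 := by
      by_contra h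
      exact f1 _ i hF' (by simp; omega) (by simp [tb_inr])
    have a2 : E (j, Sum.inr l) = 0 := by
      by_contra h
      exact f1 _ l hF' (by simp [ta_inl]) (by simp; omega)
    have a3 : E (j, Sum.inr i) = 0 := by
      by_contra h
      exact f1 _ i hF (by simp [ta_inl]) (by simp; omega)
    have a4 : E (j, Sum.inl l) = 0 := by
      by_contra h
      exact f1 _ l hF (by simp; omega) (by simp [tb_inr])
    refine ⟨a1, a2, a3, a4, ?_⟩
    rw [a1, a2, a3, a4] at hk1
    simp at hk1
    exact eq_neg_of_add_eq_zero_left hk1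
  have f3 : ∀ (E : TE m t) i l, i ≠ l → coeff (E + ta j i + tb j l) u ≠ 0 → dg E j = 0 := by
    intro E i l hil hF
    obtain ⟨a1, a2, a3, a4, a5⟩ := f2 E i l hil hF
    by_contra h0
    obtain ⟨z, hz⟩ := Finsupp.ne_iff.mp h0
    simp only [dg_apply, Finsupp.coe_zero, Pi.zero_apply] at hz
    rcases z with z | z
    · have hzi : z ≠ i := by rintro rfl; exact hz a1
      have hzl : z ≠ l := by rintro rfl; exact hz a4
      obtain ⟨E', rfl⟩ := splita E z (by omega)
      have r1 : E' + ta j z + ta j l + tb j i = E' + ta j l + ta j z + tb j i := by abel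
      have r2 : E' + ta j l + ta j i + tb j z = E' + ta j i + ta j l + tb j z := by abel
      have r3 : E' + ta j i + ta j z + tb j l = E' + ta j z + ta j i + tb j l := by abel
      have n1 : coeff (E' + ta j l + ta j z + tb j i) u ≠ 0 := by
        rw [← r1, a5]; exact neg_ne_zero.mpr hF
      have a6 := (f2 (E' + ta j l) z i hzi n1).2.2.2.2
      have n2 : coeff (E' + ta j i + ta j l + tb j z) u ≠ 0 := by
        rw [← r2, a6]; exact neg_ne_zero.mpr n1
      have a7 := (f2 (E' + ta j i) l z hzl.symm n2).2.2.2.2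
      apply hF
      apply neg_self
      rw [r3, ← r2, a6, ← r1, a5] at a7
      linear_combination a7
    · have hzi : z ≠ i := by rintro rfl; exact hz a3
      have hzl : z ≠ l := by rintro rfl; exact hz a2
      obtain ⟨E', rfl⟩ := splitb E z (by omega)
      have r1 : E' + tb j z + ta j l + tb j i = E' + tb j i + ta j l + tb j z := by abel
      have r2 : E' + tb j i + ta j z + tb j l = E' + tb j l + ta j z + tb j i := by abel
      have r3 : E' + tb j l + ta j i + tb j z = E' + tb j z + ta j i + tb j l := by abel
      have n1 : coeff (E' + tb j i + ta j l + tb j z) u ≠ 0 := by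
        rw [← r1, a5]; exact neg_ne_zero.mpr hF
      have a6 := (f2 (E' + tb j i) l z hzl.symm n1).2.2.2.2
      have n2 : coeff (E' + tb j l + ta j z + tb j i) u ≠ 0 := by
        rw [← r2, a6]; exact neg_ne_zero.mpr n1
      have a7 := (f2 (E' + tb j l) z i hzi n2).2.2.2.2
      apply hF
      apply neg_self
      rw [r3, ← r2, a6, ← r1, a5] at a7
      linear_combination a7
  have hrd := hu.rd F hF j
  have hgc := hu.gc F hF j
  refine ⟨hrd, hgc, ?_⟩
  by_cases hp1 : (∀ i, dg F j (Sum.inl i) = 0) ∨ ∀ i, dg F j (Sum.inr i) = 0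
  · by_cases hc0 : c j = 0
    · have hz : dg F j = 0 := by
        rw [hc0] at hgc
        rcases hp1 with h | h
        · have h3 : ∑ i, (dg F j (Sum.inr i) : ℤ) = 0 := by
            simp only [chg, h] at hgc; simpa using hgc
          rw [Finset.sum_eq_zero_iff_of_nonneg (fun i _ => by positivity)] at h3
          ext z
          rcases z with z | z
          · exact h z
          · exact_mod_cast h3 z (Finset.mem_univ _)
        · have h3 : ∑ i, (dg F j (Sum.inl i) : ℤ) = 0 := by
            simp only [chg, h] at hgc; simpa using hgc
          rw [Finset.sum_eq_zero_iff_of_nonneg (fun i _ => by positivity)] at h3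
          ext z
          rcases z with z | z
          · exact_mod_cast h3 z (Finset.mem_univ _)
          · exact h z
      rcases hk j with ⟨_, h⟩ | ⟨h, _⟩ | ⟨h, _⟩
      · exact absurd hc0 h
      · exact Or.inr (Or.inl ⟨h, hz⟩)
      · exfalso
        have := hu.sy j (by rw [h]; simp) F
        have hs : swT j F = F := by
          refine dg_ext fun i => ?_
          rw [dg_swT]
          split_ifs with hi
          · subst hi; rw [hz]; ext z; simp
          · rfl
        rw [hs, h] at this
        exact hF (neg_self _ (by linear_combination this))
    · exact Or.inl ⟨hc0, hp1⟩
  · push Not at hp1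
    obtain ⟨⟨i, hi⟩, l, hl⟩ := hp1
    rw [dg_apply] at hi hl
    have hil : i ≠ l := by
      rintro rfl
      exact f1 F i hF (by omega) (by omega)
    obtain ⟨E1, rfl⟩ := splita F i (by omega)
    obtain ⟨E, rfl⟩ := splitb E1 l (by simp at hl; omega)
    rw [add_right_comm] at hF hgc ⊢
    have hz := f3 E i l hil hF
    have hd : dg (E + ta j i + tb j l) j = xa i + xb l := by
      rw [dg_add, dg_add, hz, dg_ta, dg_tb]; simp
    have hc0 : c j = 0 := by
      rw [← hgc, hd]; simp [chg_add]
    rcases hk j with ⟨_, h⟩ | ⟨h, _⟩ | ⟨h, _⟩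
    · exact absurd hc0 h
    · exfalso
      have := hu.sy j (by rw [h]; simp) (E + ta j i + tb j l)
      have hs : swT j (E + ta j i + tb j l) = E + ta j l + tb j i := by
        refine dg_ext fun i' => ?_
        rw [dg_swT]
        split_ifs with hi'
        · subst hi'
          simp only [dg_add, dg_ta, dg_tb, hz, if_true, swE_add, swE_xa, swE_xb]
          ext z; rcases z with z | z <;> simp [add_comm]
        · simp [dg_add, dg_ta, dg_tb, Ne.symm hi']
      rw [hs, h, (f2 E i l hil hF).2.2.2.2] at this
      exact hF (neg_self _ (by linear_combination -this))
    · exact Or.inr (Or.inr ⟨h, i, l, hil, hd⟩)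

lemma Cl_Dl (hk1 : ∀ j, k j ≠ 0 → k j * k j = 1)
    {u : TP K m t} (hu : Cl k c p u) (j : Fin t) (i l : Fin m) (h0 : Dl j i l u ≠ 0) :
    Cl k c p (Dl j i l u) := by
  have sub : ∀ E, coeff E (Dl j i l u) ≠ 0 → ∃ a b, coeff (E + ta j a + tb j b) u ≠ 0 := by
    intro E hE
    by_contra h
    push Not at h
    apply hE
    rw [coeff_Dl, h, h]; simp
  refine ⟨?_, ?_, ?_, h0⟩
  · intro E hE j'
    obtain ⟨a, b, h⟩ := sub E hE
    have := hu.gc _ h j'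
    rw [← this, dg_add, dg_add, chg_add, chg_add, dg_ta, dg_tb]
    split_ifs
    · simp
    · simp [chg]
  · intro E hE j' z
    obtain ⟨a, b, h⟩ := sub E hE
    refine le_trans ?_ (hu.rd _ h j' z)
    simp [add_assoc]
  · intro j' hj' E
    rw [coeff_Dl, coeff_Dl]
    by_cases hjj : j = j'
    · subst hjj
      have s1 : ∀ a b, swT j E + ta j a + tb j b = swT j (E + ta j b + tb j a) := by
        intro a b
        refine dg_ext fun i' => ?_
        simp only [dg_add, dg_ta, dg_tb, dg_swT]
        by_cases h : i' = j
        · subst h; simp [swE_add]; abel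
        · simp [h, Ne.symm h]
      have s2 : ∀ a, swT j E (j, Sum.inl a) = E (j, Sum.inr a) := by intro a; simp [swT_apply, swP]
      have s3 : ∀ a, swT j E (j, Sum.inr a) = E (j, Sum.inl a) := by intro a; simp [swT_apply, swP]
      rw [s1, s1, hu.sy j hj', hu.sy j hj', s2, s2, s3, s3]
      ring
    · have s1 : ∀ a b, swT j' E + ta j a + tb j b = swT j' (E + ta j a + tb j b) := by
        intro a b
        refine dg_ext fun i' => ?_
        simp only [dg_add, dg_ta, dg_tb, dg_swT]
        by_cases h : i' = j'
        · subst h; simp [hjj]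
        · simp [h]
      have s2 : ∀ a, swT j' E (j, a) = E (j, a) := by intro a; simp [swT_apply, swP, hjj]
      rw [s1, s1, hu.sy j' hj', hu.sy j' hj', s2, s2, s2, s2]
      ring

lemma totalDegree_Dl {u : TP K m t} (j : Fin t) (i l : Fin m) (h0 : Dl j i l u ≠ 0) :
    (Dl j i l u).totalDegree < u.totalDegree := by
  have sub : ∀ E, coeff E (Dl j i l u) ≠ 0 → ∃ a b, coeff (E + ta j a + tb j b) u ≠ 0 := by
    intro E hE
    by_contra h
    push Not at h
    apply hE
    rw [coeff_Dl, h, h]; simp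
  have hlt : ∀ E, coeff E (Dl j i l u) ≠ 0 → (E.sum fun _ e => e) < u.totalDegree := by
    intro E hE
    obtain ⟨a, b, h⟩ := sub E hE
    have := le_totalDegree (mem_support_iff.mpr h)
    rw [Finsupp.sum_add_index' (by simp) (by simp), Finsupp.sum_add_index' (by simp) (by simp), ta, tb,
      Finsupp.sum_single_index (by simp), Finsupp.sum_single_index (by simp)] at this
    omega
  obtain ⟨E, hE⟩ := ne_zero_iff.mp h0
  have hpos : 0 < u.totalDegree := lt_of_le_of_lt (Nat.zero_le _) (hlt E hE)
  rw [totalDegree, Finset.sup_lt_iff (by simpa using hpos)]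
  intro E hE
  exact hlt E (mem_support_iff.mp hE)

lemma Cl_Gd {u : TP K m t} (hu : Cl k c p u) (j : Fin t) (i : Fin m) (a : K)
    (h0 : Gd j i u - a • u ≠ 0) : Cl k c p (Gd j i u - a • u) := by
  have cf : ∀ E, coeff E (Gd j i u - a • u) = (wt E j i - a) * coeff E u := by
    intro E
    rw [coeff_sub, coeff_Gd, coeff_smul, smul_eq_mul]; ring
  refine ⟨?_, ?_, ?_, h0⟩
  · intro E hE
    rw [cf] at hE
    exact hu.gc E (right_ne_zero_of_mul hE)
  · intro E hE
    rw [cf] at hE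
    exact hu.rd E (right_ne_zero_of_mul hE)
  · intro j' hj' E
    rw [cf, cf, hu.sy j' hj']
    have : wt (swT j' E) j i = wt E j i := by
      simp only [wt, swT_apply, swP]
      by_cases h : j = j'
      · simp [h, add_comm]
      · simp [h]
    rw [this]; ring

/-- partially swapped exponents -/
def swB (B : Finset (Fin t)) (E : TE m t) : TE m t :=
  Finsupp.equivFunOnFinite.symm fun x => E (x.1, if x.1 ∈ B then Sum.swap x.2 else x.2)

lemma dg_swB (B : Finset (Fin t)) (E : TE m t) (j : Fin t) :
    dg (swB B E) j = if j ∈ B then swE (dg E j) else dg E j := by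
  ext z
  by_cases h : j ∈ B <;> simp [swB, h]

lemma swB_insert (B : Finset (Fin t)) (b : Fin t) (hb : b ∉ B) (E : TE m t) :
    swB (insert b B) E = swT b (swB B E) := by
  refine dg_ext fun j => ?_
  rw [dg_swT, dg_swB, dg_swB]
  by_cases h : j = b
  · subst h; simp [hb]
  · simp [h]

lemma swB_empty (E : TE m t) : swB ∅ E = E := by
  refine dg_ext fun j => ?_
  rw [dg_swB]; simp

set_option maxHeartbeats 800000 in
theorem lower [hp : Fact p.Prime] [CharP K p] (h2 : (2 : K) ≠ 0)
    (hk : ∀ j, (k j = 0 ∧ c j ≠ 0) ∨ (k j = 1 ∧ c j = 0) ∨ (k j = -1 ∧ c j = 0))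
    (N : Submodule K (TP K m t))
    (hD : ∀ u ∈ N, (∀ E, coeff E u ≠ 0 → gcE c E) → ∀ j i l, Dl j i l u ∈ N)
    (hG : ∀ u ∈ N, (∀ E, coeff E u ≠ 0 → gcE c E) → ∀ j i, Gd j i u ∈ N)
    (hN : N0 k c p m ≤ N) {u0 : TP K m t} (hu0 : ∀ E, coeff E u0 ≠ 0 → gcE c E)
    (hu0N : u0 ∈ N) (hn : u0 ∉ N0 k c p m) :
    ∃ E0 : TE m t, (∀ j, Gn p (k j) (c j) (dg E0 j)) ∧ monomial E0 1 ∈ N := by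
  have hk1 : ∀ j, k j ≠ 0 → k j * k j = 1 := by
    intro j hj
    rcases hk j with ⟨h, _⟩ | ⟨h, _⟩ | ⟨h, _⟩
    · exact absurd h hj
    · rw [h, mul_one]
    · rw [h]; ring
  have hkc : ∀ j, k j ≠ 0 → c j = 0 := by
    intro j hj
    rcases hk j with ⟨h, _⟩ | ⟨h, h'⟩ | ⟨h, h'⟩
    · exact absurd h hj
    · exact h'
    · exact h'
  have hp2 : 2 ≤ p := hp.out.two_le
  obtain ⟨u1, hu1, hC1⟩ := exists_Cl (p := p) h2 hk1 hkc hu0 hn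
  have hu1N : u1 ∈ N := by
    have := N.sub_mem hu0N (hN hu1)
    rwa [sub_sub_cancel] at this
  -- minimal degree
  have ex1 : ∃ n, ∃ u ∈ N, Cl k c p u ∧ u.totalDegree = n := ⟨_, u1, hu1N, hC1, rfl⟩
  obtain ⟨u2, hu2N, hC2, hdeg⟩ := Nat.find_spec ex1
  have kill : ∀ j i l, Dl j i l u2 = 0 := by
    intro j i l
    by_contra h
    have h1 := totalDegree_Dl j i l h
    rw [hdeg] at h1
    exact Nat.find_min ex1 h1 ⟨_, hD u2 hu2N hC2.gc j i l, Cl_Dl hk1 hC2 j i l h, rfl⟩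
  have sh2 := killed_shape h2 hk hC2 kill
  -- minimal support
  have ex2 : ∃ n, ∃ u ∈ N, Cl k c p u ∧ (∀ F, coeff F u ≠ 0 → ∀ j, Gs p (k j) (c j) (dg F j)) ∧
    u.support.card = n := ⟨_, u2, hu2N, hC2, sh2, rfl⟩
  obtain ⟨u, huN, hC, sh, hcard⟩ := Nat.find_spec ex2
  have wtK : ∀ E E', coeff E u ≠ 0 → coeff E' u ≠ 0 → ∀ j i, (wt E j i : K) = wt E' j i := by
    intro E E' hE hE' j i
    by_contra hne
    set v := Gd j i u - (wt E' j i : K) • u with hv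
    have cf : ∀ E, coeff E v = (wt E j i - wt E' j i : K) * coeff E u := by
      intro E
      rw [hv, coeff_sub, coeff_Gd, coeff_smul, smul_eq_mul]; ring
    have hv0 : v ≠ 0 := by
      intro h0
      have := cf E
      rw [h0, coeff_zero] at this
      exact (mul_ne_zero (sub_ne_zero.mpr hne) hE) this.symm
    have hlt : v.support.card < u.support.card := by
      apply Finset.card_lt_card
      rw [Finset.ssubset_iff_of_subset]
      · refine ⟨E', mem_support_iff.mpr hE', ?_⟩
        rw [mem_support_iff, cf]; simp
      · intro F hF
        rw [mem_support_iff, cf] at hF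
        exact mem_support_iff.mpr (right_ne_zero_of_mul hF)
    rw [hcard] at hlt
    refine Nat.find_min ex2 hlt ⟨v, N.sub_mem (hG u huN hC.gc j i) (N.smul_mem _ huN),
      Cl_Gd hC j i _ hv0, ?_, rfl⟩
    intro F hF
    rw [cf] at hF
    exact sh F (right_ne_zero_of_mul hF)
  have wlt : ∀ E, coeff E u ≠ 0 → ∀ j i, wt E j i < p := by
    intro E hE j i
    obtain ⟨hr, hch, hs⟩ := sh E hE j
    have r1 := hr (Sum.inl i)
    have r2 := hr (Sum.inr i)
    rw [dg_apply] at r1 r2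
    have : E (j, Sum.inl i) = 0 ∨ E (j, Sum.inr i) = 0 := (sh E hE j).wt i
    rw [wt]
    rcases this with h | h <;> omega
  have weq : ∀ E E', coeff E u ≠ 0 → coeff E' u ≠ 0 → ∀ j i, wt E j i = wt E' j i := by
    intro E E' hE hE' j i
    have h1 := wtK E E' hE hE' j i
    rw [CharP.cast_eq_iff_mod_eq K p, Nat.mod_eq_of_lt (wlt E hE j i), Nat.mod_eq_of_lt (wlt E' hE' j i)] at h1
    exact h1
  obtain ⟨E0, hE0⟩ := ne_zero_iff.mp hC.ne
  -- comparison of digits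
  have cmp : ∀ E, coeff E u ≠ 0 → ∀ j, dg E j = dg E0 j ∨ (k j = -1 ∧ dg E j = swE (dg E0 j)) := by
    intro E hE j
    exact Gs_cmp h2 (hk j) (sh E hE j) (sh E0 hE0 j) (fun i => weq E E0 hE hE0 j i)
  -- swapped copies
  set T : Finset (Fin t) := Finset.univ.filter (fun j => k j = -1) with hT
  have swc : ∀ B ⊆ T, coeff (swB B E0) u = (∏ j ∈ B, k j) * coeff E0 u ∧
      monomial (swB B E0) 1 - (∏ j ∈ B, k j) • monomial E0 1 ∈ N := by
    intro B
    induction B using Finset.induction_on with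
    | empty => intro _; simp [swB_empty]
    | insert b B hb ih =>
      intro hB
      have hbT : k b = -1 := by
        have := hB (Finset.mem_insert_self b B)
        simpa [hT] using this
      have hb0 : k b ≠ 0 := by rw [hbT]; simp
      obtain ⟨i1, i2⟩ := ih (fun x hx => hB (Finset.mem_insert_of_mem hx))
      have hne : coeff (swB B E0) u ≠ 0 := by
        rw [i1]
        refine mul_ne_zero (Finset.prod_ne_zero_iff.mpr fun x hx => ?_) hE0
        have := hB (Finset.mem_insert_of_mem hx)
        have : k x = -1 := by simpa [hT] using this
        rw [this]; simp
      rw [swB_insert _ _ hb, Finset.prod_insert hb]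
      refine ⟨?_, ?_⟩
      · rw [hC.sy b hb0, i1, mul_assoc]
      · have a1 : (monomial (swT b (swB B E0)) 1 - k b • monomial (swB B E0) 1 : TP K m t) ∈ N :=
          hN (Submodule.subset_span (Or.inr ⟨_, b, hC.gc _ hne, hb0, rfl⟩))
        have := N.add_mem a1 (N.smul_mem (k b) i2)
        convert this using 1
        rw [smul_sub, smul_smul]; abel
  have hsupp : u.support = T.powerset.image (fun B => swB B E0) := by
    ext E
    rw [mem_support_iff, Finset.mem_image]
    constructor
    · intro hE
      refine ⟨T.filter (fun j => dg E j ≠ dg E0 j), by simp, ?_⟩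
      refine dg_ext fun j => ?_
      rw [dg_swB]
      rcases cmp E hE j with h | ⟨h1, h3⟩
      · rw [if_neg (by simp [h]), h]
      · by_cases h : dg E j = dg E0 j
        · rw [if_neg (by simp [h]), h]
        · rw [if_pos (by simp [h, hT, h1]), h3]
    · rintro ⟨B, hB, rfl⟩
      rw [(swc B (Finset.mem_powerset.mp hB)).1]
      refine mul_ne_zero (Finset.prod_ne_zero_iff.mpr fun x hx => ?_) hE0
      have := (Finset.mem_powerset.mp hB) hx
      have : k x = -1 := by simpa [hT] using this
      rw [this]; simp
  have swne : ∀ j ∈ T, swE (dg E0 j) ≠ dg E0 j := by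
    intro j hj
    have hj1 : k j = -1 := by simpa [hT] using hj
    obtain ⟨_, hch, hs⟩ := sh E0 hE0 j
    rcases hs with ⟨h1, _⟩ | ⟨h1, _⟩ | ⟨_, a, b, hab, h⟩
    · exact absurd (hkc j (by rw [hj1]; simp)) h1
    · rw [hj1] at h1; exfalso; apply h2; linear_combination -h1
    · intro h3
      rw [h, swE_add, swE_xa, swE_xb] at h3
      have := DFunLike.congr_fun h3 (Sum.inl a)
      simp [xa_inl, hab.symm] at this
  have hinj : Set.InjOn (fun B => swB B E0) (T.powerset : Set (Finset (Fin t))) := by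
    have half : ∀ B B' : Finset (Fin t), B ⊆ T → swB B E0 = swB B' E0 → B ⊆ B' := by
      intro B B' hB h j hj
      by_contra hj'
      have := congrArg (fun E => dg E j) h
      simp only [dg_swB, if_pos hj, if_neg hj'] at this
      exact swne j (hB hj) this
    intro B hB B' hB' h
    simp only [Finset.coe_powerset, Set.mem_preimage, Set.mem_powerset_iff, Finset.coe_subset] at hB hB'
    exact Finset.Subset.antisymm (half B B' hB h) (half B' B hB' h.symm)
  refine ⟨E0, fun j => (sh E0 hE0 j).gn, ?_⟩
  have hsum : u = ∑ B ∈ T.powerset, coeff (swB B E0) u • monomial (swB B E0) 1 := by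
    conv_lhs => rw [← support_sum_monomial_coeff u, hsupp, Finset.sum_image hinj]
    refine Finset.sum_congr rfl fun B _ => ?_
    rw [smul_monomial, smul_eq_mul, mul_one]
  have hmod : (∑ B ∈ T.powerset, coeff (swB B E0) u • (monomial (swB B E0) 1 : TP K m t)) -
      ∑ B ∈ T.powerset, coeff E0 u • monomial E0 1 ∈ N := by
    rw [← Finset.sum_sub_distrib]
    refine Submodule.sum_mem _ fun B hB => ?_
    rw [Finset.mem_powerset] at hB
    obtain ⟨i1, i2⟩ := swc B hB
    have hsq : (∏ j ∈ B, k j) * (∏ j ∈ B, k j) = 1 := by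
      rw [← Finset.prod_mul_distrib]
      refine Finset.prod_eq_one fun x hx => hk1 x ?_
      have := hB hx
      have : k x = -1 := by simpa [hT] using this
      rw [this]; simp
    have := N.smul_mem ((∏ j ∈ B, k j) * coeff E0 u) i2
    rw [i1]
    convert this using 1
    rw [smul_sub, smul_smul, mul_right_comm, hsq, one_mul]
  rw [← hsum] at hmod
  have h5 := N.sub_mem huN hmod
  rw [sub_sub_cancel, Finset.sum_const, Finset.card_powerset, ← Nat.cast_smul_eq_nsmul K, smul_smul] at h5
  refine (Submodule.smul_mem_iff _ (mul_ne_zero ?_ hE0)).mp h5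
  push_cast
  exact pow_ne_zero _ h2

end lower

end RS

namespace RS

section comb

variable {p t m d : ℕ} [NeZero t]

/-- lower bound for `s` -/
def lo (d : ℕ) : ℤ := if d = 0 then 1 else 0

/-- unsigned types -/
def Hc (p t m d : ℕ) [NeZero t] (s : Fin t → ℤ) : Prop :=
  (∀ j, lo d ≤ s j ∧ s j ≤ 2 * m - 1) ∧
  (∀ j, 0 ≤ lamOf p t d s j ∧ lamOf p t d s j ≤ 2 * m * ((p : ℤ) - 1))

lemma memCase_iff (s : Fin t → ℤ) (eps : Finset (Fin t)) :
    memCase p t m d s eps ↔ Hc p t m d s ∧ eps ⊆ Jset p t m d s := by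
  by_cases hd : d = 0
  · subst hd; simp [memCase, Hc, memS, memH, lo]
  · simp [memCase, Hc, memSd, memHd, lo, hd]

lemma lo_nonneg (d : ℕ) : 0 ≤ lo d := by
  rw [lo]; split_ifs <;> norm_num

lemma cyc_up {P : Fin t → Prop} (h : ∀ j, P j → P (j + 1)) {j0 : Fin t} (h0 : P j0) (j : Fin t) : P j := by
  have key : ∀ n : ℕ, P (j0 + Fin.ofNat t n) := by
    intro n
    induction n with
    | zero => simpa using h0
    | succ n ih =>
      have := h _ ih
      convert this using 1
      rw [add_assoc]
      congr 1
      ext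
      simp [Fin.val_add]
  have := key (j - j0).val
  simpa using this

lemma cyc_dn {P : Fin t → Prop} (h : ∀ j, P (j + 1) → P j) {j0 : Fin t} (h0 : P j0) (j : Fin t) : P j := by
  by_contra hj
  exact cyc_up (P := fun j => ¬ P j) (fun j hj h1 => hj (h j h1)) hj j0 h0

lemma sum_shift {M : Type*} [AddCommMonoid M] (f : Fin t → M) : ∑ j, f (j + 1) = ∑ j, f j :=
  Equiv.sum_comp (Equiv.addRight (1 : Fin t)) f

lemma sum_lam (s : Fin t → ℤ) :
    ∑ j, lamOf p t d s j = ((p : ℤ) - 1) * ∑ j, s j + ∑ j : Fin t, (digitp p d j : ℤ) := by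
  simp only [lamOf, Finset.sum_add_distrib, Finset.sum_sub_distrib, ← Finset.mul_sum]
  rw [sum_shift]; ring

lemma digit_sum (p d n : ℕ) : d % p ^ n = ∑ j ∈ Finset.range n, p ^ j * digitp p d j := by
  induction n with
  | zero => simp [Nat.mod_one]
  | succ n ih => rw [Nat.mod_pow_succ, ih, Finset.sum_range_succ]; rfl

lemma digit_sum' (hp : 2 ≤ p) (hd : d ≤ p ^ t - 2) : d = ∑ j : Fin t, p ^ (j : ℕ) * digitp p d j := by
  have : 0 < p ^ t := by positivity
  rw [Fin.sum_univ_eq_sum_range (fun j => p ^ j * digitp p d j), ← digit_sum, Nat.mod_eq_of_lt]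
  omega

lemma digit_le (hp : 2 ≤ p) (j : ℕ) : digitp p d j ≤ p - 1 := by
  have := Nat.mod_lt (d / p ^ j) (show 0 < p by omega)
  rw [digitp]; omega

lemma not_all_zero (hp : 2 ≤ p) (hd : d ≤ p ^ t - 2) (h0 : d ≠ 0) :
    ¬ ∀ j : Fin t, digitp p d j = 0 := by
  intro h
  have := digit_sum' hp hd
  simp only [h] at this
  simp at this
  exact h0 this

lemma not_all_top (hp : 2 ≤ p) (ht : 1 < t) (hd : d ≤ p ^ t - 2) :
    ¬ ∀ j : Fin t, digitp p d j = p - 1 := by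
  intro h
  have := digit_sum' hp hd
  simp only [h] at this
  rw [← Finset.sum_mul, Fin.sum_univ_eq_sum_range (fun j => p ^ j)] at this
  have hg : (∑ j ∈ Finset.range t, p ^ j) * (p - 1) = p ^ t - 1 := by
    rw [mul_comm]
    have h5 : ((p : ℤ) - 1) * ∑ i ∈ Finset.range t, (p : ℤ) ^ i = (p : ℤ) ^ t - 1 := mul_geom_sum _ _
    have h6 : 1 ≤ p ^ t := Nat.one_le_pow _ _ (by omega)
    zify [h6, show 1 ≤ p by omega]
    exact h5
  rw [hg] at this
  have h6 : p ^ 1 < p ^ t := Nat.pow_lt_pow_right (by omega) ht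
  have h7 : 2 ≤ p ^ t := by rw [pow_one] at h6; omega
  generalize p ^ t = q at *
  omega

lemma succ_ne (ht : 1 < t) (j : Fin t) : j + 1 ≠ j := by
  intro h
  have h1 : (1 : Fin t) = 0 := by simpa using h
  have := congrArg Fin.val h1
  simp [Fin.val_one', Nat.mod_eq_of_lt ht] at this

/-- raise one coordinate -/
def bump (s : Fin t → ℤ) (j : Fin t) (a : ℤ) : Fin t → ℤ := Function.update s j (s j + a)

lemma bump_same (s : Fin t → ℤ) (j : Fin t) (a : ℤ) : bump s j a j = s j + a := by simp [bump]
lemma bump_ne (s : Fin t → ℤ) {j i : Fin t} (h : i ≠ j) (a : ℤ) : bump s j a i = s i := by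
  simp [bump, h]
lemma bump_sum (s : Fin t → ℤ) (j : Fin t) (a : ℤ) : ∑ i, bump s j a i = ∑ i, s i + a := by
  rw [bump, Finset.sum_update_of_mem (Finset.mem_univ _), ← Finset.add_sum_erase _ _ (Finset.mem_univ j),
    Finset.sdiff_singleton_eq_erase]
  ring

lemma lam_bump_same (ht : 1 < t) (s : Fin t → ℤ) (j : Fin t) (a : ℤ) :
    lamOf p t d (bump s (j + 1) a) j = lamOf p t d s j + p * a := by
  rw [lamOf, lamOf, bump_same, bump_ne s (succ_ne ht j).symm]; ring

lemma lam_bump_succ (ht : 1 < t) (s : Fin t → ℤ) (j : Fin t) (a : ℤ) :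
    lamOf p t d (bump s j a) j = lamOf p t d s j - a := by
  rw [lamOf, lamOf, bump_same, bump_ne s (succ_ne ht j)]; ring

lemma lam_bump_ne (s : Fin t → ℤ) {i j : Fin t} (h1 : i ≠ j) (h2 : i ≠ j + 1) (a : ℤ) :
    lamOf p t d (bump s (j + 1) a) i = lamOf p t d s i := by
  rw [lamOf, lamOf, bump_ne s h2, bump_ne s (fun h => h1 (add_right_cancel h))]

lemma up_cover (hp : 3 ≤ p) (ht : 1 < t) (hm : 2 ≤ m) (hd : d ≤ p ^ t - 2) {s' s : Fin t → ℤ}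
    (hs' : Hc p t m d s') (hs : Hc p t m d s) (hle : ∀ j, s' j ≤ s j) (hne : s' ≠ s) :
    ∃ j, Hc p t m d (bump s' (j + 1) 1) ∧ s' (j + 1) < s (j + 1) := by
  have hpm : (4 : ℤ) * ((p : ℤ) - 1) ≤ 2 * m * ((p : ℤ) - 1) := by
    have : (2 : ℤ) ≤ m := by exact_mod_cast hm
    have : (3 : ℤ) ≤ p := by exact_mod_cast hp
    nlinarith
  have hp3 : (3 : ℤ) ≤ p := by exact_mod_cast hp
  obtain ⟨j0, hj0⟩ : ∃ j, s' j < s j := by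
    by_contra h
    push Not at h
    exact hne (funext fun j => le_antisymm (hle j) (h j))
  by_contra hcon
  push Not at hcon
  -- blocking dichotomy
  have dich : ∀ j, s' (j + 1) < s (j + 1) →
      lamOf p t d s' (j + 1) = 0 ∨ 2 * m * ((p : ℤ) - 1) < lamOf p t d s' j + p := by
    intro j hj
    by_contra h
    push Not at h
    refine absurd hj (not_lt.mpr (hcon j ⟨?_, ?_⟩))
    · intro i
      by_cases hi : i = j + 1
      · subst hi
        rw [bump_same]
        have := hs'.1 (j + 1); have := hs.1 (j + 1)
        constructor <;> omega
      · rw [bump_ne _ hi]; exact hs'.1 i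
    · intro i
      by_cases hi : i = j + 1
      · subst hi
        rw [lam_bump_succ ht]
        have := hs'.2 (j + 1); have := h.1
        constructor <;> omega
      · by_cases hi2 : i = j
        · subst hi2
          rw [lam_bump_same ht]
          have := hs'.2 i; have := h.2
          constructor <;> linarith
        · rw [lam_bump_ne _ hi2 hi]; exact hs'.2 i
  have pre : ∀ j : Fin t, ∃ i, j = i + 1 := fun j => ⟨j - 1, by simp⟩
  by_cases hlow : ∃ j, s' j < s j ∧ lamOf p t d s' j = 0
  · obtain ⟨j1, hj1⟩ := hlow
    have all : ∀ j, s' j < s j ∧ lamOf p t d s' j = 0 := by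
      refine cyc_up (P := fun j => s' j < s j ∧ lamOf p t d s' j = 0) ?_ hj1
      rintro j ⟨h1, h2⟩
      have h3 := (hs.2 j).1
      have h4 : s' (j + 1) < s (j + 1) := by
        rw [lamOf] at h2 h3
        by_contra hh
        have := hle (j + 1)
        have : s' (j + 1) = s (j + 1) := by omega
        rw [this] at h2
        omega
      refine ⟨h4, (dich j h4).resolve_right ?_⟩
      rw [h2]; linarith
    have hsum := sum_lam (p := p) (d := d) s'
    rw [Finset.sum_eq_zero (fun j _ => (all j).2)] at hsum
    have hd0 : 0 ≤ ∑ j : Fin t, (digitp p d j : ℤ) := Finset.sum_nonneg fun _ _ => by positivity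
    have hs0 : 0 ≤ ∑ j, s' j := Finset.sum_nonneg fun j _ => (lo_nonneg d).trans (hs'.1 j).1
    have e2 : ∑ j, s' j = 0 := by nlinarith
    have e1 : ∑ j : Fin t, (digitp p d j : ℤ) = 0 := by rw [e2] at hsum; linarith
    by_cases h0 : d = 0
    · have : ∑ j : Fin t, (1 : ℤ) ≤ ∑ j, s' j := Finset.sum_le_sum fun j _ => by
        have := (hs'.1 j).1
        rwa [lo, if_pos h0] at this
      rw [e2] at this
      simp at this
      omega
    · refine not_all_zero (t := t) (by omega) hd h0 fun j => ?_
      rw [Finset.sum_eq_zero_iff_of_nonneg (fun _ _ => by positivity)] at e1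
      exact_mod_cast e1 j (Finset.mem_univ _)
  · push Not at hlow
    have all : ∀ j, s' j < s j := by
      refine cyc_dn (P := fun j => s' j < s j) ?_ hj0
      intro j h1
      have h2 := (dich j h1).resolve_left (hlow _ h1)
      have h3 := (hs.2 j).2
      rw [lamOf] at h2 h3
      nlinarith
    have big : ∀ j, 2 * m * ((p : ℤ) - 1) - p + 1 ≤ lamOf p t d s' j := by
      intro j
      have := (dich j (all _)).resolve_left (hlow _ (all _))
      linarith
    have le1 : ∀ j, (p - 1) * s' j ≤ (p - 1) * ((2 : ℤ) * m - 2) := by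
      intro j
      have := all j; have := (hs.1 j).2
      apply mul_le_mul_of_nonneg_left <;> linarith
    have le2 : ∀ j : Fin t, (digitp p d j : ℤ) ≤ p - 1 := by
      intro j
      have := digit_le (d := d) (show 2 ≤ p by omega) j
      omega
    refine not_all_top (t := t) (by omega) ht hd fun j => ?_
    have hsum := sum_lam (p := p) (d := d) s'
    by_contra hj
    have hlt : ∑ j : Fin t, (digitp p d j : ℤ) < ∑ j : Fin t, ((p : ℤ) - 1) := by
      refine Finset.sum_lt_sum (fun j _ => le2 j) ⟨j, Finset.mem_univ _, ?_⟩
      have := le2 j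
      omega
    have s1 := Finset.sum_le_sum (fun j (_ : j ∈ Finset.univ) => big j)
    have s2 := Finset.sum_le_sum (fun j (_ : j ∈ Finset.univ) => le1 j)
    rw [← Finset.mul_sum] at s2
    have s3 : ∑ j : Fin t, (2 * m * ((p : ℤ) - 1) - p + 1) =
      ∑ j : Fin t, (p - 1) * ((2 : ℤ) * m - 2) + ∑ j : Fin t, ((p : ℤ) - 1) := by
      rw [← Finset.sum_add_distrib]
      refine Finset.sum_congr rfl fun _ _ => by ring
    linarith

lemma leSd_trans {s1 s2 s3 : Fin t → ℤ} {e1 e2 e3 : Finset (Fin t)}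
    (h1 : leSd p t m d s1 e1 s2 e2) (h2 : leSd p t m d s2 e2 s3 e3) : leSd p t m d s1 e1 s3 e3 := by
  refine ⟨fun j => (h1.1 j).trans (h2.1 j), ?_⟩
  ext j
  simp only [Finset.mem_inter]
  refine and_congr_left fun hj => ?_
  rw [Zset, Finset.mem_filter] at hj
  obtain ⟨_, a, b, c⟩ := hj
  have a1 := h1.1 j; have a2 := h2.1 j
  have b1 := h1.1 (j + 1); have b2 := h2.1 (j + 1)
  have z1 : j ∈ Zset p t m d s1 s2 := by
    rw [Zset, Finset.mem_filter]; exact ⟨Finset.mem_univ _, by omega, by omega, c⟩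
  have z2 : j ∈ Zset p t m d s2 s3 := by
    rw [Zset, Finset.mem_filter]
    refine ⟨Finset.mem_univ _, by omega, by omega, ?_⟩
    rw [lamOf] at c ⊢
    rw [← c, show s2 j = s1 j by omega, show s2 (j + 1) = s1 (j + 1) by omega]
  have q1 := Finset.ext_iff.mp h1.2 j
  have q2 := Finset.ext_iff.mp h2.2 j
  simp only [Finset.mem_inter, z1, z2, and_true] at q1 q2
  rw [q2, q1]

lemma leSd_refl (s : Fin t → ℤ) (e : Finset (Fin t)) : leSd p t m d s e s e := ⟨fun _ => le_rfl, rfl⟩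

lemma interm (hp : 3 ≤ p) (ht : 1 < t) (hm : 2 ≤ m) (hd : d ≤ p ^ t - 2) {s : Fin t → ℤ}
    {e : Finset (Fin t)} (hs : memCase p t m d s e) (n : ℕ) :
    ∀ (s' : Fin t → ℤ) (e' : Finset (Fin t)) (_ : memCase p t m d s' e')
    (_ : leSd p t m d s' e' s e) (_ : (∑ j, s' j) + n ≤ ∑ j, s j),
    ∃ s'' e'', memCase p t m d s'' e'' ∧ leSd p t m d s' e' s'' e'' ∧ leSd p t m d s'' e'' s e ∧
      ∑ j, s'' j = (∑ j, s' j) + n := by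
  induction n with
  | zero =>
    intro s' e' h' hle _
    exact ⟨s', e', h', leSd_refl _ _, hle, by simp⟩
  | succ n ih =>
    intro s' e' h' hle hn
    rw [memCase_iff] at hs
    have h'' := (memCase_iff _ _).mp h'
    have hne : s' ≠ s := by rintro rfl; push_cast at hn; omega
    obtain ⟨j, hb, hj⟩ := up_cover hp ht hm hd h''.1 hs.1 hle.1 hne
    set s1 := bump s' (j + 1) 1 with hs1
    have l1 : ∀ i, s' i ≤ s1 i := by
      intro i
      by_cases hi : i = j + 1
      · rw [hi, hs1, bump_same]; omega
      · rw [hs1, bump_ne _ hi]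
    have l2 : ∀ i, s1 i ≤ s i := by
      intro i
      by_cases hi : i = j + 1
      · rw [hi, hs1, bump_same]; omega
      · rw [hs1, bump_ne _ hi]; exact hle.1 i
    have both : ∀ i, i ∈ Zset p t m d s1 s → i ∈ Zset p t m d s' s1 → (i ∈ e ↔ i ∈ e') := by
      intro i h1 h2
      rw [Zset, Finset.mem_filter] at h1 h2
      have q := Finset.ext_iff.mp hle.2 i
      have z : i ∈ Zset p t m d s' s := by
        rw [Zset, Finset.mem_filter]
        exact ⟨Finset.mem_univ _, h2.2.1.trans h1.2.1, h2.2.2.1.trans h1.2.2.1, h2.2.2.2⟩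
      simpa [z] using q
    set e1 := (e ∩ Zset p t m d s1 s) ∪ (e' ∩ Zset p t m d s' s1) with he1
    have c1 : memCase p t m d s1 e1 := by
      rw [memCase_iff]
      refine ⟨hb, ?_⟩
      intro i hi
      rw [Jset, Finset.mem_filter]
      refine ⟨Finset.mem_univ _, ?_⟩
      rw [he1, Finset.mem_union, Finset.mem_inter, Finset.mem_inter, Zset, Zset, Finset.mem_filter,
        Finset.mem_filter] at hi
      rcases hi with hi | hi
      · exact hi.2.2.2.2
      · have := hi.2.2.2.2
        rw [lamOf] at this ⊢
        rw [← this, hi.2.2.1, hi.2.2.2.1]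
    have c2 : leSd p t m d s' e' s1 e1 := by
      refine ⟨l1, ?_⟩
      ext i
      have := both i
      simp only [he1, Finset.mem_inter, Finset.mem_union]
      tauto
    have c3 : leSd p t m d s1 e1 s e := by
      refine ⟨l2, ?_⟩
      ext i
      have := both i
      simp only [he1, Finset.mem_inter, Finset.mem_union]
      tauto
    obtain ⟨s2, e2, k1, k2, k3, k4⟩ := ih s1 e1 c1 c3 (by rw [hs1, bump_sum]; push_cast at hn; omega)
    refine ⟨s2, e2, k1, leSd_trans c2 k2, k3, ?_⟩
    rw [k4, hs1, bump_sum]; push_cast; ring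

end comb

end RS

namespace RS

section layers
open MvPolynomial

/-- standing hypotheses -/
structure Hy (K : Type) [Field K] [Fintype K] (p t m d : ℕ) : Prop where
  hp3 : 3 ≤ p
  ht : 1 < t
  hm : 2 ≤ m
  hd : d ≤ p ^ t - 2
  hcard : Fintype.card K = p ^ t

variable {K : Type} [Field K] {p t m d : ℕ}

/-- twisted product of digits -/
def fn (p : ℕ) (h : Fin t → PP K m) : VV K m → K := fun v => ∏ j, (ev (h j) v) ^ (p ^ (j : ℕ))

lemma fn_update (h : Fin t → PP K m) (j : Fin t) (a : PP K m) (v : VV K m) :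
    fn p (Function.update h j a) v = (ev a v) ^ (p ^ (j : ℕ)) * ∏ i ∈ Finset.univ.erase j, (ev (h i) v) ^ (p ^ (i : ℕ)) := by
  rw [fn, ← Finset.mul_prod_erase _ _ (Finset.mem_univ j), Function.update_self]
  congr 1
  refine Finset.prod_congr rfl fun i hi => ?_
  rw [Function.update_of_ne (Finset.ne_of_mem_erase hi)]

lemma ev_add (a b : PP K m) (v : VV K m) : ev (a + b) v = ev a v + ev b v := by simp [ev]
lemma ev_mul (a b : PP K m) (v : VV K m) : ev (a * b) v = ev a v * ev b v := by simp [ev]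
lemma ev_smul (c : K) (b : PP K m) (v : VV K m) : ev (c • b) v = c * ev b v := by simp [ev, smul_eval]
lemma ev_zero (v : VV K m) : ev (0 : PP K m) v = 0 := by simp [ev]
lemma ev_pow (a : PP K m) (n : ℕ) (v : VV K m) : ev (a ^ n) v = ev a v ^ n := by simp [ev]
lemma ev_C (c : K) (v : VV K m) : ev (C c : PP K m) v = c := by simp [ev]

lemma fn_smul [hp : Fact p.Prime] (h : Fin t → PP K m) (j : Fin t) (c : K) (a : PP K m) :
    fn p (Function.update h j (c • a)) = c ^ (p ^ (j : ℕ)) • fn p (Function.update h j a) := by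
  funext v
  rw [Pi.smul_apply, fn_update, fn_update, ev_smul, mul_pow, smul_eq_mul, mul_assoc]

lemma fn_zero [hp : Fact p.Prime] (h : Fin t → PP K m) (j : Fin t) :
    fn p (Function.update h j 0) = 0 := by
  have := fn_smul (p := p) h j 0 0
  have h0 := hp.out.pos
  rwa [zero_smul, zero_pow (by positivity), zero_smul] at this

lemma fn_add [hp : Fact p.Prime] [CharP K p] (h : Fin t → PP K m) (j : Fin t) (a b : PP K m) :
    fn p (Function.update h j (a + b)) = fn p (Function.update h j a) + fn p (Function.update h j b) := by
  haveI : ExpChar K p := ExpChar.prime hp.out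
  funext v
  rw [Pi.add_apply, fn_update, fn_update, fn_update, ev_add, add_pow_expChar_pow, add_mul]

lemma fn_sub [hp : Fact p.Prime] [CharP K p] (h : Fin t → PP K m) (j : Fin t) (a b : PP K m) :
    fn p (Function.update h j (a - b)) = fn p (Function.update h j a) - fn p (Function.update h j b) := by
  have := fn_add (p := p) h j (a - b) b
  rw [sub_add_cancel] at this
  rw [this, add_sub_cancel_right]

lemma fn_neg [hp : Fact p.Prime] [CharP K p] (h : Fin t → PP K m) (j : Fin t) (a : PP K m) :
    fn p (Function.update h j (-a)) = - fn p (Function.update h j a) := by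
  have := fn_sub (p := p) h j 0 a
  rw [zero_sub] at this
  rw [this, fn_zero, zero_sub]

/-- the digits placing `fn` into a submodule -/
def slot [hp : Fact p.Prime] [CharP K p] (M : Submodule K (VV K m → K)) (h : Fin t → PP K m) (j : Fin t) : Submodule K (PP K m) where
  carrier := {a | fn p (Function.update h j a) ∈ M}
  add_mem' {a b} ha hb := by
    simp only [Set.mem_setOf_eq] at *
    rw [fn_add]; exact M.add_mem ha hb
  zero_mem' := by simp only [Set.mem_setOf_eq]; rw [fn_zero]; exact M.zero_mem
  smul_mem' c a ha := by
    simp only [Set.mem_setOf_eq] at *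
    rw [fn_smul]; exact M.smul_mem _ ha

lemma mem_slot [hp : Fact p.Prime] [CharP K p] {M : Submodule K (VV K m → K)} {h : Fin t → PP K m} {j : Fin t} {a : PP K m} :
    a ∈ slot (p := p) M h j ↔ fn p (Function.update h j a) ∈ M := Iff.rfl

/-- digit-wise span induction -/
lemma fn_span [hp : Fact p.Prime] [CharP K p] {M : Submodule K (VV K m → K)} (X : Fin t → Set (PP K m))
    (hX : ∀ h : Fin t → PP K m, (∀ j, h j ∈ X j) → fn p h ∈ M) (h : Fin t → PP K m)
    (hh : ∀ j, h j ∈ Submodule.span K (X j)) : fn p h ∈ M := by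
  have key : ∀ S : Finset (Fin t), ∀ h : Fin t → PP K m, (∀ j ∈ S, h j ∈ Submodule.span K (X j)) →
      (∀ j ∉ S, h j ∈ X j) → fn p h ∈ M := by
    intro S
    induction S using Finset.induction_on with
    | empty => intro h _ h2; exact hX h fun j => h2 j (Finset.notMem_empty _)
    | insert b S hb ih =>
      intro h h1 h2
      have : Submodule.span K (X b) ≤ slot (p := p) M h b := by
        rw [Submodule.span_le]
        intro a ha
        rw [SetLike.mem_coe, mem_slot]
        refine ih _ ?_ ?_
        · intro j hj
          have : j ≠ b := by rintro rfl; exact hb hj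
          rw [Function.update_of_ne this]
          exact h1 j (Finset.mem_insert_of_mem hj)
        · intro j hj
          by_cases hjb : j = b
          · subst hjb; rwa [Function.update_self]
          · rw [Function.update_of_ne hjb]
            exact h2 j (by simp [hj, hjb])
      have := this (h1 b (Finset.mem_insert_self _ _))
      rwa [mem_slot, Function.update_eq_self] at this
  exact key Finset.univ h (fun j _ => hh j) (fun j hj => absurd (Finset.mem_univ j) hj)

variable [NeZero t]

/-- modes -/
def mode (K : Type) [Field K] (p m d : ℕ) (s : Fin t → ℤ) (eps : Finset (Fin t)) (s' : Fin t → ℤ) (j : Fin t) : K :=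
  if j ∈ Zset p t m d s' s then (if j ∈ eps then 1 else -1) else 0

/-- admissible types -/
structure Adm (p d : ℕ) (s s' : Fin t → ℤ) : Prop where
  le : ∀ j, s' j ≤ s j
  lo : ∀ j, lo d ≤ s' j
  lam : ∀ j, 0 ≤ lamOf p t d s' j

/-- generators of the layers -/
def Gen (p d : ℕ) (s : Fin t → ℤ) (eps : Finset (Fin t)) (s' : Fin t → ℤ) (h : Fin t → PP K m) : Prop :=
  Adm p d s s' ∧ ∀ j, h j ∈ DD m p (mode K p m d s eps s' j) (lamOfN p t d s' j)

/-- the layers -/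
def WW (K : Type) [Field K] (p m d : ℕ) (s : Fin t → ℤ) (eps : Finset (Fin t)) (n : ℤ) : Submodule K (VV K m → K) :=
  Submodule.span K {f | ∃ s' h, Gen p d s eps s' h ∧ ∑ j, s' j ≤ n ∧ f = fn p h}

lemma WW_mono (s : Fin t → ℤ) (eps : Finset (Fin t)) {n n' : ℤ} (h : n ≤ n') :
    WW K p m d s eps n ≤ WW K p m d s eps n' := by
  apply Submodule.span_mono
  rintro f ⟨s', h', h1, h2, h3⟩
  exact ⟨s', h', h1, h2.trans h, h3⟩

lemma fn_mem_WW {s : Fin t → ℤ} {eps : Finset (Fin t)} {s' : Fin t → ℤ} {h : Fin t → PP K m}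
    (hg : Gen p d s eps s' h) {n : ℤ} (hn : ∑ j, s' j ≤ n) : fn p h ∈ WW K p m d s eps n :=
  Submodule.subset_span ⟨s', h, hg, hn, rfl⟩

lemma WW_neg (s : Fin t → ℤ) (eps : Finset (Fin t)) {n : ℤ} (h : n < 0) : WW K p m d s eps n = ⊥ := by
  rw [WW, Submodule.span_eq_bot]
  rintro f ⟨s', h', h1, h2, h3⟩
  exfalso
  have : 0 ≤ ∑ j, s' j := Finset.sum_nonneg fun j _ => (lo_nonneg d).trans (h1.1.lo j)
  omega

lemma mode_of_ne (s : Fin t → ℤ) (eps : Finset (Fin t)) (s' : Fin t → ℤ) (j : Fin t)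
    (h : s' j ≠ s j ∨ s' (j + 1) ≠ s (j + 1)) : mode K p m d s eps s' j = 0 := by
  rw [mode, if_neg]
  rw [Zset, Finset.mem_filter]
  tauto

lemma mode_congr (s : Fin t → ℤ) (eps : Finset (Fin t)) {s' s'' : Fin t → ℤ} {j : Fin t}
    (h1 : s' j = s'' j) (h2 : s' (j + 1) = s'' (j + 1)) :
    mode K p m d s eps s' j = mode K p m d s eps s'' j := by
  have : j ∈ Zset p t m d s' s ↔ j ∈ Zset p t m d s'' s := by
    rw [Zset, Zset, Finset.mem_filter, Finset.mem_filter, lamOf, lamOf, h1, h2]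
  simp only [mode, this]

lemma mode_hk (s : Fin t → ℤ) (eps : Finset (Fin t)) {s' : Fin t → ℤ} (j : Fin t) (h0 : 0 ≤ lamOf p t d s' j) :
    mode K p m d s eps s' j = 0 ∨ (lamOfN p t d s' j : ℤ) - m * ((p : ℤ) - 1) = 0 := by
  by_cases h : j ∈ Zset p t m d s' s
  · right
    rw [Zset, Finset.mem_filter] at h
    rw [lamOfN, Int.toNat_of_nonneg h0, h.2.2.2, sub_self]
  · left; rw [mode, if_neg h]

/-- carrying -/
lemma fn_carry [hp : Fact p.Prime] [Fintype K] (hy : Hy K p t m d)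
    (h : Fin t → PP K m) (j : Fin t) (z : ZZ m) (g : PP K m) :
    fn p (Function.update h j (X z ^ p * g)) =
      fn p (Function.update (Function.update h j g) (j + 1) (X z * h (j + 1))) := by
  funext v
  have hne := succ_ne hy.ht j
  rw [fn_update, fn_update]
  have hmem : j ∈ Finset.univ.erase (j + 1) := Finset.mem_erase.mpr ⟨hne.symm, Finset.mem_univ _⟩
  have hmem' : j + 1 ∈ Finset.univ.erase j := Finset.mem_erase.mpr ⟨hne, Finset.mem_univ _⟩
  rw [← Finset.mul_prod_erase _ _ hmem, ← Finset.mul_prod_erase _ _ hmem', Function.update_self,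
    Finset.erase_right_comm]
  have hrest : ∏ i ∈ (Finset.univ.erase (j + 1)).erase j, ev (Function.update h j g i) v ^ p ^ (i : ℕ) =
      ∏ i ∈ (Finset.univ.erase (j + 1)).erase j, ev (h i) v ^ p ^ (i : ℕ) := by
    refine Finset.prod_congr rfl fun i hi => ?_
    rw [Function.update_of_ne (Finset.ne_of_mem_erase hi)]
  rw [hrest, ev_mul, ev_mul, ev_pow, mul_pow, mul_pow, ← pow_mul, ← pow_succ']
  have hkey : (ev (X z : PP K m) v) ^ p ^ ((j : ℕ) + 1) = (ev (X z) v) ^ p ^ ((j + 1 : Fin t) : ℕ) := by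
    by_cases hj : (j : ℕ) + 1 < t
    · congr 2
      rw [Fin.val_add, Fin.val_one', Nat.mod_eq_of_lt hy.ht, Nat.mod_eq_of_lt hj]
    · have h1 : (j : ℕ) + 1 = t := by have := j.2; omega
      have h2 : ((j + 1 : Fin t) : ℕ) = 0 := by
        rw [Fin.val_add, Fin.val_one', Nat.mod_eq_of_lt hy.ht, h1, Nat.mod_self]
      rw [h1, h2, pow_zero, pow_one, ← hy.hcard, FiniteField.pow_card]
  rw [hkey]
  ring

variable {s : Fin t → ℤ} {eps : Finset (Fin t)}

lemma Adm_carry [hp : Fact p.Prime] [Fintype K] (hy : Hy K p t m d) {s' : Fin t → ℤ} (ha : Adm p d s s') (j : Fin t)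
    (hl : (p : ℤ) ≤ lamOf p t d s' j) : Adm p d s (bump s' (j + 1) (-1)) := by
  refine ⟨?_, ?_, ?_⟩
  · intro i
    by_cases hi : i = j + 1
    · subst hi; rw [bump_same]; have := ha.le (j + 1); omega
    · rw [bump_ne _ hi]; exact ha.le i
  · intro i
    by_cases hi : i = j + 1
    · subst hi; rw [bump_same]
      have h1 := ha.lo j
      have hp3 : (3 : ℤ) ≤ p := by exact_mod_cast hy.hp3
      rw [lamOf] at hl
      have h2 := digit_le (d := d) (show 2 ≤ p by have := hy.hp3; omega) j
      have h3 : (digitp p d j : ℤ) ≤ p - 1 := by have := hy.hp3; omega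
      by_cases hd : d = 0
      · rw [RS.lo, if_pos hd] at h1 ⊢
        have : digitp p d j = 0 := by rw [hd, digitp]; simp
        rw [this] at hl
        push_cast at hl
        by_contra hcon
        have : s' (j + 1) ≤ 1 := by omega
        nlinarith
      · rw [RS.lo, if_neg hd] at h1 ⊢
        by_contra hcon
        have : s' (j + 1) ≤ 0 := by omega
        nlinarith
    · rw [bump_ne _ hi]; exact ha.lo i
  · intro i
    by_cases hi : i = j + 1
    · subst hi; rw [lam_bump_succ hy.ht]; have := ha.lam (j + 1); omega
    · by_cases hi2 : i = j
      · subst hi2; rw [lam_bump_same hy.ht]; linarith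
      · rw [lam_bump_ne _ hi2 hi]; exact ha.lam i

/-- Elements with a digit in the ideal drop a level. -/
lemma carry [hp : Fact p.Prime] [CharP K p] [Fintype K] (hy : Hy K p t m d) {s' : Fin t → ℤ} {h : Fin t → PP K m}
    (hg : Gen p d s eps s' h) (j : Fin t) {a : PP K m} (ha : a.IsHomogeneous (lamOfN p t d s' j)) (haI : a ∈ II K m p) :
    fn p (Function.update h j a) ∈ WW K p m d s eps (∑ i, s' i - 1) := by
  suffices hs : a ∈ slot (p := p) (WW K p m d s eps (∑ i, s' i - 1)) h j from hs
  rw [← support_sum_monomial_coeff a]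
  refine Submodule.sum_mem _ fun e he => ?_
  obtain ⟨z, hz⟩ := mem_II.mp haI e he
  have hdeg : e.degree = lamOfN p t d s' j := by
    have := ha (mem_support_iff.mp he)
    rw [← this, Finsupp.degree_eq_weight_one]; rfl
  have hle : Finsupp.single z p ≤ e := by simpa using hz
  have hsplit : monomial e (coeff e a) = X z ^ p * monomial (e - Finsupp.single z p) (coeff e a) := by
    rw [X_pow_eq_monomial, monomial_mul, one_mul, add_tsub_cancel_of_le hle]
  have hdz : (e - Finsupp.single z p).degree + p = lamOfN p t d s' j := by
    rw [← hdeg]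
    conv_rhs => rw [← tsub_add_cancel_of_le hle]
    rw [map_add, Finsupp.degree_single]
  have h0 := hg.1.lam j
  have hcast : (lamOfN p t d s' j : ℤ) = lamOf p t d s' j := Int.toNat_of_nonneg h0
  have hpl : (p : ℤ) ≤ lamOf p t d s' j := by rw [← hcast, ← hdz]; push_cast; linarith
  rw [hsplit, mem_slot, fn_carry hy]
  have hadm := Adm_carry hy hg.1 j hpl
  refine fn_mem_WW (s' := bump s' (j + 1) (-1)) ⟨hadm, ?_⟩ (by rw [bump_sum]; omega)
  have hlt : ∀ (i : Fin t), i = j + 1 → bump s' (j + 1) (-1) i ≠ s i := by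
    rintro i rfl
    rw [bump_same]; have := hg.1.le (j + 1); omega
  intro i
  by_cases hi : i = j + 1
  · subst hi
    rw [Function.update_self, mode_of_ne _ _ _ _ (Or.inl (hlt _ rfl))]
    apply DD_zero
    have := (isHomogeneous_X K z).mul (DD_hom (hg.2 (j + 1)))
    convert this using 1
    rw [lamOfN, lam_bump_succ hy.ht, lamOfN]
    have := hg.1.lam (j + 1)
    omega
  · rw [Function.update_of_ne hi]
    by_cases hi2 : i = j
    · subst hi2
      rw [Function.update_self, mode_of_ne _ _ _ _ (Or.inr (hlt _ rfl))]
      apply DD_zero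
      apply isHomogeneous_monomial
      rw [lamOfN, lam_bump_same hy.ht]
      omega
    · rw [Function.update_of_ne hi2, mode_congr s eps (bump_ne _ hi _)
        (bump_ne _ (fun hh => hi2 (add_right_cancel hh)) _), lamOfN, lam_bump_ne _ hi2 hi]
      exact hg.2 i

lemma Gen.update {s' : Fin t → ℤ} {h : Fin t → PP K m} [hp : Fact p.Prime] [CharP K p]
    (hg : Gen p d s eps s' h) {j : Fin t} {a : PP K m}
    (ha : a ∈ DD m p (mode K p m d s eps s' j) (lamOfN p t d s' j)) : Gen p d s eps s' (Function.update h j a) := by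
  refine ⟨hg.1, fun i => ?_⟩
  by_cases hi : i = j
  · subst hi; rwa [Function.update_self]
  · rw [Function.update_of_ne hi]; exact hg.2 i

lemma fn_congr [hp : Fact p.Prime] [CharP K p] [Fintype K] (hy : Hy K p t m d) {s' : Fin t → ℤ} {h h' : Fin t → PP K m}
    (hg : Gen p d s eps s' h) (hg' : Gen p d s eps s' h') (hI : ∀ j, h j - h' j ∈ II K m p) :
    fn p h - fn p h' ∈ WW K p m d s eps (∑ i, s' i - 1) := by
  have key : ∀ S : Finset (Fin t), ∀ h : Fin t → PP K m, Gen p d s eps s' h → (∀ j, h j - h' j ∈ II K m p) →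
      (∀ j ∉ S, h j = h' j) → fn p h - fn p h' ∈ WW K p m d s eps (∑ i, s' i - 1) := by
    intro S
    induction S using Finset.induction_on with
    | empty =>
      intro h _ _ h2
      have : h = h' := funext fun j => h2 j (Finset.notMem_empty _)
      rw [this, sub_self]; exact Submodule.zero_mem _
    | insert b S hb ih =>
      intro h h1 h2 h3
      have e1 := ih (Function.update h b (h' b)) (h1.update (hg'.2 b)) (by
        intro j
        by_cases hj : j = b
        · subst hj; simp
        · rw [Function.update_of_ne hj]; exact h2 j) (by
        intro j hj
        by_cases hjb : j = b
        · subst hjb; simp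
        · rw [Function.update_of_ne hjb]; exact h3 j (by simp [hj, hjb]))
      have e2 := carry hy h1 b (a := h b - h' b) ((DD_hom (h1.2 b)).sub (DD_hom (hg'.2 b))) (h2 b)
      rw [fn_sub, Function.update_eq_self] at e2
      have := Submodule.add_mem _ e2 e1
      rwa [sub_add_sub_cancel] at this
  exact key Finset.univ h hg hI (fun j hj => absurd (Finset.mem_univ j) hj)

/-- stability -/
def Stab (M : Submodule K (VV K m → K)) : Prop := ∀ u c, ∀ f ∈ M, (fun v => f (tv u c v)) ∈ M

lemma fn_tv (h : Fin t → PP K m) (u : VV K m) (c : K) :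
    (fun v => fn p h (tv u c v)) = fn p (fun j => th u c (h j)) := by
  funext v
  simp only [fn, ev_th]

lemma Gen.th [hp : Fact p.Prime] [CharP K p] {s' : Fin t → ℤ} {h : Fin t → PP K m} (hg : Gen p d s eps s' h) (u : VV K m) (c : K) :
    Gen p d s eps s' (fun j => th u c (h j)) := ⟨hg.1, fun j => DD_th u c (hg.2 j)⟩

lemma stab_span {X : Set (VV K m → K)} (h : ∀ f ∈ X, ∀ u c, (fun v => f (tv u c v)) ∈ Submodule.span K X) :
    Stab (Submodule.span K X) := by
  intro u c f hf
  refine Submodule.span_induction (p := fun f _ => (fun v => f (tv u c v)) ∈ Submodule.span K X) ?_ ?_ ?_ ?_ hf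
  · intro x hx; exact h x hx u c
  · exact Submodule.zero_mem _
  · intro x y _ _ hx hy; exact Submodule.add_mem _ hx hy
  · intro a x _ hx; exact Submodule.smul_mem _ a hx

lemma WW_stab [hp : Fact p.Prime] [CharP K p] (n : ℤ) : Stab (WW K p m d s eps n) := by
  apply stab_span
  rintro f ⟨s', h, hg, hn, rfl⟩ u c
  rw [fn_tv]
  exact fn_mem_WW (hg.th u c) hn

end layers

end RS

namespace RS

section ops
open MvPolynomial

variable {K : Type} [Field K] {p t m d : ℕ}

lemma sum_pow_ne [Fintype K] (n : ℕ) (hn : n ≠ 0) :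
    ∑ x : K, x ^ n = if Fintype.card K - 1 ∣ n then -1 else 0 := by
  let φ : Kˣ ↪ K := ⟨fun x ↦ x, Units.val_injective⟩
  have h1 : Finset.univ.map φ = Finset.univ \ {0} := by
    ext x
    simpa only [Finset.mem_map, Finset.mem_univ, Function.Embedding.coeFn_mk, true_and, Finset.mem_sdiff,
      Finset.mem_singleton, φ] using! isUnit_iff_ne_zero
  calc
    ∑ x : K, x ^ n = ∑ x ∈ Finset.univ \ {(0 : K)}, x ^ n := by
      rw [← Finset.sum_sdiff ({0} : Finset K).subset_univ, Finset.sum_singleton, zero_pow hn, add_zero]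
    _ = ∑ x : Kˣ, (x ^ n : K) := by rw [← h1, Finset.sum_map]; rfl
    _ = _ := FiniteField.sum_pow_units K n

/-- extraction operator -/
def xt [Fintype K] (u : VV K m) (k : ℕ) : (VV K m → K) →ₗ[K] (VV K m → K) where
  toFun f := fun v => - ∑ c : K, c ^ (Fintype.card K - 1 - k) * f (tv u c v)
  map_add' f g := by
    funext v
    simp only [Pi.add_apply, mul_add, Finset.sum_add_distrib, neg_add]
  map_smul' a f := by
    funext v
    simp only [Pi.smul_apply, smul_eq_mul, RingHom.id_apply, mul_neg, Finset.mul_sum]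
    congr 1
    exact Finset.sum_congr rfl fun c _ => by ring

lemma xt_mem [Fintype K] {M : Submodule K (VV K m → K)} (hM : Stab M) (u : VV K m) (k : ℕ)
    {f : VV K m → K} (hf : f ∈ M) : xt u k f ∈ M := by
  have : xt u k f = - ∑ c : K, c ^ (Fintype.card K - 1 - k) • (fun v => f (tv u c v)) := by
    funext v
    simp [xt]
  rw [this]
  exact M.neg_mem (M.sum_mem fun c _ => M.smul_mem _ (hM u c f hf))

lemma xt_congr [Fintype K] {M : Submodule K (VV K m → K)} (u : VV K m) (k : ℕ)
    {f : VV K m → K} (g : K → VV K m → K) (h : ∀ c, (fun v => f (tv u c v)) - g c ∈ M) :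
    xt u k f - (fun v => - ∑ c : K, c ^ (Fintype.card K - 1 - k) * g c v) ∈ M := by
  have : xt u k f - (fun v => - ∑ c : K, c ^ (Fintype.card K - 1 - k) * g c v) =
      - ∑ c : K, c ^ (Fintype.card K - 1 - k) • ((fun v => f (tv u c v)) - g c) := by
    funext v
    simp [xt, mul_sub, Finset.sum_sub_distrib]
    try abel
  rw [this]
  exact M.neg_mem (M.sum_mem fun c _ => M.smul_mem _ (h c))

lemma extract [hp : Fact p.Prime] [CharP K p] [Fintype K] (hy : Hy K p t m d) (H : Fin t → ℕ → PP K m)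
    (j : Fin t) (r : ℕ) (hr : 1 ≤ r) (hr' : r ≤ p - 1) :
    (fun v => - ∑ c : K, c ^ (Fintype.card K - 1 - r * p ^ (j : ℕ)) *
      fn p (fun i => ∑ r ∈ Finset.range p, C (c ^ r) * H i r) v) =
    fn p (Function.update (fun i => H i 0) j (H j r)) := by
  haveI : ExpChar K p := ExpChar.prime hp.out
  have hp3 := hy.hp3
  funext v
  set q := Fintype.card K with hq
  set A : (Fin t → Fin p) → K := fun ρ => ∏ i, (ev (H i (ρ i)) v) ^ (p ^ (i : ℕ)) with hA
  set N : (Fin t → Fin p) → ℕ := fun ρ => ∑ i : Fin t, (ρ i : ℕ) * p ^ (i : ℕ) with hN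
  have hexp : ∀ c : K, fn p (fun i => ∑ r ∈ Finset.range p, C (c ^ r) * H i r) v =
      ∑ ρ : Fin t → Fin p, c ^ N ρ * A ρ := by
    intro c
    have e1 : ∀ i : Fin t, ev (∑ r ∈ Finset.range p, C (c ^ r) * H i r) v ^ (p ^ (i : ℕ)) =
        ∑ r : Fin p, (c ^ (r : ℕ)) ^ (p ^ (i : ℕ)) * (ev (H i r) v) ^ (p ^ (i : ℕ)) := by
      intro i
      rw [← Fin.sum_univ_eq_sum_range (fun r => C (c ^ r) * H i r)]
      have : ev (∑ r : Fin p, C (c ^ (r : ℕ)) * H i r) v = ∑ r : Fin p, c ^ (r : ℕ) * ev (H i r) v := by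
        simp [ev]
      rw [this, sum_pow_char_pow]
      refine Finset.sum_congr rfl fun r _ => mul_pow _ _ _
    rw [fn]
    simp only [e1]
    rw [Finset.prod_univ_sum, Fintype.piFinset_univ]
    refine Finset.sum_congr rfl fun ρ _ => ?_
    rw [Finset.prod_mul_distrib, hA, hN]
    congr 1
    rw [← Finset.prod_pow_eq_pow_sum]
    refine Finset.prod_congr rfl fun i _ => ?_
    rw [pow_mul]
  set k := r * p ^ (j : ℕ) with hk
  have hqt : q = p ^ t := hy.hcard
  have hk0 : 0 < k := Nat.mul_pos (by omega) (pow_pos hp.out.pos _)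
  have hkq : k + 2 ≤ q := by
    have h1 : p ^ (j : ℕ) ≤ p ^ (t - 1) := Nat.pow_le_pow_right hp.out.pos (by have := j.2; omega)
    have h2 : q = p * p ^ (t - 1) := by rw [hqt, ← pow_succ']; congr 1; have := hy.ht; omega
    have h3 : p ^ 1 ≤ p ^ (t - 1) := Nat.pow_le_pow_right hp.out.pos (by have := hy.ht; omega)
    have h4 : k ≤ (p - 1) * p ^ (t - 1) := Nat.mul_le_mul hr' h1
    have h5 : (p - 1) * p ^ (t - 1) + p ^ (t - 1) = q := by
      rw [h2, Nat.sub_mul, one_mul]; exact Nat.sub_add_cancel (Nat.le_mul_of_pos_left _ hp.out.pos)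
    rw [pow_one] at h3
    omega
  have hNq : ∀ ρ, N ρ < q := by
    intro ρ
    have := (finFunctionFinEquiv ρ).2
    rw [finFunctionFinEquiv_apply] at this
    rw [hqt]; exact this
  have hval : ∀ ρ, - ∑ c : K, c ^ (q - 1 - k) * c ^ N ρ = if N ρ = k then 1 else 0 := by
    intro ρ
    simp only [← pow_add]
    rw [sum_pow_ne _ (by omega), ← hq]
    have : q - 1 ∣ q - 1 - k + N ρ ↔ N ρ = k := by
      constructor
      · rintro ⟨x, hx⟩
        have hb := hNq ρ
        rcases x with _ | _ | x
        · omega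
        · omega
        · exfalso
          have h6 : (q - 1) * (x + 1 + 1) = (q - 1) * x + (q - 1) + (q - 1) := by ring
          rw [h6] at hx
          have := Nat.zero_le ((q - 1) * x)
          omega
      · intro h; rw [h]; exact ⟨1, by omega⟩
    simp only [this]
    split_ifs <;> simp
  set ρ0 : Fin t → Fin p := fun i => if i = j then ⟨r, by omega⟩ else ⟨0, hp.out.pos⟩ with hρ0
  have hN0 : N ρ0 = k := by
    rw [hN]
    simp only [hρ0]
    rw [Finset.sum_eq_single j]
    · simp [hk]
    · intro b _ hb; simp [hb]
    · simp
  have huniq : ∀ ρ, N ρ = k ↔ ρ = ρ0 := by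
    intro ρ
    constructor
    · intro h
      apply finFunctionFinEquiv.injective
      apply Fin.ext
      rw [finFunctionFinEquiv_apply, finFunctionFinEquiv_apply]
      exact h.trans hN0.symm
    · rintro rfl; exact hN0
  calc - ∑ c : K, c ^ (q - 1 - k) * fn p (fun i => ∑ r ∈ Finset.range p, C (c ^ r) * H i r) v
      = ∑ ρ : Fin t → Fin p, (- ∑ c : K, c ^ (q - 1 - k) * c ^ N ρ) * A ρ := by
        simp only [hexp, Finset.mul_sum, neg_mul, Finset.sum_mul, Finset.sum_neg_distrib]
        rw [Finset.sum_comm]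
        congr 1
        refine Finset.sum_congr rfl fun _ _ => Finset.sum_congr rfl fun _ _ => by ring
    _ = A ρ0 := by
        simp only [hval, huniq]
        simp
    _ = _ := by
        rw [hA, fn]
        refine Finset.prod_congr rfl fun i _ => ?_
        by_cases hi : i = j
        · subst hi; simp [hρ0]
        · rw [Function.update_of_ne hi]; simp [hρ0, hi]

variable [NeZero t] {s : Fin t → ℤ} {eps : Finset (Fin t)}

lemma Gen.tay [hp : Fact p.Prime] [CharP K p] {s' : Fin t → ℤ} {h : Fin t → PP K m} (hg : Gen p d s eps s' h) (u : VV K m) (c : K) :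
    Gen p d s eps s' (fun j => tay p u c (h j)) := ⟨hg.1, fun j => DD_tay u c (hg.2 j)⟩

lemma xt_tay [hp : Fact p.Prime] [CharP K p] [Fintype K] (hy : Hy K p t m d) {s' : Fin t → ℤ} {h : Fin t → PP K m}
    (hg : Gen p d s eps s' h) (u : VV K m) (j : Fin t) (r : ℕ) (hr : 1 ≤ r) (hr' : r ≤ p - 1) :
    xt u (r * p ^ (j : ℕ)) (fn p h) - fn p (Function.update h j (((r.factorial : K)⁻¹) • (Qd u)^[r] (h j)))
      ∈ WW K p m d s eps (∑ i, s' i - 1) := by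
  have h1 := xt_congr (M := WW K p m d s eps (∑ i, s' i - 1)) u (r * p ^ (j : ℕ)) (f := fn p h)
    (fun c => fn p (fun i => tay p u c (h i))) (by
      intro c
      rw [fn_tv]
      exact fn_congr hy (hg.th u c) (hg.tay u c) (fun i => taylor u c (h i)))
  have h2 := extract hy (fun i r => ((r.factorial : K)⁻¹) • (Qd u)^[r] (h i)) j r hr hr'
  convert h1 using 2
  have h3 : (fun i => (((0 : ℕ).factorial : K)⁻¹) • (Qd u)^[0] (h i)) = h := by
    funext i; simp
  rw [h3] at h2
  rw [← h2]
  funext v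
  congr 1
  refine Finset.sum_congr rfl fun c _ => ?_
  congr 2
  funext i
  rw [RS.tay]
  refine Finset.sum_congr rfl fun r _ => ?_
  rw [div_eq_mul_inv, C_mul, smul_eq_C_mul, mul_assoc]

lemma xt_Qd [hp : Fact p.Prime] [CharP K p] [Fintype K] (hy : Hy K p t m d) {s' : Fin t → ℤ} {h : Fin t → PP K m}
    (hg : Gen p d s eps s' h) (u : VV K m) (j : Fin t) :
    xt u (p ^ (j : ℕ)) (fn p h) - fn p (Function.update h j (Qd u (h j)))
      ∈ WW K p m d s eps (∑ i, s' i - 1) := by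
  have := xt_tay hy hg u j 1 le_rfl (by have := hy.hp3; omega)
  simpa using this

/-- compatible modes -/
structure Kap (p m d : ℕ) (s : Fin t → ℤ) (eps : Finset (Fin t)) (s' : Fin t → ℤ) (κ : Fin t → K) : Prop where
  adm : Adm p d s s'
  val : ∀ j, κ j = 0 ∨ κ j = 1 ∨ κ j = -1
  c0 : ∀ j, κ j = 0 ∨ (lamOfN p t d s' j : ℤ) - m * ((p : ℤ) - 1) = 0
  md : ∀ j, mode K p m d s eps s' j = 0 ∨ mode K p m d s eps s' j = κ j

/-- charges -/
abbrev cc (p t m d : ℕ) [NeZero t] (s' : Fin t → ℤ) (j : Fin t) : ℤ := (lamOfN p t d s' j : ℤ) - m * ((p : ℤ) - 1)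

/-- generators with modes κ -/
def GK (p d : ℕ) (s' : Fin t → ℤ) (κ : Fin t → K) (h : Fin t → PP K m) : Prop :=
  ∀ j, h j ∈ DD m p (κ j) (lamOfN p t d s' j)

lemma GK.gen [hp : Fact p.Prime] [CharP K p] {s' : Fin t → ℤ} {κ : Fin t → K} (hκ : Kap p m d s eps s' κ)
    {h : Fin t → PP K m} (hg : GK p d s' κ h) : Gen p d s eps s' h := by
  refine ⟨hκ.adm, fun j => ?_⟩
  rcases hκ.md j with h1 | h1
  · rw [h1]; exact DD_zero (DD_hom (hg j))
  · rw [h1]; exact hg j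

/-- Fourier side generators -/
def SF (p : ℕ) (κ : Fin t → K) (f : Fin t → PP K m) : Fin t → PP K m := fun j => SS m p (κ j) (f j)

lemma SF_update (κ : Fin t → K) (f : Fin t → PP K m) (j : Fin t) (g : PP K m) :
    SF p κ (Function.update f j g) = Function.update (SF p κ f) j (SS m p (κ j) g) := by
  funext i
  by_cases hi : i = j
  · subst hi; simp [SF]
  · simp [SF, Function.update_of_ne hi]

lemma SF_GK [hp : Fact p.Prime] [CharP K p] {s' : Fin t → ℤ} {κ : Fin t → K} (hκ : Kap p m d s eps s' κ)
    {f : Fin t → PP K m} (hf : ∀ j, f j ∈ CH K m (cc p t m d s' j)) : GK p d s' κ (SF p κ f) :=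
  fun j => SS_DD (hκ.c0 j) (hf j)

lemma xt_Qh [hp : Fact p.Prime] [CharP K p] [Fintype K] (hy : Hy K p t m d) {s' : Fin t → ℤ} {κ : Fin t → K} (hκ : Kap p m d s eps s' κ)
    {f : Fin t → PP K m} (hf : ∀ j, f j ∈ CH K m (cc p t m d s' j)) (u : VV K m) (j : Fin t) :
    xt u (p ^ (j : ℕ)) (fn p (SF p κ f)) - fn p (SF p κ (Function.update f j (Qh u (f j))))
      ∈ WW K p m d s eps (∑ i, s' i - 1) := by
  have hg := (SF_GK hκ hf).gen hκ
  have h1 := xt_Qd hy hg u j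
  have hf' : ∀ i, Function.update f j (Qh u (f j)) i ∈ CH K m (cc p t m d s' i) := by
    intro i
    by_cases hi : i = j
    · subst hi; rw [Function.update_self]; exact Qh_CH u (hf i)
    · rw [Function.update_of_ne hi]; exact hf i
  have hg' := (SF_GK hκ hf').gen hκ
  have h2 := fn_congr hy (hg.update (DD_Qd u (hg.2 j))) hg' (by
    intro i
    by_cases hi : i = j
    · subst hi
      simp only [Function.update_self, SF]
      exact SS_Qh _ _ _
    · simp [SF, Function.update_of_ne hi])
  have := Submodule.add_mem _ h1 h2
  rwa [sub_add_sub_cancel] at this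

lemma Qh_step [hp : Fact p.Prime] [CharP K p] [Fintype K] (hy : Hy K p t m d) {s' : Fin t → ℤ} {κ : Fin t → K} (hκ : Kap p m d s eps s' κ)
    {M : Submodule K (VV K m → K)} (hM : Stab M) (hW : WW K p m d s eps (∑ i, s' i - 1) ≤ M)
    {f : Fin t → PP K m} (hf : ∀ j, f j ∈ CH K m (cc p t m d s' j)) (u : VV K m) (j : Fin t)
    (h : fn p (SF p κ f) ∈ M) : fn p (SF p κ (Function.update f j (Qh u (f j)))) ∈ M := by
  have h1 := M.sub_mem (xt_mem hM u (p ^ (j : ℕ)) h) (hW (xt_Qh hy hκ hf u j))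
  rwa [sub_sub_cancel] at h1

lemma two_ne [hp : Fact p.Prime] [CharP K p] (hp3 : 3 ≤ p) : (2 : K) ≠ 0 := by
  intro h
  have : ((2 : ℕ) : K) = 0 := by exact_mod_cast h
  rw [CharP.cast_eq_zero_iff K p] at this
  have := Nat.le_of_dvd (by norm_num) this
  omega

/-- all generators from one -/
lemma phase2 [hp : Fact p.Prime] [CharP K p] [Fintype K] (hy : Hy K p t m d) {s' : Fin t → ℤ} {κ : Fin t → K} (hκ : Kap p m d s eps s' κ)
    {M : Submodule K (VV K m → K)} (hM : Stab M) (hW : WW K p m d s eps (∑ i, s' i - 1) ≤ M)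
    (e0 : Fin t → (ZZ m →₀ ℕ)) (hG : ∀ j, Gn p (κ j) (cc p t m d s' j) (e0 j))
    (h0 : fn p (SF p κ (fun j => mo K (e0 j))) ∈ M) {h : Fin t → PP K m} (hh : GK p d s' κ h) :
    fn p h ∈ M := by
  have key : ∀ S : Finset (Fin t), ∀ e : Fin t → (ZZ m →₀ ℕ), (∀ j, chg (e j) = cc p t m d s' j) →
      (∀ j ∉ S, e j = e0 j) → fn p (SF p κ (fun j => mo K (e j))) ∈ M := by
    intro S
    induction S using Finset.induction_on with
    | empty =>
      intro e _ h2
      have : e = e0 := funext fun j => h2 j (Finset.notMem_empty _)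
      rw [this]; exact h0
    | insert b S hb ih =>
      intro e he h2
      set f : Fin t → PP K m := fun j => mo K (e j) with hf
      have hfC : ∀ j, f j ∈ CH K m (cc p t m d s' j) := fun j => mon_mem_CH _ (he j)
      set Mb : Submodule K (PP K m) := (slot (p := p) M (SF p κ f) b).comap (SS m p (κ b)) ⊓ CH K m (cc p t m d s' b) with hMb
      have mem : ∀ g, g ∈ Mb ↔ fn p (SF p κ (Function.update f b g)) ∈ M ∧ g ∈ CH K m (cc p t m d s' b) := by
        intro g
        rw [hMb, Submodule.mem_inf, Submodule.mem_comap, mem_slot, SF_update]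
      have updC : ∀ g ∈ CH K m (cc p t m d s' b), ∀ j, Function.update f b g j ∈ CH K m (cc p t m d s' j) := by
        intro g hg j
        by_cases hj : j = b
        · subst hj; rwa [Function.update_self]
        · rw [Function.update_of_ne hj]; exact hfC j
      have hGen := (SF_GK hκ hfC).gen hκ
      have hup : ∀ e' : ZZ m →₀ ℕ, Function.update f b (mo K e') = fun j => mo K (Function.update e b e' j) := by
        intro e'
        funext j
        by_cases hj : j = b
        · subst hj; simp
        · simp [Function.update_of_ne hj, hf]
      have hres := raise (M := Mb) (p := p) (by
          intro u g hg
          rw [mem] at hg ⊢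
          refine ⟨?_, Qh_CH u hg.2⟩
          have := Qh_step hy hκ hM hW (updC g hg.2) u b hg.1
          rwa [Function.update_idem, Function.update_self] at this) (two_ne (p := p) hy.hp3)
          (cc p t m d s' b) (κ b) (by
          intro e' hr hc
          rw [mem]
          refine ⟨?_, mon_mem_CH _ hc⟩
          rw [SF_update]
          exact hW (carry hy hGen b (SS_hom rfl (hκ.c0 b) (mon_mem_CH _ hc)) (SS_nonred hr _ _))) (hκ.c0 b) (by
          intro hk e' hc
          have hcb := (hκ.c0 b).resolve_left hk
          have hkk : κ b * κ b = 1 := by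
            rcases hκ.val b with h | h | h
            · exact absurd h hk
            · rw [h, one_mul]
            · rw [h]; ring
          rw [mem]
          refine ⟨?_, Submodule.sub_mem _ (mon_mem_CH _ (hc.trans hcb.symm))
            (Submodule.smul_mem _ _ (mon_mem_CH _ ?_))⟩
          · have : SS m p (κ b) (mo K e' - κ b • mo K (swE e')) = 0 := by
              rw [SS_apply, map_sub, map_smul, map_sub, map_smul, map_sub, map_smul, mo, mo, sw_monomial, sw_monomial, swE_swE,
                smul_sub, smul_smul, hkk, one_smul]
              abel
            rw [SF_update, this, fn_zero]
            exact M.zero_mem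
          · rw [chg_swE, hc]; exact hcb.symm) (hG b) (by
          rw [mem]
          refine ⟨?_, mon_mem_CH _ (hG b).2.1⟩
          rw [hup]
          refine ih _ ?_ ?_
          · intro j
            by_cases hj : j = b
            · subst hj; rw [Function.update_self]; exact (hG j).2.1
            · rw [Function.update_of_ne hj]; exact he j
          · intro j hj
            by_cases hjb : j = b
            · subst hjb; rw [Function.update_self]
            · rw [Function.update_of_ne hjb]; exact h2 j (by simp [hj, hjb]))
      have h5 := hres (e b) (he b)
      rw [mem, Function.update_eq_self_iff.mpr (by rfl)] at h5
      exact h5.1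
  refine fn_span (fun j => DX m p (κ j) (lamOfN p t d s' j)) ?_ h (fun j => DD_le_span (hκ.c0 j) (hh j))
  intro h hX
  have hGK : GK p d s' κ h := fun j => DX_sub (hκ.c0 j) (hX j)
  by_cases hII : ∃ j, h j ∈ II K m p
  · obtain ⟨j, hj⟩ := hII
    have := carry hy (hGK.gen hκ) j (DD_hom (hGK j)) hj
    rw [Function.update_eq_self] at this
    exact hW this
  · push Not at hII
    have : ∀ j, ∃ e : ZZ m →₀ ℕ, chg e = cc p t m d s' j ∧ h j = SS m p (κ j) (mo K e) := by
      intro j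
      rcases hX j with ⟨e, _, h2, h3⟩ | ⟨_, h2⟩
      · exact ⟨e, h2, h3⟩
      · exact absurd h2 (hII j)
    choose e he1 he2 using this
    have hh : h = SF p κ (fun j => mo K (e j)) := funext he2
    rw [hh]
    exact key Finset.univ e he1 (fun j hj => absurd (Finset.mem_univ j) hj)

end ops

end RS

namespace RS

section simple
open MvPolynomial
variable {K : Type} [Field K] {p t m d : ℕ} [NeZero t]

/-- evaluation of the multi-digit polynomials -/
def Psi (p : ℕ) (κ : Fin t → K) : TP K m t →ₗ[K] (VV K m → K) :=
  (basisMonomials (Fin t × ZZ m) K).constr K (fun E => fn p (SF p κ (fun j => mo K (dg E j))))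

lemma Psi_mon (κ : Fin t → K) (E : TE m t) :
    Psi p κ (monomial E 1) = fn p (SF p κ (fun j => mo K (dg E j))) := by
  have := (basisMonomials (Fin t × ZZ m) K).constr_basis K
    (fun E => fn p (SF p κ (fun j => mo K (dg E j)))) E
  rwa [coe_basisMonomials] at this

lemma natCast_pow [hp : Fact p.Prime] [CharP K p] (n j : ℕ) : (n : K) ^ (p ^ j) = n := by
  haveI : ExpChar K p := ExpChar.prime hp.out
  have := map_natCast (iterateFrobenius K p j) n
  rwa [iterateFrobenius_def] at this

lemma Psi_upd [hp : Fact p.Prime] [CharP K p] (κ : Fin t → K) (E E' : TE m t) (j : Fin t) (e' : ZZ m →₀ ℕ) (n : ℕ)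
    (h : ∀ i, dg E' i = Function.update (dg E) j e' i) :
    Psi p κ (monomial E' (n : K)) =
      fn p (SF p κ (Function.update (fun i => mo K (dg E i)) j (monomial e' (n : K)))) := by
  have h1 : (monomial E' (n : K) : TP K m t) = (n : K) • monomial E' 1 := by
    rw [smul_monomial, smul_eq_mul, mul_one]
  have h2 : (monomial e' (n : K) : PP K m) = (n : K) • monomial e' 1 := by
    rw [smul_monomial, smul_eq_mul, mul_one]
  rw [h1, map_smul, Psi_mon, h2, SF_update, map_smul, fn_smul, natCast_pow, ← SF_update]
  congr 3
  funext i
  rw [h i]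
  by_cases hi : i = j
  · subst hi; simp [mo]
  · simp [Function.update_of_ne hi]

lemma fn_SF_add [hp : Fact p.Prime] [CharP K p] (κ : Fin t → K) (f : Fin t → PP K m) (j : Fin t) (a b : PP K m) :
    fn p (SF p κ (Function.update f j (a + b))) =
      fn p (SF p κ (Function.update f j a)) + fn p (SF p κ (Function.update f j b)) := by
  simp only [SF_update, map_add, fn_add]
lemma fn_SF_sub [hp : Fact p.Prime] [CharP K p] (κ : Fin t → K) (f : Fin t → PP K m) (j : Fin t) (a b : PP K m) :
    fn p (SF p κ (Function.update f j (a - b))) =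
      fn p (SF p κ (Function.update f j a)) - fn p (SF p κ (Function.update f j b)) := by
  simp only [SF_update, map_sub, fn_sub]
lemma fn_SF_neg [hp : Fact p.Prime] [CharP K p] (κ : Fin t → K) (f : Fin t → PP K m) (j : Fin t) (a : PP K m) :
    fn p (SF p κ (Function.update f j (-a))) =
      - fn p (SF p κ (Function.update f j a)) := by
  simp only [SF_update, map_neg, fn_neg]

lemma dg_sub (E : TE m t) (j : Fin t) (z : ZZ m) (i : Fin t) :
    dg (E - Finsupp.single (j, z) 1) i = Function.update (dg E) j (dg E j - Finsupp.single z 1) i := by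
  by_cases hi : i = j
  · subst hi
    rw [Function.update_self]
    ext w
    simp [Finsupp.single_apply]
  · rw [Function.update_of_ne hi]
    ext w
    simp [Finsupp.single_apply, Ne.symm hi]

lemma pd2 [hp : Fact p.Prime] [CharP K p] (κ : Fin t → K) (E : TE m t) (j : Fin t) (z w : ZZ m) :
    Psi p κ (pderiv (j, w) (pderiv (j, z) (monomial E 1))) =
      fn p (SF p κ (Function.update (fun i => mo K (dg E i)) j (pderiv w (pderiv z (mo K (dg E j)))))) := by
  have h1 : (pderiv (j, w) (pderiv (j, z) (monomial E 1)) : TP K m t) =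
      monomial (E - Finsupp.single (j, z) 1 - Finsupp.single (j, w) 1)
        ((E (j, z) * (E - Finsupp.single (j, z) 1 : TE m t) (j, w) : ℕ) : K) := by
    rw [pderiv_monomial, pderiv_monomial]
    push_cast
    rw [one_mul]
  have h2 : (pderiv w (pderiv z (mo K (dg E j))) : PP K m) =
      monomial (dg E j - Finsupp.single z 1 - Finsupp.single w 1)
        ((E (j, z) * (E - Finsupp.single (j, z) 1 : TE m t) (j, w) : ℕ) : K) := by
    rw [mo, pderiv_monomial, pderiv_monomial]
    push_cast
    rw [one_mul, dg_apply]
    congr 2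
    simp [Finsupp.single_apply]
  rw [h1, h2]
  apply Psi_upd
  intro i
  rw [dg_sub]
  by_cases hi : i = j
  · subst hi
    rw [Function.update_self, Function.update_self, dg_sub, Function.update_self]
  · rw [Function.update_of_ne hi, Function.update_of_ne hi, dg_sub, Function.update_of_ne hi]

lemma Psi_Dl [hp : Fact p.Prime] [CharP K p] (κ : Fin t → K) (E : TE m t) (j : Fin t) (i l : Fin m) :
    Psi p κ (Dl j i l (monomial E 1)) =
      fn p (SF p κ (Function.update (fun i => mo K (dg E i)) j (dl i l (mo K (dg E j))))) := by
  rw [Dl, dl, map_add, fn_SF_add, pd2, pd2]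

lemma X_pd_mon {σ : Type} (z : σ) (e : σ →₀ ℕ) :
    (X z * pderiv z (monomial e 1) : MvPolynomial σ K) = monomial e (e z : K) := by
  rw [pderiv_monomial, one_mul]
  by_cases h : e z = 0
  · rw [h]; simp
  · rw [X, monomial_mul, one_mul, add_comm, tsub_add_cancel_of_le]
    simpa [Nat.one_le_iff_ne_zero] using h

lemma Psi_Gd [hp : Fact p.Prime] [CharP K p] (κ : Fin t → K) (E : TE m t) (j : Fin t) (i : Fin m) :
    Psi p κ (Gd j i (monomial E 1)) =
      fn p (SF p κ (Function.update (fun i => mo K (dg E i)) j (gg i i (mo K (dg E j)) - mo K (dg E j)))) := by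
  have h1 : Gd j i (monomial E 1 : TP K m t) = monomial E ((wt E j i : ℕ) : K) := by
    rw [Gd, X_pd_mon, X_pd_mon, wt, ← map_add]; push_cast; rfl
  have h2 : gg i i (mo K (dg E j)) - mo K (dg E j) = monomial (dg E j) ((wt E j i : ℕ) : K) := by
    rw [gg, mo, X_pd_mon, X_mul_mon, pderiv_monomial, add_tsub_cancel_right, wt]
    rw [← map_add, ← map_sub]
    congr 1
    simp
    ring
  rw [h1, h2]
  apply Psi_upd
  intro i; simp

/-- the multi-digit polynomials of given charges -/
def GC (K : Type) [Field K] {t m : ℕ} (c : Fin t → ℤ) : Submodule K (TP K m t) :=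
  Submodule.span K {u | ∃ E : TE m t, gcE c E ∧ u = monomial E 1}

lemma mem_GC {c : Fin t → ℤ} {u : TP K m t} (h : ∀ E, coeff E u ≠ 0 → gcE c E) : u ∈ GC K c := by
  rw [← support_sum_monomial_coeff u]
  refine Submodule.sum_mem _ fun E hE => ?_
  have : (monomial E (coeff E u) : TP K m t) = coeff E u • monomial E 1 := by
    rw [smul_monomial, smul_eq_mul, mul_one]
  rw [this]
  exact Submodule.smul_mem _ _ (Submodule.subset_span ⟨E, h E (mem_support_iff.mp hE), rfl⟩)

lemma GC_coeff {c : Fin t → ℤ} {u : TP K m t} (h : u ∈ GC K c) : ∀ E, coeff E u ≠ 0 → gcE c E := by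
  refine Submodule.span_induction (p := fun u _ => ∀ E, coeff E u ≠ 0 → gcE c E) ?_ ?_ ?_ ?_ h
  · rintro u ⟨E, hE, rfl⟩ E' h'
    rw [coeff_monomial] at h'
    split_ifs at h' with h1
    · rw [← h1]; exact hE
    · exact absurd rfl h'
  · intro E h'; simp at h'
  · intro a b _ _ ha hb E h'
    rw [coeff_add] at h'
    by_cases h1 : coeff E a = 0
    · apply hb; intro h2; rw [h1, h2, add_zero] at h'; exact h' rfl
    · exact ha E h1
  · intro x a _ ha E h'
    apply ha
    intro h1
    rw [coeff_smul, h1, smul_zero] at h'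
    exact h' rfl

variable {s : Fin t → ℤ} {eps : Finset (Fin t)}

/-- a linear operator inducing another one modulo a submodule -/
lemma GC_op {W : Submodule K (VV K m → K)} {c : Fin t → ℤ} (A : TP K m t →ₗ[K] (VV K m → K))
    (h : ∀ E, gcE c E → A (monomial E 1) ∈ W) {u : TP K m t} (hu : u ∈ GC K c) : A u ∈ W := by
  have : GC K c ≤ W.comap A := by
    rw [GC, Submodule.span_le]
    rintro _ ⟨E, hE, rfl⟩
    exact h E hE
  exact this hu

/-- linear version -/
def DlL (K : Type) [Field K] {t m : ℕ} (j : Fin t) (i l : Fin m) : TP K m t →ₗ[K] TP K m t :=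
  (pderiv (j, Sum.inr i)).toLinearMap ∘ₗ (pderiv (j, Sum.inl l)).toLinearMap +
  (pderiv (j, Sum.inr l)).toLinearMap ∘ₗ (pderiv (j, Sum.inl i)).toLinearMap

/-- linear version -/
def GdL (K : Type) [Field K] {t m : ℕ} (j : Fin t) (i : Fin m) : TP K m t →ₗ[K] TP K m t :=
  LinearMap.mulLeft K (X (j, Sum.inl i)) ∘ₗ (pderiv (j, Sum.inl i)).toLinearMap +
  LinearMap.mulLeft K (X (j, Sum.inr i)) ∘ₗ (pderiv (j, Sum.inr i)).toLinearMap

lemma Psi_N0 [hp : Fact p.Prime] [CharP K p] [Fintype K] (hy : Hy K p t m d) {s' : Fin t → ℤ} {κ : Fin t → K}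
    (hκ : Kap p m d s eps s' κ) :
    N0 κ (cc p t m d s') p m ≤ (WW K p m d s eps (∑ i, s' i - 1)).comap (Psi p κ) := by
  rw [N0, Submodule.span_le]
  rintro _ (⟨E, hE, hr, rfl⟩ | ⟨E, j, hE, hk, rfl⟩)
  · rw [SetLike.mem_coe, Submodule.mem_comap, Psi_mon]
    rw [rdE, not_forall] at hr
    obtain ⟨j, hj⟩ := hr
    have hC : ∀ j, mo K (dg E j) ∈ CH K m (cc p t m d s' j) := fun j => mon_mem_CH _ (hE j)
    have := carry hy ((SF_GK hκ hC).gen hκ) j (DD_hom (SF_GK hκ hC j)) (SS_nonred hj _ _)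
    rwa [Function.update_eq_self] at this
  · rw [SetLike.mem_coe, Submodule.mem_comap]
    have hkk : κ j * κ j = 1 := by
      rcases hκ.val j with h | h | h
      · exact absurd h hk
      · rw [h, one_mul]
      · rw [h]; ring
    have hpk : κ j ^ (p ^ (j : ℕ)) = κ j := by
      rcases hκ.val j with h | h | h
      · exact absurd h hk
      · rw [h, one_pow]
      · rw [h, Odd.neg_one_pow]
        exact Odd.pow (hp.out.odd_of_ne_two (by have := hy.hp3; omega))
    have h0 : Psi p κ (monomial (swT j E) 1 - κ j • monomial E 1) = 0 := by
      rw [map_sub, map_smul, Psi_mon, Psi_mon]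
      set f : Fin t → PP K m := fun i => mo K (dg E i) with hf
      have h1 : (fun i => mo K (dg (swT j E) i)) = Function.update f j (mo K (swE (dg E j))) := by
        funext i
        by_cases hi : i = j
        · subst hi; simp [dg_swT]
        · simp [dg_swT, hi, hf]
      have h2 : SS m p (κ j) (mo K (swE (dg E j))) = κ j • SS m p (κ j) (f j) := by
        simp only [hf, mo]
        rw [SS_apply, SS_apply, sw_monomial, sw_monomial, swE_swE, smul_add, smul_smul, hkk, one_smul]
        abel
      have h3 : fn p (SF p κ f) = fn p (Function.update (SF p κ f) j (SS m p (κ j) (f j))) := by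
        rw [Function.update_eq_self_iff.mpr]; rfl
      rw [h1, SF_update, h2, fn_smul, hpk, ← h3, sub_self]
    rw [h0]; exact Submodule.zero_mem _

/-- the submodule generated by all functions with modes `κ` -/
def UU (p m d : ℕ) (s' : Fin t → ℤ) (κ : Fin t → K) : Submodule K (VV K m → K) :=
  Submodule.span K {f | ∃ h, GK p d s' κ h ∧ f = fn p h}

lemma UU_le [hp : Fact p.Prime] [CharP K p] [Fintype K] (hy : Hy K p t m d) {s' : Fin t → ℤ} {κ : Fin t → K}
    (hκ : Kap p m d s eps s' κ) :
    UU p m d s' κ ≤ (GC K (cc p t m d s')).map (Psi p κ) ⊔ WW K p m d s eps (∑ i, s' i - 1) := by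
  rw [UU, Submodule.span_le]
  rintro _ ⟨h, hh, rfl⟩
  refine fn_span (fun j => DX m p (κ j) (lamOfN p t d s' j)) ?_ h (fun j => DD_le_span (hκ.c0 j) (hh j))
  intro h hX
  have hGK : GK p d s' κ h := fun j => DX_sub (hκ.c0 j) (hX j)
  by_cases hII : ∃ j, h j ∈ II K m p
  · obtain ⟨j, hj⟩ := hII
    have := carry hy (hGK.gen hκ) j (DD_hom (hGK j)) hj
    rw [Function.update_eq_self] at this
    exact Submodule.mem_sup_right this
  · push Not at hII
    have : ∀ j, ∃ e : ZZ m →₀ ℕ, chg e = cc p t m d s' j ∧ h j = SS m p (κ j) (mo K e) := by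
      intro j
      rcases hX j with ⟨e, _, h2, h3⟩ | ⟨_, h2⟩
      · exact ⟨e, h2, h3⟩
      · exact absurd h2 (hII j)
    choose e he1 he2 using this
    set E : TE m t := Finsupp.equivFunOnFinite.symm fun x => e x.1 x.2 with hE
    have hdg : ∀ j, dg E j = e j := by
      intro j; ext z; rfl
    apply Submodule.mem_sup_left
    refine ⟨monomial E 1, Submodule.subset_span ⟨E, fun j => by rw [hdg, he1], rfl⟩, ?_⟩
    rw [Psi_mon]
    congr 1
    funext j
    rw [he2, SF, hdg]

/-- simplicity -/
theorem simple_layer [hp : Fact p.Prime] [CharP K p] [Fintype K] (hy : Hy K p t m d) {s' : Fin t → ℤ} {κ : Fin t → K}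
    (hκ : Kap p m d s eps s' κ)
    (hk : ∀ j, (κ j = 0 ∧ cc p t m d s' j ≠ 0) ∨ (κ j = 1 ∧ cc p t m d s' j = 0) ∨ (κ j = -1 ∧ cc p t m d s' j = 0))
    {M : Submodule K (VV K m → K)} (hM : Stab M) (hW : WW K p m d s eps (∑ i, s' i - 1) ≤ M)
    {x : VV K m → K} (hxM : x ∈ M) (hxU : x ∈ UU p m d s' κ ⊔ WW K p m d s eps (∑ i, s' i - 1))
    (hxW : x ∉ WW K p m d s eps (∑ i, s' i - 1)) : UU p m d s' κ ≤ M := by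
  set W := WW K p m d s eps (∑ i, s' i - 1) with hWdef
  have h1 : x ∈ (GC K (cc p t m d s')).map (Psi p κ) ⊔ W := by
    refine (sup_le (UU_le hy hκ) le_sup_right) hxU
  obtain ⟨y, ⟨u0, hu0, rfl⟩, w, hw, hyw⟩ := Submodule.mem_sup.mp h1
  have hop : ∀ u ∈ GC K (cc p t m d s'), ∀ A : TP K m t →ₗ[K] TP K m t,
      ∀ B : (VV K m → K) →ₗ[K] (VV K m → K), (∀ f ∈ M, B f ∈ M) →
      (∀ E, gcE (cc p t m d s') E → B (Psi p κ (monomial E 1)) - Psi p κ (A (monomial E 1)) ∈ W) →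
      Psi p κ u ∈ M → Psi p κ (A u) ∈ M := by
    intro u hu A B hB hAB huM
    have := GC_op (B ∘ₗ Psi p κ - Psi p κ ∘ₗ A) hAB hu
    have h2 := M.sub_mem (hB _ huM) (hW this)
    simpa using h2
  have hC : ∀ E, gcE (cc p t m d s') E → ∀ j, mo K (dg E j) ∈ CH K m (cc p t m d s' j) :=
    fun E hE j => mon_mem_CH _ (hE j)
  obtain ⟨E0, hG, hE0⟩ := lower (p := p) (k := κ) (c := cc p t m d s') (two_ne (p := p) hy.hp3) hk (M.comap (Psi p κ)) (by
      intro u hu hgc j i l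
      refine hop u (mem_GC hgc) (DlL K j i l)
        (-(xt (ee i + ee l) (p ^ (j : ℕ)) - xt (ee i) (p ^ (j : ℕ)) - xt (ee l) (p ^ (j : ℕ)))) ?_ ?_ hu
      · intro f hf
        exact M.neg_mem (M.sub_mem (M.sub_mem (xt_mem hM _ _ hf) (xt_mem hM _ _ hf)) (xt_mem hM _ _ hf))
      · intro E hE
        have e1 : DlL K j i l (monomial E 1) = Dl j i l (monomial E 1) := rfl
        rw [e1, Psi_Dl, dl_Qh, fn_SF_neg, fn_SF_sub, fn_SF_sub, Psi_mon]
        have a1 := xt_Qh hy hκ (hC E hE) (ee i + ee l) j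
        have a2 := xt_Qh hy hκ (hC E hE) (ee i) j
        have a3 := xt_Qh hy hκ (hC E hE) (ee l) j
        have := W.neg_mem (W.sub_mem (W.sub_mem a1 a2) a3)
        convert this using 1
        simp only [LinearMap.neg_apply, LinearMap.sub_apply]
        abel) (by
      intro u hu hgc j i
      refine hop u (mem_GC hgc) (GdL K j i)
        (xt (ee i + ff i) (p ^ (j : ℕ)) - xt (ee i) (p ^ (j : ℕ)) - xt (ff i) (p ^ (j : ℕ)) - LinearMap.id) ?_ ?_ hu
      · intro f hf
        exact M.sub_mem (M.sub_mem (M.sub_mem (xt_mem hM _ _ hf) (xt_mem hM _ _ hf)) (xt_mem hM _ _ hf)) hf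
      · intro E hE
        have e1 : GdL K j i (monomial E 1) = Gd j i (monomial E 1) := rfl
        rw [e1, Psi_Gd, gg_Qh, fn_SF_sub, fn_SF_sub, fn_SF_sub, Psi_mon]
        have a1 := xt_Qh hy hκ (hC E hE) (ee i + ff i) j
        have a2 := xt_Qh hy hκ (hC E hE) (ee i) j
        have a3 := xt_Qh hy hκ (hC E hE) (ff i) j
        have := (W.sub_mem (W.sub_mem a1 a2) a3)
        convert this using 1
        have e2 : Function.update (fun i => mo K (dg E i)) j (mo K (dg E j)) = fun i => mo K (dg E i) :=
          Function.update_eq_self_iff.mpr rfl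
        rw [e2]
        simp only [LinearMap.sub_apply, LinearMap.id_apply]
        abel) ((Psi_N0 hy hκ).trans (Submodule.comap_mono hW)) (GC_coeff hu0) (by
      rw [Submodule.mem_comap]
      have : Psi p κ u0 = x - w := by rw [← hyw, add_sub_cancel_right]
      rw [this]
      exact M.sub_mem hxM (hW hw)) (by
      intro h
      apply hxW
      rw [← hyw]
      exact W.add_mem (Psi_N0 hy hκ h) hw)
  rw [UU, Submodule.span_le]
  rintro _ ⟨h, hh, rfl⟩
  rw [Submodule.mem_comap, Psi_mon] at hE0
  exact phase2 hy hκ hM hW (dg E0) hG hE0 hh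

end simple

end RS

namespace RS

section exact
open MvPolynomial
variable {K : Type} [Field K] {p t m d : ℕ}

lemma ell_ee (i : Fin m) : ell (ee i : VV K m) = - X (Sum.inr i) := by
  rw [ell, Fintype.sum_sum_type]
  simp [pt, ee, LL, Pi.single_apply, Finset.sum_neg_distrib]

lemma ell_ff (i : Fin m) : ell (ff i : VV K m) = X (Sum.inl i) := by
  rw [ell, Fintype.sum_sum_type]
  simp [pt, ff, LL, Pi.single_apply]

lemma Qd_ee (i : Fin m) (h : PP K m) : Qd (ee i) h = - (X (Sum.inr i) * pderiv (Sum.inl i) h) := by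
  rw [Qd_eq, ell_ee, Fintype.sum_sum_type]
  simp [pt, ee, Pi.single_apply]

lemma Qd_ff (i : Fin m) (h : PP K m) : Qd (ff i) h = X (Sum.inl i) * pderiv (Sum.inr i) h := by
  rw [Qd_eq, ell_ff, Fintype.sum_sum_type]
  simp [pt, ff, Pi.single_apply]

lemma Qee_mon (i : Fin m) (e : ZZ m →₀ ℕ) (c : K) :
    Qd (ee i) (monomial e c) = monomial (e - xa i + xb i) (-(c * e (Sum.inl i))) := by
  rw [Qd_ee, pderiv_monomial, X_mul_mon, ← map_neg]; rfl

lemma Qff_mon (i : Fin m) (e : ZZ m →₀ ℕ) (c : K) :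
    Qd (ff i) (monomial e c) = monomial (e - xb i + xa i) (c * e (Sum.inr i)) := by
  rw [Qd_ff, pderiv_monomial, X_mul_mon]; rfl

lemma Qee_iter (i : Fin m) (e : ZZ m →₀ ℕ) (c : K) (k : ℕ) :
    (Qd (ee i))^[k] (monomial e c) =
      monomial (e - k • xa i + k • xb i) (c * (-1) ^ k * ((e (Sum.inl i)).descFactorial k : K)) := by
  induction k with
  | zero => simp
  | succ k ih =>
    rw [Function.iterate_succ_apply', ih, Qee_mon]
    have h1 : e - k • xa i + k • xb i - xa i + xb i = e - (k + 1) • xa i + (k + 1) • xb i := by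
      ext z
      rcases z with z | z
      · by_cases hz : i = z <;> simp [xa_inl, hz]
        omega
      · by_cases hz : i = z <;> simp [xb_inr, hz]
        omega
    have h2 : (e - k • xa i + k • xb i) (Sum.inl i) = e (Sum.inl i) - k := by
      simp [xa_inl]
    rw [h1, h2, Nat.descFactorial_succ]
    congr 1
    push_cast
    ring

lemma Qee_zero (i : Fin m) (e : ZZ m →₀ ℕ) (c : K) (k : ℕ) (h : e (Sum.inl i) < k) :
    (Qd (ee i))^[k] (monomial e c) = 0 := by
  rw [Qee_iter, Nat.descFactorial_eq_zero_iff_lt.mpr h]; simp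

lemma iter_II [hp : Fact p.Prime] [CharP K p] (u : VV K m) {h : PP K m} (hh : h ∈ II K m p) (k : ℕ) :
    (Qd u)^[k] h ∈ II K m p := by
  induction k with
  | zero => exact hh
  | succ k ih => rw [Function.iterate_succ_apply']; exact deriv_mem_II _ ih

lemma iter_add (u : VV K m) (f g : PP K m) (k : ℕ) : (Qd u)^[k] (f + g) = (Qd u)^[k] f + (Qd u)^[k] g := by
  induction k with
  | zero => rfl
  | succ k ih => rw [Function.iterate_succ_apply', ih, map_add, ← Function.iterate_succ_apply' (⇑(Qd u)),
      ← Function.iterate_succ_apply' (⇑(Qd u))]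

lemma opII [hp : Fact p.Prime] [CharP K p] (hp3 : 3 ≤ p) (i : Fin m) (h : PP K m) :
    Qd (ee i) (Qd (ff i) ((Qd (ee i))^[p - 1] h)) - (Qd (ee i))^[p - 1] h ∈ II K m p := by
  induction h using MvPolynomial.induction_on' with
  | add f g hf hg =>
    rw [iter_add]
    simp only [map_add]
    have := Ideal.add_mem _ hf hg
    convert this using 1
    ring
  | monomial e c =>
    by_cases hr : red p e
    · have h1 := hr (Sum.inl i)
      by_cases h2 : e (Sum.inl i) < p - 1
      · rw [Qee_zero _ _ _ _ h2]; simp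
      · have h3 : e (Sum.inl i) = p - 1 := by omega
        rw [Qee_iter]
        set a : K := c * (-1) ^ (p - 1) * ((e (Sum.inl i)).descFactorial (p - 1) : K) with ha
        by_cases hb : e (Sum.inr i) = 0
        · rw [Qff_mon, Qee_mon]
          have e1 : (e - (p - 1) • xa i + (p - 1) • xb i) (Sum.inr i) = p - 1 := by simp [xb_inr, hb]
          have e2 : (e - (p - 1) • xa i + (p - 1) • xb i - xb i + xa i) (Sum.inl i) = 1 := by
            simp [xa_inl, h3]
          have e3 : e - (p - 1) • xa i + (p - 1) • xb i - xb i + xa i - xa i + xb i =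
              e - (p - 1) • xa i + (p - 1) • xb i := by
            ext z
            rcases z with z | z
            · by_cases hz : i = z <;> simp [xa_inl, hz]
            · by_cases hz : i = z <;> simp [xb_inr, hz]
              omega
          rw [e1, e2, e3]
          have : -(a * ((p - 1 : ℕ) : K) * ((1 : ℕ) : K)) = a := by
            rw [Nat.cast_sub (by omega), CharP.cast_eq_zero]; simp
          rw [this, sub_self]
          exact Ideal.zero_mem _
        · have hI : (monomial (e - (p - 1) • xa i + (p - 1) • xb i) a : PP K m) ∈ II K m p := by
            rw [mem_II]
            intro e' he'
            have := support_monomial_subset he'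
            rw [Finset.mem_singleton] at this
            refine ⟨Sum.inr i, ?_⟩
            rw [this]
            simp [xb_inr]
            omega
          exact Ideal.sub_mem _ (deriv_mem_II _ (deriv_mem_II _ hI)) hI
    · have hI : (monomial e c : PP K m) ∈ II K m p := by
        rw [mem_II]
        intro e' he'
        have := support_monomial_subset he'
        rw [Finset.mem_singleton] at this
        rw [this]
        simp only [red, not_forall] at hr
        obtain ⟨z, hz⟩ := hr
        exact ⟨z, by omega⟩
      exact Ideal.sub_mem _ (deriv_mem_II _ (deriv_mem_II _ (iter_II _ hI _))) (iter_II _ hI _)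

lemma tay_mul_X_exact [hp : Fact p.Prime] [CharP K p] (u : VV K m) (c : K) (h : PP K m) (z : ZZ m)
    (h0 : pt u z = 0 ∨ (Qd u)^[p - 1] h = 0) :
    tay p u c (h * X z) = tay p u c h * (X z + C (c * pt u z) * ell u) := by
  obtain ⟨n, rfl⟩ : ∃ n, p = n + 1 := ⟨p - 1, by have := hp.out.pos; omega⟩
  have hfac : ∀ r, r < n + 1 → (r.factorial : K) ≠ 0 := by
    intro r hr h0
    rw [CharP.cast_eq_zero_iff K (n + 1), hp.out.dvd_factorial] at h0
    omega
  have e1 : tay (n + 1) u c (h * X z) = tay (n + 1) u c h * X z +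
      ∑ r ∈ Finset.range n, C (c ^ r / (r.factorial : K)) * (Qd u)^[r] h *
        (C (c * pt u z) * ell u) := by
    simp only [tay, Qd_iter_mul_X, mul_add, Finset.sum_add_distrib, Finset.sum_mul]
    congr 1
    · refine Finset.sum_congr rfl fun r _ => by ring
    · rw [Finset.sum_range_succ']
      simp only [Nat.cast_zero, zero_mul, mul_zero, add_zero, Nat.add_sub_cancel]
      refine Finset.sum_congr rfl fun r hr => ?_
      have hr' := Finset.mem_range.mp hr
      have h1 := hfac (r + 1) (by omega)
      have : (C (c ^ (r + 1) / ((r + 1).factorial : K)) : PP K m) * ((r + 1 : ℕ) : PP K m) =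
          C (c ^ r / (r.factorial : K)) * C c := by
        rw [show ((r + 1 : ℕ) : PP K m) = C ((r + 1 : ℕ) : K) by simp, ← C_mul, ← C_mul]
        congr 1
        have h2 := hfac r (by omega)
        rw [Nat.factorial_succ, Nat.cast_mul] at h1 ⊢
        have h3 : ((r + 1 : ℕ) : K) ≠ 0 := left_ne_zero_of_mul h1
        field_simp
        try ring
      rw [← mul_assoc, this, C_mul]
      ring
  rw [e1, mul_add, add_right_inj, tay, Finset.sum_range_succ, add_mul, Finset.sum_mul, left_eq_add]
  rcases h0 with h0 | h0
  · rw [h0]; simp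
  · rw [Nat.add_sub_cancel] at h0; rw [h0]; simp

/-- bounded degree in a variable -/
def xdeg (p : ℕ) (i : Fin m) (h : PP K m) : Prop := ∀ e ∈ h.support, e (Sum.inl i) ≤ p - 1

lemma iter_C_mul (u : VV K m) (a : K) (f : PP K m) (k : ℕ) : (Qd u)^[k] (C a * f) = C a * (Qd u)^[k] f := by
  induction k with
  | zero => rfl
  | succ k ih => rw [Function.iterate_succ_apply', ih, Derivation.leibniz, Qd_C, smul_zero, add_zero,
      smul_eq_mul, ← Function.iterate_succ_apply' (⇑(Qd u))]

lemma tay_add (u : VV K m) (c : K) (f g : PP K m) : tay p u c (f + g) = tay p u c f + tay p u c g := by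
  simp only [tay, iter_add, mul_add, Finset.sum_add_distrib]

lemma tay_zero (u : VV K m) (c : K) : tay p u c (0 : PP K m) = 0 := by
  have := tay_add (p := p) u c (0 : PP K m) 0
  rw [add_zero] at this
  exact left_eq_add.mp this

lemma tay_sum {ι : Type} (S : Finset ι) (u : VV K m) (c : K) (f : ι → PP K m) :
    tay p u c (∑ x ∈ S, f x) = ∑ x ∈ S, tay p u c (f x) := by
  induction S using Finset.induction_on with
  | empty => simp [tay_zero]
  | insert a S ha ih => rw [Finset.sum_insert ha, Finset.sum_insert ha, tay_add, ih]

lemma tay_exact [hp : Fact p.Prime] [CharP K p] (i : Fin m) (c : K) (h : PP K m) (hx : xdeg p i h) :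
    th (ee i) c h = tay p (ee i) c h := by
  have key : ∀ n : ℕ, ∀ e : ZZ m →₀ ℕ, ∀ a : K, e.degree = n → e (Sum.inl i) ≤ p - 1 →
      th (ee i) c (monomial e a) = tay p (ee i) c (monomial e a) := by
    intro n
    induction n with
    | zero =>
      intro e a he _
      have : e = 0 := (Finsupp.degree_eq_zero_iff e).mp he
      subst this
      have e2 : (monomial 0 a : PP K m) = C a := rfl
      rw [e2, tay, ← Nat.sub_add_cancel hp.out.one_le, Finset.sum_range_succ', Finset.sum_eq_zero]
      · simp [th]
      · intro r _
        rw [Function.iterate_succ_apply, Qd_C]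
        have : (Qd (ee i))^[r] (0 : PP K m) = 0 := by
          have := iter_C_mul (ee i : VV K m) 0 0 r
          simpa using this
        rw [this, mul_zero]
    | succ n ih =>
      intro e a he hx
      have hne : e ≠ 0 := by rintro rfl; simp at he
      obtain ⟨z, hz⟩ := Finsupp.ne_iff.mp hne
      have hz1 : Finsupp.single z 1 ≤ e := by
        simpa [Nat.one_le_iff_ne_zero] using hz
      set e1 := e - Finsupp.single z 1 with he1
      have hee : e = e1 + Finsupp.single z 1 := (tsub_add_cancel_of_le hz1).symm
      have hm : (monomial e a : PP K m) = monomial e1 a * X z := by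
        rw [mul_comm, X_mul_mon, ← hee]
      have hle : e1 (Sum.inl i) ≤ e (Sum.inl i) := by rw [he1]; simp
      rw [hm, tay_mul_X_exact, map_mul, ih e1 a ?_ (hle.trans hx)]
      · congr 1
        simp [th]
      · rw [hee, map_add, Finsupp.degree_single] at he
        omega
      · by_cases hzi : z = Sum.inl i
        · right
          apply Qee_zero
          rw [hee, hzi] at hx
          simp at hx
          omega
        · left
          rcases z with z | z
          · have : z ≠ i := fun h => hzi (by rw [h])
            simp [pt, ee, this]
          · simp [pt, ee]
  rw [← support_sum_monomial_coeff h, map_sum, tay_sum]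
  exact Finset.sum_congr rfl fun e he => key _ e _ rfl (hx e he)

lemma xt_exact [NeZero t] [hp : Fact p.Prime] [CharP K p] [Fintype K] (hy : Hy K p t m d) {h : Fin t → PP K m}
    (i : Fin m) (hx : ∀ j, xdeg p i (h j)) (j : Fin t) (r : ℕ) (hr : 1 ≤ r) (hr' : r ≤ p - 1) :
    xt (ee i) (r * p ^ (j : ℕ)) (fn p h) =
      fn p (Function.update h j (((r.factorial : K)⁻¹) • (Qd (ee i))^[r] (h j))) := by
  have h2 := extract hy (fun l r => ((r.factorial : K)⁻¹) • (Qd (ee i))^[r] (h l)) j r hr hr'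
  have h3 : (fun l => (((0 : ℕ).factorial : K)⁻¹) • (Qd (ee i))^[0] (h l)) = h := by
    funext i; simp
  rw [h3] at h2
  rw [← h2]
  funext v
  show - ∑ c : K, _ = _
  congr 1
  refine Finset.sum_congr rfl fun c _ => ?_
  congr 1
  have := congrFun (fn_tv (p := p) h (ee i) c) v
  rw [this]
  congr 1
  funext l
  rw [tay_exact i c _ (hx l), RS.tay]
  refine Finset.sum_congr rfl fun r _ => ?_
  rw [div_eq_mul_inv, C_mul, smul_eq_C_mul, mul_assoc]

end exact

end RS

namespace RS

section digits
open MvPolynomial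
variable {K : Type} [Field K] {p t m d : ℕ}

lemma exists_le_sum {ι : Type} [Fintype ι] (b : ι → ℕ) (N : ℕ) (h : N ≤ ∑ i, b i) :
    ∃ a : ι → ℕ, (∀ i, a i ≤ b i) ∧ ∑ i, a i = N := by
  induction N with
  | zero => exact ⟨fun _ => 0, fun _ => Nat.zero_le _, by simp⟩
  | succ N ih =>
    obtain ⟨a, h1, h2⟩ := ih (by omega)
    have : ∃ i, a i < b i := by
      by_contra hc
      push Not at hc
      have := Finset.sum_le_sum fun i (_ : i ∈ Finset.univ) => hc i
      omega
    obtain ⟨i, hi⟩ := this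
    refine ⟨Function.update a i (a i + 1), ?_, ?_⟩
    · intro l
      by_cases hl : l = i
      · subst hl; simpa using hi
      · simpa [hl] using h1 l
    · rw [Finset.sum_update_of_mem (Finset.mem_univ _), ← h2, ← Finset.add_sum_erase _ _ (Finset.mem_univ i),
        Finset.sdiff_singleton_eq_erase]
      ring

/-- exponent from two parts -/
def mkE (a b : Fin m → ℕ) : ZZ m →₀ ℕ := Finsupp.equivFunOnFinite.symm (Sum.elim a b)
@[simp] lemma mkE_inl (a b : Fin m → ℕ) (i : Fin m) : mkE a b (Sum.inl i) = a i := rfl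
@[simp] lemma mkE_inr (a b : Fin m → ℕ) (i : Fin m) : mkE a b (Sum.inr i) = b i := rfl

lemma sum_upd_const (i : Fin m) (c b : ℕ) :
    ∑ l, (if l = i then b else c) + c = m * c + b := by
  have : ∑ l, (if l = i then b else c) = ∑ l, Function.update (fun _ : Fin m => c) i b l := by
    refine Finset.sum_congr rfl fun l _ => ?_
    by_cases h : l = i
    · subst h; simp
    · simp [h]
  rw [this, Finset.sum_update_of_mem (Finset.mem_univ _)]
  have h2 : ∑ l : Fin m, c = m * c := by simp
  rw [← Finset.add_sum_erase _ _ (Finset.mem_univ i)] at h2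
  rw [Finset.sdiff_singleton_eq_erase, ← h2]
  ring

lemma ex_purex (n : ℕ) (hn : n ≤ m * (p - 1)) :
    ∃ e : ZZ m →₀ ℕ, red p e ∧ chg e = n ∧ ∀ i, e (Sum.inr i) = 0 := by
  obtain ⟨a, h1, h2⟩ := exists_le_sum (fun _ : Fin m => p - 1) n (by simpa using hn)
  refine ⟨mkE a 0, ?_, ?_, ?_⟩
  · rintro (z | z)
    · exact h1 z
    · simp
  · rw [chg]; simp only [mkE_inl, mkE_inr, Pi.zero_apply]; rw [← h2]; push_cast; simp
  · intro i; rfl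

lemma ex_purey (n : ℕ) (i0 : Fin m) (hp : 2 ≤ p) (hn : n + 1 ≤ m * (p - 1)) :
    ∃ e : ZZ m →₀ ℕ, red p e ∧ chg e = -n ∧ (∀ i, e (Sum.inl i) = 0) ∧ e (Sum.inr i0) ≤ p - 2 := by
  have hs := sum_upd_const i0 (p - 1) (p - 2)
  obtain ⟨a, h1, h2⟩ := exists_le_sum (fun l : Fin m => if l = i0 then p - 2 else p - 1) n (by omega)
  refine ⟨mkE 0 a, ?_, ?_, ?_, ?_⟩
  · rintro (z | z)
    · simp
    · have := h1 z
      simp only [mkE_inr]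
      split_ifs at this <;> omega
  · rw [chg]; simp only [mkE_inl, mkE_inr, Pi.zero_apply]; rw [← h2]; push_cast; simp
  · intro i; rfl
  · have := h1 i0
    simpa using this

/-- digit for an arbitrary mode -/
lemma dig_gen (hp3 : 3 ≤ p) (i0 i1 : Fin m) (h01 : i0 ≠ i1) (k : K) (c : ℤ)
    (hk : k = 0 ∨ (k = 1 ∨ k = -1) ∧ c = 0) (h1 : -(m * ((p : ℤ) - 1)) ≤ c) (h2 : c ≤ m * ((p : ℤ) - 1)) :
    ∃ e : ZZ m →₀ ℕ, Gn p k c e := by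
  have hcast : ((m * (p - 1) : ℕ) : ℤ) = m * ((p : ℤ) - 1) := by
    rw [Nat.cast_mul, Nat.cast_sub (by omega)]; simp
  by_cases hc : c = 0
  · subst hc
    have hpair : red p (xa i1 + xb i0) ∧ chg (xa i1 + xb i0) = 0 := by
      refine ⟨?_, by rw [chg_add]; simp⟩
      rintro (z | z)
      · simp only [Finsupp.add_apply, xa_inl, xb_inl]; split_ifs <;> omega
      · simp only [Finsupp.add_apply, xb_inr, xa_inr]; split_ifs <;> omega
    rcases hk with h | ⟨h | h, _⟩
    · exact ⟨xa i1 + xb i0, hpair.1, hpair.2, Or.inr (Or.inr (Or.inr ⟨h, 0, i1, i0, h01.symm, by simp, by simp, by simp⟩))⟩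
    · exact ⟨0, fun z => by simp, by simp [chg], Or.inr (Or.inl ⟨h, rfl⟩)⟩
    · exact ⟨xa i1 + xb i0, hpair.1, hpair.2, Or.inr (Or.inr (Or.inl ⟨h, i1, i0, h01.symm, rfl⟩))⟩
  · rcases lt_or_gt_of_ne hc with h | h
    · obtain ⟨e, e1, e2, e3⟩ := ex_purex (p := p) (m := m) (-c).toNat (by omega)
      refine ⟨swE e, fun z => by rw [swE_apply]; exact e1 _, ?_, Or.inl ⟨hc, Or.inl fun i => ?_⟩⟩
      · rw [chg_swE, e2]; omega
      · simp [e3]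
    · obtain ⟨e, e1, e2, e3⟩ := ex_purex (p := p) (m := m) c.toNat (by omega)
      exact ⟨e, e1, by omega, Or.inl ⟨hc, Or.inr e3⟩⟩

/-- digit giving the carry -/
lemma dig_j (hp3 : 3 ≤ p) (i0 i1 : Fin m) (h01 : i0 ≠ i1) (c : ℤ)
    (h1 : -(m * ((p : ℤ) - 1)) ≤ c) (h2 : c + p ≤ m * ((p : ℤ) - 1)) :
    ∃ e : ZZ m →₀ ℕ, Gn p (0 : K) c e ∧ e (Sum.inl i0) = 0 ∧ 1 ≤ e (Sum.inr i0) := by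
  have hcast : ((m * (p - 1) : ℕ) : ℤ) = m * ((p : ℤ) - 1) := by
    rw [Nat.cast_mul, Nat.cast_sub (by omega)]; simp
  rcases lt_or_ge c 0 with hc | hc
  · obtain ⟨e, e1, e2, e3, e4⟩ := ex_purey (p := p) (-c - 1).toNat i0 (by omega) (by omega)
    refine ⟨e + xb i0, ⟨?_, ?_, Or.inl ⟨hc.ne, Or.inl fun i => by simp [e3]⟩⟩, by simp [e3], by simp [xb_inr]⟩
    · rintro (z | z)
      · simp [e3]
      · have := e1 (Sum.inr z)
        simp only [Finsupp.add_apply, xb_inr]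
        split_ifs with hz
        · subst hz; omega
        · omega
    · rw [chg_add, e2, chg_xb]; omega
  · have hs := sum_upd_const i0 (p - 1) 0
    obtain ⟨a, a1, a2⟩ := exists_le_sum (fun l : Fin m => if l = i0 then 0 else if l = i1 then p - 2 else p - 1) c.toNat (by
      have : ∑ l : Fin m, (if l = i0 then 0 else if l = i1 then p - 2 else p - 1) + 1 =
          ∑ l, (if l = i0 then 0 else (p - 1)) := by
        rw [← Finset.add_sum_erase _ _ (Finset.mem_univ i1), ← Finset.add_sum_erase (Finset.univ) (fun l => if l = i0 then 0 else (p - 1)) (Finset.mem_univ i1)]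
        have : ∑ l ∈ Finset.univ.erase i1, (if l = i0 then 0 else if l = i1 then p - 2 else p - 1) =
            ∑ l ∈ Finset.univ.erase i1, (if l = i0 then 0 else (p - 1)) := by
          refine Finset.sum_congr rfl fun l hl => ?_
          rw [if_neg (Finset.ne_of_mem_erase hl)]
        rw [this, if_neg h01.symm, if_neg h01.symm, if_pos rfl]
        omega
      omega)
    have ha0 : a i0 = 0 := by have := a1 i0; simpa using this
    refine ⟨mkE a 0 + xa i1 + xb i0, ⟨?_, ?_, Or.inr (Or.inr (Or.inr ⟨rfl, mkE a 0, i1, i0, h01.symm, fun _ => rfl, ha0, rfl⟩))⟩, ?_, ?_⟩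
    · rintro (z | z)
      · have := a1 z
        simp only [Finsupp.add_apply, xa_inl, xb_inl, mkE_inl]
        by_cases hz1 : i1 = z
        · subst hz1
          rw [if_neg h01.symm, if_pos rfl] at this
          rw [if_pos rfl]; omega
        · rw [if_neg hz1]
          split_ifs at this <;> omega
      · simp only [Finsupp.add_apply, xb_inr, xa_inr, mkE_inr, Pi.zero_apply]
        split_ifs <;> omega
    · rw [chg_add, chg_add, chg_xa, chg_xb, chg]
      simp only [mkE_inl, mkE_inr, Pi.zero_apply]
      have : ((∑ i, a i : ℕ) : ℤ) = c := by omega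
      push_cast at this
      rw [this]; simp
    · simp [ha0, xa_inl, h01.symm]
    · simp [xb_inr]

lemma bar_add_xb (e : ZZ m →₀ ℕ) (i0 : Fin m) (h : e (Sum.inr i0) + 1 ≤ p - 1) :
    bar p (e + xb i0) + xb i0 = bar p e := by
  ext z
  rcases z with z | z
  · simp
  · by_cases hz : i0 = z
    · subst hz; simp [xb_inr]; omega
    · simp [xb_inr, hz]

lemma XFF (e : ZZ m →₀ ℕ) (i0 : Fin m) (h : e (Sum.inr i0) + 1 ≤ p - 1) :
    X (Sum.inr i0) * FF K m p (mo K (e + xb i0)) = ((e (Sum.inr i0) + 1 : ℕ) : K) • FF K m p (mo K e) := by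
  rw [mo, FF_monomial, X_mul_mon, mo, FF_monomial, smul_monomial]
  have h1 : bar p (e + xb i0) + Finsupp.single (Sum.inr i0) 1 = bar p e := bar_add_xb e i0 h
  rw [h1, xb, fac_add]
  push_cast
  simp

lemma XFF_II (e : ZZ m →₀ ℕ) (i0 : Fin m) (h : e (Sum.inr i0) = 0) (hp : 1 ≤ p) :
    X (Sum.inr i0) * FF K m p (mo K e) ∈ II K m p := by
  rw [mo, FF_monomial, X_mul_mon, mem_II]
  intro e' he'
  have := support_monomial_subset he'
  rw [Finset.mem_singleton] at this
  subst this
  refine ⟨Sum.inr i0, ?_⟩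
  simp [h]
  omega

lemma SS_zero (f : PP K m) : SS m p (0 : K) f = FF K m p f := by simp [SS_apply]

/-- digit receiving the carry -/
lemma dig_j1 [hp : Fact p.Prime] [CharP K p] (hp3 : 3 ≤ p) (i0 i1 : Fin m) (h01 : i0 ≠ i1) (k : K) (c : ℤ) (hk : k = 0 ∨ c = 1)
    (h1 : -(m * ((p : ℤ) - 1)) + 1 ≤ c) (h2 : c ≤ m * ((p : ℤ) - 1)) :
    ∃ e a : ZZ m →₀ ℕ, ∃ β : K, β ≠ 0 ∧ Gn p (0 : K) c e ∧ red p a ∧ chg a = c - 1 ∧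
      X (Sum.inr i0) * SS m p k (mo K a) - β • SS m p 0 (mo K e) ∈ II K m p := by
  have hcast : ((m * (p - 1) : ℕ) : ℤ) = m * ((p : ℤ) - 1) := by
    rw [Nat.cast_mul, Nat.cast_sub (by omega)]; simp
  have fin : ∀ e : ZZ m →₀ ℕ, Gn p (0 : K) c e → e (Sum.inr i0) + 1 ≤ p - 1 → (k = 0 ∨ e (Sum.inl i0) = 0) →
      ∃ e a : ZZ m →₀ ℕ, ∃ β : K, β ≠ 0 ∧ Gn p (0 : K) c e ∧ red p a ∧ chg a = c - 1 ∧
      X (Sum.inr i0) * SS m p k (mo K a) - β • SS m p 0 (mo K e) ∈ II K m p := by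
    intro e hg he hk
    refine ⟨e, e + xb i0, ((e (Sum.inr i0) + 1 : ℕ) : K), ?_, hg, ?_, ?_, ?_⟩
    · rw [Ne, CharP.cast_eq_zero_iff K p]
      intro hdvd
      have := Nat.le_of_dvd (by omega) hdvd
      omega
    · intro z
      have := hg.1 z
      rw [Finsupp.add_apply, xb, Finsupp.single_apply]
      split_ifs with hz
      · subst hz; omega
      · omega
    · rw [chg_add, hg.2.1, chg_xb]; ring
    · rw [SS_zero, SS_apply, mul_add, XFF e i0 he, add_sub_cancel_left]
      rcases hk with hk | hk
      · rw [hk]; simp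
      · rw [mul_smul_comm]
        apply Submodule.smul_of_tower_mem
        rw [mo, sw_monomial]
        apply XFF_II
        · simp [hk]
        · omega
  by_cases hc1 : c = 1
  · refine fin (xa i1) ⟨?_, by simp [hc1], Or.inl ⟨by omega, Or.inr fun i => by simp⟩⟩ (by simp; omega) (Or.inr (by simp [xa_inl, h01.symm]))
    intro z
    rw [xa, Finsupp.single_apply]
    split_ifs <;> omega
  · have hk0 : k = 0 := by tauto
    rcases lt_trichotomy c 0 with hc | hc | hc
    · obtain ⟨e, e1, e2, e3, e4⟩ := ex_purey (p := p) (-c).toNat i0 (by omega) (by omega)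
      exact fin e ⟨e1, by omega, Or.inl ⟨hc.ne, Or.inl e3⟩⟩ (by omega) (Or.inl hk0)
    · refine fin (xa i1 + xb i0) ⟨?_, by rw [chg_add]; simp [hc], Or.inr (Or.inr (Or.inr ⟨rfl, 0, i1, i0, h01.symm, by simp, by simp, by simp⟩))⟩
        (by simp [xb_inr]; omega) (Or.inl hk0)
      rintro (z | z)
      · simp only [Finsupp.add_apply, xa_inl, xb_inl]; split_ifs <;> omega
      · simp only [Finsupp.add_apply, xb_inr, xa_inr]; split_ifs <;> omega
    · obtain ⟨e, e1, e2, e3⟩ := ex_purex (p := p) (m := m) c.toNat (by omega)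
      exact fin e ⟨e1, by omega, Or.inl ⟨hc.ne', Or.inr e3⟩⟩ (by rw [e3]; omega) (Or.inl hk0)

lemma xdeg_SS (i0 : Fin m) (k : K) (e : ZZ m →₀ ℕ) (h1 : e (Sum.inl i0) ≤ p - 1) (h2 : e (Sum.inr i0) ≤ p - 1) :
    xdeg p i0 (SS m p k (mo K e)) := by
  intro e' he'
  rw [SS_apply, mo, sw_monomial, FF_monomial, FF_monomial, smul_monomial] at he'
  have := support_add he'
  rw [Finset.mem_union] at this
  rcases this with h | h
  · have := Finset.mem_singleton.mp (support_monomial_subset h)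
    subst this; simpa using h1
  · have := Finset.mem_singleton.mp (support_monomial_subset h)
    subst this; simpa using h2

/-- the lifted digit -/
lemma lift_j [hp : Fact p.Prime] [CharP K p] (hp3 : 3 ≤ p) (i0 : Fin m) (k : K) (e : ZZ m →₀ ℕ) (hr : red p e)
    (he0 : e (Sum.inl i0) = 0) (he1 : 1 ≤ e (Sum.inr i0)) :
    ∃ a : ZZ m →₀ ℕ, ∃ β : K, β ≠ 0 ∧ red p a ∧ chg a = chg e + p ∧
      ((p - 1).factorial : K)⁻¹ • (Qd (ee i0))^[p - 1] (SS m p k (mo K a)) =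
        X (Sum.inr i0) ^ p * (β • SS m p 0 (mo K e)) := by
  have hrb := hr (Sum.inr i0)
  have hfe : fac K e ≠ 0 := fac_ne_zero (p := p) fun i => hr _
  set a : ZZ m →₀ ℕ := e - xb i0 + (p - 1) • xa i0 with ha
  have hae : a + xb i0 = e + (p - 1) • xa i0 := by
    ext z
    rcases z with z | z
    · simp [ha]
    · by_cases hz : i0 = z
      · subst hz; simp [ha, xb_inr]; omega
      · simp [ha, xb_inr, hz]
  have hred : red p a := by
    rintro (z | z)
    · by_cases hz : i0 = z
      · subst hz; simp [ha, xa_inl, he0]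
      · have := hr (Sum.inl z); simpa [ha, xa_inl, hz] using this
    · have := hr (Sum.inr z); simp [ha]; omega
  have hchg : chg a = chg e + p := by
    have := congrArg chg hae
    have h2 : chg ((p - 1) • xa i0 : ZZ m →₀ ℕ) = ((p - 1 : ℕ) : ℤ) := by
      rw [xa, Finsupp.smul_single, smul_eq_mul, mul_one, chg_inl]
    rw [chg_add a (xb i0), chg_add e, chg_xb, h2] at this
    rw [Nat.cast_sub (by omega)] at this
    push_cast at this
    linarith
  have hfa : fac K a ≠ 0 := fac_ne_zero (p := p) fun i => hred _
  have hal : a (Sum.inl i0) = p - 1 := by simp [ha, xa_inl, he0]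
  have har : a (Sum.inr i0) = e (Sum.inr i0) - 1 := by simp [ha, xb_inr]
  refine ⟨a, fac K a / fac K e * (-1) ^ (p - 1), ?_, hred, hchg, ?_⟩
  · exact mul_ne_zero (div_ne_zero hfa hfe) (pow_ne_zero _ (by simp))
  · have hf0 : ((p - 1).factorial : K) ≠ 0 := by
      rw [Ne, fact_eq_zero (p := p)]; omega
    have hz : (Qd (ee i0))^[p - 1] (SS m p k (mo K a)) = (Qd (ee i0))^[p - 1] (monomial (bar p a) (fac K a)) := by
      rw [SS_apply, iter_add, mo, sw_monomial, FF_monomial, FF_monomial, smul_monomial, one_mul,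
        Qee_zero i0 (bar p (swE a)) _ (p - 1) (by simp [har]; omega), add_zero]
    rw [hz, Qee_iter, SS_zero, mo, FF_monomial, smul_monomial, smul_monomial, X_pow_eq_monomial, monomial_mul, bar_inl, hal,
      Nat.descFactorial_self]
    have hexp : bar p a - (p - 1) • xa i0 + (p - 1) • xb i0 = Finsupp.single (Sum.inr i0) p + bar p e := by
      ext z
      rcases z with z | z
      · by_cases hz : i0 = z
        · subst hz; simp [ha, xa_inl, he0]
        · simp [ha, xa_inl, hz]
      · by_cases hz : i0 = z
        · subst hz; simp [ha, xb_inr]; omega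
        · simp [ha, xb_inr, hz]
    rw [hexp]
    congr 1
    simp only [smul_eq_mul]
    field_simp

end digits

end RS

namespace RS

section claimC
open MvPolynomial
variable {K : Type} [Field K] {p t m d : ℕ} [NeZero t] {s : Fin t → ℤ} {eps : Finset (Fin t)}

/-- the lowering operator -/
def aop [Fintype K] (p : ℕ) (i : Fin m) (j : Fin t) : (VV K m → K) →ₗ[K] (VV K m → K) :=
  (xt (ee i) (p ^ (j : ℕ))) ∘ₗ (xt (ff i) (p ^ (j : ℕ))) ∘ₗ (xt (ee i) ((p - 1) * p ^ (j : ℕ))) -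
    xt (ee i) ((p - 1) * p ^ (j : ℕ))

lemma aop_apply [Fintype K] (i : Fin m) (j : Fin t) (f : VV K m → K) : aop p i j f =
    xt (ee i) (p ^ (j : ℕ)) (xt (ff i) (p ^ (j : ℕ)) (xt (ee i) ((p - 1) * p ^ (j : ℕ)) f)) -
    xt (ee i) ((p - 1) * p ^ (j : ℕ)) f := rfl

lemma aop_mem [Fintype K] {M : Submodule K (VV K m → K)} (hM : Stab M) (i : Fin m) (j : Fin t)
    {f : VV K m → K} (hf : f ∈ M) : aop p i j f ∈ M := by
  rw [aop_apply]
  exact M.sub_mem (xt_mem hM _ _ (xt_mem hM _ _ (xt_mem hM _ _ hf))) (xt_mem hM _ _ hf)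

/-- two steps -/
lemma ef_step [hp : Fact p.Prime] [CharP K p] [Fintype K] (hy : Hy K p t m d) {s' : Fin t → ℤ} {h : Fin t → PP K m}
    (hg : Gen p d s eps s' h) (i : Fin m) (j : Fin t) :
    xt (ee i) (p ^ (j : ℕ)) (xt (ff i) (p ^ (j : ℕ)) (fn p h)) -
      fn p (Function.update h j (Qd (ee i) (Qd (ff i) (h j)))) ∈ WW K p m d s eps (∑ l, s' l - 1) := by
  have h1 := xt_Qd hy hg (ff i) j
  have hg1 := hg.update (DD_Qd (ff i) (hg.2 j))
  have h2 := xt_Qd hy hg1 (ee i) j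
  rw [Function.update_self, Function.update_idem] at h2
  have h3 := xt_mem (WW_stab (s := s) (eps := eps) (d := d) (p := p) (∑ l, s' l - 1)) (ee i) (p ^ (j : ℕ)) h1
  rw [map_sub] at h3
  have := Submodule.add_mem _ h3 h2
  rwa [sub_add_sub_cancel] at this

lemma aop_WW [hp : Fact p.Prime] [CharP K p] [Fintype K] (hy : Hy K p t m d) (i : Fin m) (j : Fin t) (n : ℤ)
    {f : VV K m → K} (hf : f ∈ WW K p m d s eps n) : aop p i j f ∈ WW K p m d s eps (n - 1) := by
  suffices hs : WW K p m d s eps n ≤ (WW K p m d s eps (n - 1)).comap (aop p i j) from hs hf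
  rw [WW, Submodule.span_le]
  rintro f ⟨s', h, hg, hn, rfl⟩
  rw [SetLike.mem_coe, Submodule.mem_comap]
  have hp3 := hy.hp3
  apply WW_mono s eps (show ∑ l, s' l - 1 ≤ n - 1 by omega)
  have st := WW_stab (s := s) (eps := eps) (d := d) (p := p) (K := K) (m := m) (∑ l, s' l - 1)
  set W := WW K p m d s eps (∑ l, s' l - 1) with hW
  set h1 : PP K m := (((p - 1).factorial : K)⁻¹) • (Qd (ee i))^[p - 1] (h j) with hh1
  have e1 : xt (ee i) ((p - 1) * p ^ (j : ℕ)) (fn p h) - fn p (Function.update h j h1) ∈ W :=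
    xt_tay hy hg (ee i) j (p - 1) (by omega) le_rfl
  have hd1 : h1 ∈ DD m p (mode K p m d s eps s' j) (lamOfN p t d s' j) :=
    Submodule.smul_mem _ _ (DD_Qd_iter (ee i) (hg.2 j) (p - 1))
  have hg1 := hg.update hd1
  have e2 := ef_step hy hg1 i j
  rw [Function.update_self, Function.update_idem] at e2
  have e3 := xt_mem st (ee i) (p ^ (j : ℕ)) (xt_mem st (ff i) (p ^ (j : ℕ)) e1)
  rw [map_sub, map_sub] at e3
  have e4 := carry hy hg j (a := Qd (ee i) (Qd (ff i) h1) - h1)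
    ((DD_hom (DD_Qd (ee i) (DD_Qd (ff i) hd1))).sub (DD_hom hd1)) (by
      have := opII hp3 i (h j)
      rw [hh1, Derivation.map_smul, Derivation.map_smul, ← smul_sub]
      exact Submodule.smul_of_tower_mem _ _ this)
  rw [fn_sub] at e4
  rw [aop_apply]
  have := W.sub_mem (W.add_mem (W.add_mem e3 e2) e4) e1
  convert this using 1
  abel

/-- rescaling digits -/
lemma rescale [hp : Fact p.Prime] [CharP K p] [Fintype K] (hy : Hy K p t m d) {s' : Fin t → ℤ}
    {M : Submodule K (VV K m → K)} (hW : WW K p m d s eps (∑ i, s' i - 1) ≤ M)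
    {G H : Fin t → PP K m} (hG : Gen p d s eps s' G) (hH : Gen p d s eps s' H)
    (h : ∀ i, ∃ c : K, c ≠ 0 ∧ G i - c • H i ∈ II K m p) (hM : fn p G ∈ M) : fn p H ∈ M := by
  choose c hc hI using h
  have hg2 : Gen p d s eps s' (fun i => c i • H i) := ⟨hH.1, fun i => Submodule.smul_mem _ _ (hH.2 i)⟩
  have h1 := M.sub_mem hM (hW (fn_congr hy hG hg2 hI))
  rw [sub_sub_cancel] at h1
  have h2 : fn p (fun i => c i • H i) = (∏ i, (c i) ^ (p ^ (i : ℕ))) • fn p H := by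
    funext v
    simp only [fn, ev_smul, mul_pow, Finset.prod_mul_distrib, Pi.smul_apply, smul_eq_mul]
  rw [h2] at h1
  exact (M.smul_mem_iff (Finset.prod_ne_zero_iff.mpr fun i _ => pow_ne_zero _ (hc i))).mp h1

lemma QeQf (i : Fin m) (e : ZZ m →₀ ℕ) (c : K) (he : e (Sum.inl i) = 0) :
    Qd (ee i) (Qd (ff i) (monomial e c)) = (-(e (Sum.inr i) : K)) • monomial e c := by
  rw [Qff_mon, Qee_mon]
  by_cases h : e (Sum.inr i) = 0
  · simp [h]
  · have : e - xb i + xa i - xa i + xb i = e := by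
      ext z
      rcases z with z | z
      · simp
      · by_cases hz : i = z
        · subst hz; simp [xb_inr]; omega
        · simp [xb_inr, hz]
    rw [this, smul_monomial]
    congr 1
    simp [he, xa_inl]
    ring

/-- the main step -/
lemma claim_step [hp : Fact p.Prime] [CharP K p] [Fintype K] (hy : Hy K p t m d)
    {M : Submodule K (VV K m → K)} {s'' : Fin t → ℤ}
    (hW : WW K p m d s eps (∑ i, s'' i - 1) ≤ M) (hM : Stab M) (hadm : Adm p d s s'')
    (hl : ∀ i, lamOf p t d s'' i ≤ 2 * m * ((p : ℤ) - 1)) (j : Fin t) (hs' : Hc p t m d (bump s'' (j + 1) 1))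
    (hlt : s'' (j + 1) < s (j + 1))
    (hF : ∀ h : Fin t → PP K m, Gen p d s eps (bump s'' (j + 1) 1) h → ∀ i0, aop p i0 j (fn p h) ∈ M)
    {h : Fin t → PP K m} (hg : Gen p d s eps s'' h) : fn p h ∈ M := by
  have hp3 := hy.hp3
  have hne := succ_ne hy.ht j
  have hm := hy.hm
  let i0 : Fin m := ⟨0, by omega⟩
  let i1 : Fin m := ⟨1, by omega⟩
  have h01 : i0 ≠ i1 := by intro h; simp [i0, i1] at h
  set s' := bump s'' (j + 1) 1 with hs'def
  set κ : Fin t → K := mode K p m d s eps s'' with hκdef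
  set κ' : Fin t → K := mode K p m d s eps s' with hκ'def
  have hlc : ∀ i, (lamOfN p t d s'' i : ℤ) = lamOf p t d s'' i := fun i => Int.toNat_of_nonneg (hadm.lam i)
  have hlc' : ∀ i, (lamOfN p t d s' i : ℤ) = lamOf p t d s' i := fun i => Int.toNat_of_nonneg (hs'.2 i).1
  have hval : ∀ s1 i, mode K p m d s eps s1 i = 0 ∨ mode K p m d s eps s1 i = 1 ∨ mode K p m d s eps s1 i = -1 := by
    intro s1 i
    rw [mode]; split_ifs <;> simp
  have hκ : Kap p m d s eps s'' κ := ⟨hadm, hval s'', fun i => mode_hk s eps i (hadm.lam i), fun i => Or.inr rfl⟩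
  have hadm' : Adm p d s s' := by
    refine ⟨fun i => ?_, fun i => (hs'.1 i).1, fun i => (hs'.2 i).1⟩
    by_cases hi : i = j + 1
    · subst hi; rw [hs'def, bump_same]; omega
    · rw [hs'def, bump_ne _ hi]; exact hadm.le i
  have hk0 : κ j = 0 := mode_of_ne _ _ _ _ (Or.inr hlt.ne)
  have hk1 : κ (j + 1) = 0 := mode_of_ne _ _ _ _ (Or.inl hlt.ne)
  have hkk : ∀ i, i ≠ j → i ≠ j + 1 → κ' i = κ i := by
    intro i h1 h2
    exact mode_congr s eps (bump_ne _ h2 _) (bump_ne _ (fun hh => h1 (add_right_cancel hh)) _)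
  have hc' : ∀ i, κ' i = 0 ∨ cc p t m d s' i = 0 := fun i => mode_hk s eps i (hs'.2 i).1
  have hlj : lamOf p t d s' j = lamOf p t d s'' j + p := by
    rw [hs'def, lam_bump_same hy.ht]; ring
  have hlj1 : lamOf p t d s' (j + 1) = lamOf p t d s'' (j + 1) - 1 := by
    rw [hs'def, lam_bump_succ hy.ht]
  have hli : ∀ i, i ≠ j → i ≠ j + 1 → lamOf p t d s' i = lamOf p t d s'' i := by
    intro i h1 h2
    rw [hs'def, lam_bump_ne _ h1 h2]
  have hmm : (2 : ℤ) * m * ((p : ℤ) - 1) = m * ((p : ℤ) - 1) + m * ((p : ℤ) - 1) := by ring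
  -- the digits
  obtain ⟨ej, gj, ej0, ej1⟩ := dig_j (K := K) hp3 i0 i1 h01 (cc p t m d s'' j)
    (by rw [cc, hlc]; have := hadm.lam j; omega)
    (by rw [cc, hlc]; have := (hs'.2 j).2; omega)
  obtain ⟨aj, βj, hβj, raj, caj, hQj⟩ := lift_j hp3 i0 (κ' j) ej gj.1 ej0 ej1
  obtain ⟨ek, ak, βk, hβk, gk, rak, cak, hXk⟩ := dig_j1 hp3 i0 i1 h01 (κ' (j + 1)) (cc p t m d s'' (j + 1))
    (by
      rcases hc' (j + 1) with h | h
      · exact Or.inl h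
      · right; rw [cc, hlc', hlj1] at h; rw [cc, hlc]; omega)
    (by rw [cc, hlc]; have := (hs'.2 (j + 1)).1; omega)
    (by rw [cc, hlc]; have := hl (j + 1); omega)
  have hex : ∀ i, ∃ e : ZZ m →₀ ℕ, Gn p (κ i) (cc p t m d s'' i) e := by
    intro i
    refine dig_gen hp3 i0 i1 h01 _ _ ?_ (by rw [cc, hlc]; have := hadm.lam i; omega)
      (by rw [cc, hlc]; have := hl i; omega)
    rcases hκ.c0 i with h | h
    · exact Or.inl h
    · rcases hval s'' i with h2 | h2
      · exact Or.inl h2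
      · exact Or.inr ⟨h2, h⟩
  choose e1 he1 using hex
  let e0 : Fin t → (ZZ m →₀ ℕ) := Function.update (Function.update e1 j ej) (j + 1) ek
  have e0j : e0 j = ej := by simp [e0, Function.update_of_ne hne.symm]
  have e0k : e0 (j + 1) = ek := by simp [e0]
  have e0i : ∀ i, i ≠ j → i ≠ j + 1 → e0 i = e1 i := by
    intro i h1 h2
    simp [e0, Function.update_of_ne h1, Function.update_of_ne h2]
  have hGn : ∀ i, Gn p (κ i) (cc p t m d s'' i) (e0 i) := by
    intro i
    by_cases h1 : i = j
    · subst h1; rw [e0j, hk0]; exact gj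
    · by_cases h2 : i = j + 1
      · subst h2; rw [e0k, hk1]; exact gk
      · rw [e0i i h1 h2]; exact he1 i
  let a0 : Fin t → (ZZ m →₀ ℕ) := Function.update (Function.update e0 j aj) (j + 1) ak
  have a0j : a0 j = aj := by simp [a0, Function.update_of_ne hne.symm]
  have a0k : a0 (j + 1) = ak := by simp [a0]
  have a0i : ∀ i, i ≠ j → i ≠ j + 1 → a0 i = e0 i := by
    intro i h1 h2
    simp [a0, Function.update_of_ne h1, Function.update_of_ne h2]
  have ra0 : ∀ i, red p (a0 i) := by
    intro i
    by_cases h1 : i = j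
    · subst h1; rw [a0j]; exact raj
    · by_cases h2 : i = j + 1
      · subst h2; rw [a0k]; exact rak
      · rw [a0i i h1 h2]; exact (hGn i).1
  have ca0 : ∀ i, chg (a0 i) = cc p t m d s' i := by
    intro i
    by_cases h1 : i = j
    · subst h1; rw [a0j, caj, gj.2.1, cc, cc, hlc, hlc', hlj]; ring
    · by_cases h2 : i = j + 1
      · subst h2; rw [a0k, cak, cc, cc, hlc, hlc', hlj1]; ring
      · rw [a0i i h1 h2, (hGn i).2.1, cc, cc, hlc, hlc', hli i h1 h2]
  -- the element
  let H : Fin t → PP K m := fun i => SS m p (κ' i) (mo K (a0 i))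
  have hH : Gen p d s eps s' H := ⟨hadm', fun i => SS_DD (hc' i) (mon_mem_CH _ (ca0 i))⟩
  have hx : ∀ i, xdeg p i0 (H i) := fun i => xdeg_SS i0 _ _ (ra0 i _) (ra0 i _)
  let g : PP K m := βj • SS m p 0 (mo K ej)
  let G : Fin t → PP K m := Function.update (Function.update H j g) (j + 1) (X (Sum.inr i0) * H (j + 1))
  have hGj : G j = g := by simp [G, Function.update_of_ne hne.symm]
  have hGk : G (j + 1) = X (Sum.inr i0) * H (j + 1) := by simp [G]
  have hGi : ∀ i, i ≠ j → i ≠ j + 1 → G i = H i := by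
    intro i h1 h2
    simp [G, Function.update_of_ne h1, Function.update_of_ne h2]
  have hE : xt (ee i0) ((p - 1) * p ^ (j : ℕ)) (fn p H) = fn p G := by
    rw [xt_exact hy i0 hx j (p - 1) (by omega) le_rfl]
    have : H j = SS m p (κ' j) (mo K aj) := by simp only [H, a0j]
    rw [this, hQj, fn_carry hy]
  have hSF : Gen p d s eps s'' (SF p κ fun i => mo K (e0 i)) :=
    (SF_GK hκ fun i => mon_mem_CH _ (hGn i).2.1).gen hκ
  have hGG : Gen p d s eps s'' G := by
    refine ⟨hadm, fun i => ?_⟩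
    by_cases h1 : i = j
    · subst h1
      rw [hGj]
      have := hSF.2 i
      simp only [SF, e0j, hk0] at this
      exact Submodule.smul_mem _ _ this
    · by_cases h2 : i = j + 1
      · subst h2
        rw [hGk]
        have e1 : mode K p m d s eps s'' (j + 1) = 0 := hk1
        rw [e1]
        apply DD_zero
        have := (isHomogeneous_X K (Sum.inr i0 : ZZ m)).mul (DD_hom (hH.2 (j + 1)))
        convert this using 1
        have h5 := hlc' (j + 1)
        have h6 := hlc (j + 1)
        omega
      · rw [hGi i h1 h2]
        have := hSF.2 i
        simp only [SF] at this
        simp only [H, hkk i h1 h2, a0i i h1 h2]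
        exact this
  have hfg := hF H hH i0
  rw [aop_apply, hE] at hfg
  have h3 := M.sub_mem hfg (hW (ef_step hy hGG i0 j))
  have h4 : Qd (ee i0) (Qd (ff i0) (G j)) = (-((bar p ej (Sum.inr i0) : ℕ) : K)) • G j := by
    rw [hGj]
    simp only [g]
    rw [SS_zero, mo, FF_monomial, smul_monomial, QeQf]
    simpa using ej0
  rw [h4, fn_smul, Function.update_eq_self] at h3
  have h5 : (-((bar p ej (Sum.inr i0) : ℕ) : K)) = ((ej (Sum.inr i0) + 1 : ℕ) : K) := by
    have hr := gj.1 (Sum.inr i0)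
    rw [bar_inr, neg_eq_iff_add_eq_zero, ← Nat.cast_add]
    have : p - 1 - ej (Sum.inr i0) + (ej (Sum.inr i0) + 1) = p := by omega
    rw [this, CharP.cast_eq_zero]
  rw [h5, natCast_pow] at h3
  have h6 : ((ej (Sum.inr i0) : ℕ) : K) • fn p G ∈ M := by
    convert h3 using 1
    push_cast
    rw [add_smul, one_smul]
    abel
  have h7 : ((ej (Sum.inr i0) : ℕ) : K) ≠ 0 := by
    rw [Ne, CharP.cast_eq_zero_iff K p]
    intro hdvd
    have := Nat.le_of_dvd (by omega) hdvd
    have := gj.1 (Sum.inr i0)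
    omega
  have h8 := (M.smul_mem_iff h7).mp h6
  have h9 := rescale hy hW hGG hSF (by
    intro i
    by_cases h1 : i = j
    · subst h1
      refine ⟨βj, hβj, ?_⟩
      rw [hGj]; simp only [SF, e0j, hk0, g, sub_self]; exact Submodule.zero_mem _
    · by_cases h2 : i = j + 1
      · subst h2
        refine ⟨βk, hβk, ?_⟩
        rw [hGk]; simp only [SF, e0k, hk1, H, a0k]; exact hXk
      · refine ⟨1, one_ne_zero, ?_⟩
        rw [hGi i h1 h2]; simp only [SF, H, hkk i h1 h2, a0i i h1 h2, one_smul, sub_self]; exact Submodule.zero_mem _) h8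
  exact phase2 hy hκ hM hW e0 hGn h9 hg.2

lemma big_II (hp3 : 3 ≤ p) {h : PP K m} {n : ℕ} (hh : h.IsHomogeneous n) (hn : 2 * m * ((p : ℤ) - 1) < n) :
    h ∈ II K m p := by
  rw [mem_II]
  intro e he
  by_contra hc
  push Not at hc
  have hdeg : e.degree = n := by
    have := hh (mem_support_iff.mp he)
    rw [← this, Finsupp.degree_eq_weight_one]; rfl
  have h1 : e.degree ≤ ∑ z : ZZ m, (p - 1) := by
    rw [Finsupp.degree_eq_sum]
    exact Finset.sum_le_sum fun z _ => by have := hc z; omega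
  simp at h1
  have h4 : ((e.degree : ℕ) : ℤ) ≤ (((m + m) * (p - 1) : ℕ) : ℤ) := by exact_mod_cast h1
  rw [Nat.cast_mul, Nat.cast_sub (by omega)] at h4
  push_cast at h4
  rw [hdeg] at h4
  linarith

lemma claimC [hp : Fact p.Prime] [CharP K p] [Fintype K] (hy : Hy K p t m d) (hs : Hc p t m d s)
    {N : Submodule K (VV K m → K)} (hN : Stab N) {n : ℤ} (hn : n ≤ ∑ j, s j)
    (hW : WW K p m d s eps n ≤ N ⊔ WW K p m d s eps (n - 1)) :
    WW K p m d s eps (n - 1) ≤ N ⊔ WW K p m d s eps (n - 2) := by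
  have hM : Stab (N ⊔ WW K p m d s eps (n - 2)) := by
    intro u c f hf
    obtain ⟨x, hx, y, hy', rfl⟩ := Submodule.mem_sup.mp hf
    exact Submodule.add_mem_sup (hN u c x hx) (WW_stab _ u c y hy')
  conv_lhs => rw [WW]
  rw [Submodule.span_le]
  rintro f ⟨s'', h, hg, hsum, rfl⟩
  rw [SetLike.mem_coe]
  by_cases hlow : ∑ j, s'' j ≤ n - 2
  · exact le_sup_right (a := N) (fn_mem_WW hg hlow)
  have hsum' : ∑ j, s'' j = n - 1 := by omega
  by_cases hl : ∀ i, lamOf p t d s'' i ≤ 2 * m * ((p : ℤ) - 1)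
  · have hle := hg.1.le
    have hH : Hc p t m d s'' := ⟨fun i => ⟨hg.1.lo i, (hle i).trans (hs.1 i).2⟩, fun i => ⟨hg.1.lam i, hl i⟩⟩
    have hne : s'' ≠ s := by rintro rfl; omega
    obtain ⟨j, hj, hlt⟩ := up_cover hy.hp3 hy.ht hy.hm hy.hd hH hs hle hne
    refine claim_step hy ?_ hM hg.1 hl j hj hlt ?_ hg
    · rw [hsum']; exact (WW_mono s eps (by omega)).trans le_sup_right
    · intro h' hg' i0
      have hm : fn p h' ∈ WW K p m d s eps n := fn_mem_WW hg' (by rw [bump_sum]; omega)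
      obtain ⟨x, hx, y, hy', hxy⟩ := Submodule.mem_sup.mp (hW hm)
      rw [← hxy, map_add]
      refine Submodule.add_mem_sup (aop_mem hN i0 j hx) ?_
      have := aop_WW hy i0 j (n - 1) hy'
      rwa [show n - 1 - 1 = n - 2 by ring] at this
  · push Not at hl
    obtain ⟨i, hi⟩ := hl
    apply le_sup_right (a := N)
    have := carry hy hg i (a := h i) (DD_hom (hg.2 i)) (big_II hy.hp3 (DD_hom (hg.2 i)) (by
      rw [lamOfN, Int.toNat_of_nonneg (hg.1.lam i)]; exact hi))
    rw [Function.update_eq_self, hsum'] at this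
    rwa [show n - 1 - 1 = n - 2 by ring] at this

end claimC

end RS

namespace RS

section digitA
open MvPolynomial
lemma ev_fadd {K : Type} [Field K] {m : ℕ} (a b : PP K m) :
    (ev (a + b) : VV K m → K) = ev a + ev b := by
  funext v; rw [Pi.add_apply]; simp [ev]
lemma ev_fsmul {K : Type} [Field K] {m : ℕ} (c : K) (b : PP K m) :
    (ev (c • b) : VV K m → K) = c • ev b := by
  funext v; rw [Pi.smul_apply]; simp [ev, smul_eval]
end digitA

section digitB
open MvPolynomial
variable {p t m d : ℕ} [hp : Fact p.Prime]

lemma wilson_cast {K : Type} [Field K] [CharP K p] (a : ℕ) (ha : a ≤ p - 1) :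
    ((a.factorial : K) * ((p - 1 - a).factorial : K)) = (-1) ^ (a + 1) := by
  have hp1 := hp.out.one_lt
  induction a with
  | zero =>
    have h : (((p - 1).factorial : ℕ) : ZMod p) = -1 := ZMod.wilsons_lemma p
    have h2 : (((p - 1).factorial + 1 : ℕ) : ZMod p) = 0 := by push_cast; rw [h]; ring
    rw [CharP.cast_eq_zero_iff (ZMod p) p] at h2
    have h3 : (((p - 1).factorial + 1 : ℕ) : K) = 0 := (CharP.cast_eq_zero_iff K p _).mpr h2
    push_cast at h3
    simp
    exact eq_neg_of_add_eq_zero_left h3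
  | succ a ih =>
    have h1 := ih (by omega)
    have e1 : p - 1 - a = (p - 1 - (a + 1)) + 1 := by omega
    have e2 : ((p - 1 - (a + 1) + 1 : ℕ) : K) = -((a : K) + 1) := by
      rw [eq_neg_iff_add_eq_zero, ← Nat.cast_succ, ← Nat.cast_add]
      have : p - 1 - (a + 1) + 1 + a.succ = p := by omega
      rw [this, CharP.cast_eq_zero]
    rw [e1, Nat.factorial_succ, Nat.cast_mul, e2] at h1
    rw [Nat.factorial_succ, Nat.cast_mul, pow_succ, ← h1]
    push_cast
    ring

lemma ev_mon (e : ZZ m →₀ ℕ) (c : GaloisField p t) :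
    (ev (monomial e c) : SympV p t m → GaloisField p t) = c • mono (fun i => e (Sum.inl i)) (fun i => e (Sum.inr i)) := by
  funext v
  rw [ev, eval_monomial, Pi.smul_apply, smul_eq_mul, mono, Finset.prod_mul_distrib,
    Finsupp.prod_fintype _ _ (fun i => by simp), Fintype.prod_sum_type]
  rfl

/-- exponents on the Fourier side -/
lemma ev_SS (k : GaloisField p t) (α β : Fin m → ℕ) (hβ : ∀ i, β i ≤ p - 1) :
    (ev (SS m p k (mo (GaloisField p t) (mkE α (abar p β)))) : SympV p t m → GaloisField p t) =
      factk p t (abar p β) • (mono α β + (k * ((-1) ^ ((∑ i, β i) + m) * factk p t α * factk p t β)) •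
            mono (abar p β) (abar p α)) := by
  have hw : factk p t (abar p β) * factk p t β = (-1) ^ ((∑ i, β i) + m) := by
    rw [factk, factk, ← Finset.prod_mul_distrib]
    have : ∀ i ∈ (Finset.univ : Finset (Fin m)), ((abar p β i).factorial : GaloisField p t) * ((β i).factorial : GaloisField p t) = (-1) ^ (β i + 1) := by
      intro i _
      rw [mul_comm, abar, wilson_cast _ (hβ i)]
    rw [Finset.prod_congr rfl this, Finset.prod_pow_eq_pow_sum, Finset.sum_add_distrib]
    simp
  rw [SS_apply, mo, sw_monomial, FF_monomial, FF_monomial, smul_monomial, ev_fadd, ev_mon, ev_mon]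
  have f1 : fac (GaloisField p t) (mkE α (abar p β)) = factk p t (abar p β) := rfl
  have f2 : fac (GaloisField p t) (swE (mkE α (abar p β))) = factk p t α := by
    simp [fac, factk]
  have f3 : (fun i => bar p (mkE α (abar p β)) (Sum.inr i)) = β := by
    funext i
    have := hβ i
    simp [abar]; omega
  have f4 : (fun i => bar p (mkE α (abar p β)) (Sum.inl i)) = α := rfl
  have f5 : (fun i => bar p (swE (mkE α (abar p β))) (Sum.inl i)) = abar p β := by
    funext i; simp
  have f6 : (fun i => bar p (swE (mkE α (abar p β))) (Sum.inr i)) = abar p α := by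
    funext i; simp [abar]
  rw [f1, f2, f3, f4, f5, f6, one_mul, smul_add, smul_smul]
  congr 2
  have hsq : ((-1 : GaloisField p t) ^ ((∑ i, β i) + m)) * (-1) ^ ((∑ i, β i) + m) = 1 := by
    rw [← mul_pow]; simp
  rw [smul_eq_mul, one_mul]
  calc k * factk p t α = k * factk p t α * ((-1 : GaloisField p t) ^ ((∑ i, β i) + m) * (-1) ^ ((∑ i, β i) + m)) := by
        rw [hsq, mul_one]
    _ = k * factk p t α * ((-1 : GaloisField p t) ^ ((∑ i, β i) + m) * (factk p t (abar p β) * factk p t β)) := by rw [hw]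
    _ = _ := by ring

/-- mode of a digit -/
def kk (p t m lam : ℕ) [Fact p.Prime] (pl : Prop) : GaloisField p t :=
  if lam = m * (p - 1) then (if pl then 1 else -1) else 0

lemma kk_hk (hp3 : 3 ≤ p) (lam : ℕ) (pl : Prop) : kk p t m lam pl = 0 ∨ (lam : ℤ) - m * ((p : ℤ) - 1) = 0 := by
  by_cases h : lam = m * (p - 1)
  · right; rw [h, Nat.cast_mul, Nat.cast_sub (by omega)]; simp
  · left; rw [kk, if_neg h]

lemma chg_mk (α β : Fin m → ℕ) (hβ : ∀ i, β i ≤ p - 1) :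
    chg (mkE α (abar p β)) = ((∑ i, α i + ∑ i, β i : ℕ) : ℤ) - m * ((p : ℤ) - 1) := by
  rw [chg]
  have : ∀ i ∈ (Finset.univ : Finset (Fin m)), ((abar p β i : ℕ) : ℤ) = ((p : ℤ) - 1) - β i := by
    intro i _
    have := hβ i
    have := hp.out.pos
    rw [abar]; omega
  simp only [mkE_inl, mkE_inr]
  rw [Finset.sum_congr rfl this, Finset.sum_sub_distrib]
  simp
  ring

lemma factk_ne (α : Fin m → ℕ) (h : ∀ i, α i ≤ p - 1) : factk p t α ≠ 0 :=
  fac_ne_zero (p := p) (e := mkE 0 α) h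

lemma abar_abar (α : Fin m → ℕ) (h : ∀ i, α i ≤ p - 1) : abar p (abar p α) = α := by
  funext i; have := h i; simp only [abar]; omega

/-- the self-paired monomials -/
lemma ev_SS_self (k : GaloisField p t) (α : Fin m → ℕ) (h : ∀ i, α i ≤ p - 1) :
    (ev (SS m p k (mo (GaloisField p t) (mkE α α))) : SympV p t m → GaloisField p t) =
      ((1 + k) * factk p t α) • mono α (abar p α) := by
  have h2 : swE (mkE α α) = mkE α α := by
    ext z; rcases z with z | z <;> simp
  rw [SS_apply, mo, sw_monomial, h2, FF_monomial, smul_monomial, ev_fadd, ev_mon, ev_mon, ← add_smul]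
  have f1 : fac (GaloisField p t) (mkE α α) = factk p t α := rfl
  have f3 : (fun i => bar p (mkE α α) (Sum.inr i)) = abar p α := rfl
  have f4 : (fun i => bar p (mkE α α) (Sum.inl i)) = α := rfl
  rw [f1, f3, f4, smul_eq_mul]
  congr 1
  ring

lemma digit_DD (hp3 : 3 ≤ p) {lam : ℕ} {pl : Prop} {g : SympV p t m → GaloisField p t} (hg : IsDigit p t m lam pl g) :
    ∃ h ∈ DD m p (kk p t m lam pl) lam, (ev h : SympV p t m → GaloisField p t) = g := by
  have main : ∀ α β : Fin m → ℕ, (∀ i, β i ≤ p - 1) → ∑ i, α i + ∑ i, β i = lam →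
      g = mono α β + (kk p t m lam pl * ((-1) ^ ((∑ i, β i) + m) * factk p t α * factk p t β)) • mono (abar p β) (abar p α) →
      ∃ h ∈ DD m p (kk p t m lam pl) lam, (ev h : SympV p t m → GaloisField p t) = g := by
    intro α β hβ hsum hgg
    refine ⟨(factk p t (abar p β))⁻¹ • SS m p (kk p t m lam pl) (mo _ (mkE α (abar p β))), Submodule.smul_mem _ _ (SS_DD (kk_hk hp3 _ _)
      (mon_mem_CH _ (by rw [chg_mk α β hβ, hsum]))), ?_⟩
    rw [ev_fsmul, ev_SS _ _ _ hβ, hgg, smul_smul, inv_mul_cancel₀, one_smul]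
    exact factk_ne _ fun i => by simp [abar]
  rcases hg with ⟨h1, h2, α, β, hα, hβ, hsum, rfl⟩ | ⟨h1, h2, α, hα, rfl⟩ | ⟨h1, α, β, hα, hβ, hsum, hne, rfl⟩
  · refine main α β hβ hsum ?_
    rw [kk, if_neg h1, zero_mul, zero_smul, add_zero]
  · have hk : kk p t m lam pl = 1 := by rw [kk, if_pos h1, if_pos h2]
    refine ⟨((1 + 1) * factk p t α)⁻¹ • SS m p (kk p t m lam pl) (mo _ (mkE α α)), Submodule.smul_mem _ _ (SS_DD (kk_hk hp3 _ _)
      (mon_mem_CH _ ?_)), ?_⟩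
    · rw [h1, Nat.cast_mul, Nat.cast_sub (by omega)]; simp [chg]
    · rw [hk, ev_fsmul, ev_SS_self _ _ hα, smul_smul, inv_mul_cancel₀, one_smul]
      refine mul_ne_zero ?_ (factk_ne _ hα)
      rw [one_add_one_eq_two]
      exact two_ne (p := p) hp3
  · refine main α β hβ (by rw [hsum, h1]) ?_
    have hk : kk p t m lam pl = if pl then 1 else -1 := by rw [kk, if_pos h1]
    rw [hk]

lemma DD_digit (hp3 : 3 ≤ p) {lam : ℕ} {pl : Prop} (hpl : lam ≠ m * (p - 1) → ¬ pl) {e : ZZ m →₀ ℕ} (hr : red p e)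
    (hc : chg e = (lam : ℤ) - m * ((p : ℤ) - 1)) :
    (ev (SS m p (kk p t m lam pl) (mo _ e)) : SympV p t m → GaloisField p t) = 0 ∨
    ∃ c : GaloisField p t, ∃ g, IsDigit p t m lam pl g ∧
      (ev (SS m p (kk p t m lam pl) (mo _ e)) : SympV p t m → GaloisField p t) = c • g := by
  set α : Fin m → ℕ := fun i => e (Sum.inl i) with hα
  set β : Fin m → ℕ := abar p (fun i => e (Sum.inr i)) with hβ
  have hαr : ∀ i, α i ≤ p - 1 := fun i => hr _
  have hβr : ∀ i, β i ≤ p - 1 := fun i => by simp [hβ, abar]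
  have hbb : abar p β = fun i => e (Sum.inr i) := abar_abar _ fun i => hr _
  have he : e = mkE α (abar p β) := by
    rw [hbb]; ext z; rcases z with z | z <;> rfl
  have hsum : ∑ i, α i + ∑ i, β i = lam := by
    have := chg_mk α β hβr
    rw [← he, hc] at this
    have h2 : ((∑ i, α i + ∑ i, β i : ℕ) : ℤ) = lam := by linarith
    exact_mod_cast h2
  by_cases h1 : lam = m * (p - 1)
  · by_cases hne : β = abar p α
    · have hself : e = mkE α α := by
        conv_lhs => rw [he, hne, abar_abar _ hαr]
      rw [hself, ev_SS_self _ _ hαr]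
      by_cases h2 : pl
      · right
        exact ⟨_, _, Or.inr (Or.inl ⟨h1, h2, α, hαr, rfl⟩), rfl⟩
      · left
        rw [kk, if_pos h1, if_neg h2]; simp
    · right
      rw [he, ev_SS _ _ _ hβr]
      refine ⟨factk p t (abar p β), _, Or.inr (Or.inr ⟨h1, α, β, hαr, hβr, hsum.trans h1, hne, rfl⟩), ?_⟩
      have hk : kk p t m lam pl = if pl then 1 else -1 := by rw [kk, if_pos h1]
      rw [hk]
  · right
    rw [he, ev_SS _ _ _ hβr]
    refine ⟨factk p t (abar p β), _, Or.inl ⟨h1, hpl h1, α, β, hαr, hβr, hsum, rfl⟩, ?_⟩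
    rw [kk, if_neg h1, zero_mul, zero_smul, add_zero]

end digitB

end RS

namespace RS

section goodgen
open MvPolynomial
variable {K : Type} [Field K] {p t m d : ℕ} [NeZero t] {s : Fin t → ℤ} {eps : Finset (Fin t)} [hp : Fact p.Prime] [CharP K p]

/-- full sign condition -/
def Full (K : Type) [Field K] (c : ℤ) (k : K) : Prop :=
  (k = 0 ∧ c ≠ 0) ∨ (k = 1 ∧ c = 0) ∨ (k = -1 ∧ c = 0)

lemma Full.hk {c : ℤ} {k : K} (h : Full K c k) : k = 0 ∨ c = 0 := by
  rcases h with h | h | h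
  · exact Or.inl h.1
  · exact Or.inr h.2
  · exact Or.inr h.2

/-- fine generators of the digit spaces -/
def XX (K : Type) [Field K] (m p n : ℕ) (c : ℤ) (md : K) : Set (PP K m) :=
  {x | (∃ e : ZZ m →₀ ℕ, ∃ k : K, red p e ∧ chg e = c ∧ Full K c k ∧ (md = 0 ∨ md = k) ∧ x = SS m p k (mo K e)) ∨
    (x.IsHomogeneous n ∧ x ∈ II K m p)}

lemma DD_le_XX (hp3 : 3 ≤ p) {n : ℕ} {md : K} (hk : md = 0 ∨ (n : ℤ) - m * ((p : ℤ) - 1) = 0)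
    (hmd : md = 0 ∨ md = 1 ∨ md = -1) :
    DD m p md n ≤ Submodule.span K (XX K m p n ((n : ℤ) - m * ((p : ℤ) - 1)) md) := by
  refine (DD_le_span hk).trans (Submodule.span_le.mpr ?_)
  rintro x (⟨e, hr, hc, rfl⟩ | hx)
  · by_cases h0 : (n : ℤ) - m * ((p : ℤ) - 1) = 0
    · rcases hmd with h | h | h
      · have key : ∀ k : K, (k = 1 ∨ k = -1) → SS m p k (mo K e) ∈ Submodule.span K (XX K m p n ((n : ℤ) - m * ((p : ℤ) - 1)) md) := by
          intro k hk'
          refine Submodule.subset_span (Or.inl ⟨e, k, hr, hc, Or.inr ?_, Or.inl h, rfl⟩)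
          rcases hk' with h | h
          · exact Or.inl ⟨h, h0⟩
          · exact Or.inr ⟨h, h0⟩
        have h2 : (2 : K) ≠ 0 := two_ne (p := p) hp3
        have : SS m p md (monomial e (1 : K)) = (2 : K)⁻¹ • (SS m p 1 (mo K e) + SS m p (-1) (mo K e)) := by
          rw [h, SS_apply, SS_apply, SS_apply, mo, one_smul, neg_one_smul, zero_smul, add_zero, add_add_add_comm, add_neg_cancel, add_zero,
            ← two_smul K, smul_smul, inv_mul_cancel₀ h2, one_smul]
        rw [this]
        exact Submodule.smul_mem _ _ (Submodule.add_mem _ (key _ (Or.inl rfl)) (key _ (Or.inr rfl)))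
      · exact Submodule.subset_span (Or.inl ⟨e, md, hr, hc, Or.inr (Or.inl ⟨h, h0⟩), Or.inr rfl, rfl⟩)
      · exact Submodule.subset_span (Or.inl ⟨e, md, hr, hc, Or.inr (Or.inr ⟨h, h0⟩), Or.inr rfl, rfl⟩)
    · have h : md = 0 := hk.resolve_right h0
      exact Submodule.subset_span (Or.inl ⟨e, md, hr, hc, Or.inl ⟨h, h0⟩, Or.inr rfl, rfl⟩)
  · exact Submodule.subset_span (Or.inr hx)

lemma mode_val (s : Fin t → ℤ) (eps : Finset (Fin t)) (s' : Fin t → ℤ) (j : Fin t) :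
    mode K p m d s eps s' j = 0 ∨ mode K p m d s eps s' j = 1 ∨ mode K p m d s eps s' j = -1 := by
  unfold mode; split_ifs <;> simp

lemma XX_DD {n : ℕ} {md : K} {x : PP K m} (hx : x ∈ XX K m p n ((n : ℤ) - m * ((p : ℤ) - 1)) md) : x ∈ DD m p md n := by
  rcases hx with ⟨e, k, hr, hc, hf, hmd, rfl⟩ | hx
  · have h1 : SS m p k (mo K e) ∈ DD m p k n := SS_DD hf.hk (mon_mem_CH _ hc)
    rcases hmd with rfl | rfl
    · exact DD_zero (DD_hom h1)
    · exact h1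
  · exact DD_of_II hx.1 hx.2

variable [Fintype K]

lemma WW_le_good (hy : Hy K p t m d) (hs : Hc p t m d s) {M : Submodule K (VV K m → K)} {n : ℤ}
    (H : ∀ (s' : Fin t → ℤ) (κ : Fin t → K), Hc p t m d s' → Kap p m d s eps s' κ →
      (∀ j, Full K (cc p t m d s' j) (κ j)) → ∑ j, s' j ≤ n → ∀ e : Fin t → (ZZ m →₀ ℕ),
      (∀ j, red p (e j) ∧ chg (e j) = cc p t m d s' j) → fn p (fun j => SS m p (κ j) (mo K (e j))) ∈ M) :
    WW K p m d s eps n ≤ M := by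
  suffices hh : ∀ k : ℕ, ∀ n' : ℤ, n' < k → n' ≤ n → WW K p m d s eps n' ≤ M from
    hh (n.toNat + 1) n (by omega) le_rfl
  intro k
  induction k with
  | zero => intro n' h _; rw [WW_neg s eps (by simpa using h)]; exact bot_le
  | succ k ih =>
    intro n' hn' hn'n
    refine Submodule.span_le.mpr ?_
    rintro f ⟨s', h, hg, hsum, rfl⟩
    have hL : WW K p m d s eps (∑ i, s' i - 1) ≤ M := ih _ (by push_cast at hn'; omega) (by omega)
    have hcar : ∀ h : Fin t → PP K m, Gen p d s eps s' h → (∃ j, h j ∈ II K m p) → fn p h ∈ M := by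
      rintro h hg ⟨j, hj⟩
      have := carry hy hg j (DD_hom (hg.2 j)) hj
      rw [Function.update_eq_self] at this
      exact hL this
    by_cases hbig : ∃ j, 2 * (m : ℤ) * ((p : ℤ) - 1) < lamOf p t d s' j
    · obtain ⟨j, hj⟩ := hbig
      refine hcar h hg ⟨j, big_II hy.hp3 (DD_hom (hg.2 j)) ?_⟩
      rw [lamOfN]; omega
    · push Not at hbig
      have hHc : Hc p t m d s' := ⟨fun j => ⟨hg.1.lo j, (hg.1.le j).trans (hs.1 j).2⟩, fun j => ⟨hg.1.lam j, hbig j⟩⟩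
      refine fn_span (fun j => XX K m p (lamOfN p t d s' j) (cc p t m d s' j) (mode K p m d s eps s' j)) ?_ h
        fun j => DD_le_XX hy.hp3 (mode_hk s eps j (hg.1.lam j)) (mode_val s eps s' j) (hg.2 j)
      intro h' hX
      have hg' : Gen p d s eps s' h' := ⟨hg.1, fun j => XX_DD (hX j)⟩
      by_cases hII : ∃ j, h' j ∈ II K m p
      · exact hcar h' hg' hII
      · push Not at hII
        have : ∀ j, ∃ e : ZZ m →₀ ℕ, ∃ k : K, red p e ∧ chg e = cc p t m d s' j ∧ Full K (cc p t m d s' j) k ∧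
            (mode K p m d s eps s' j = 0 ∨ mode K p m d s eps s' j = k) ∧ h' j = SS m p k (mo K e) := by
          intro j
          rcases hX j with h | h
          · exact h
          · exact absurd h.2 (hII j)
        choose e κ h1 h2 h3 h4 h5 using this
        have hh : h' = fun j => SS m p (κ j) (mo K (e j)) := funext h5
        rw [hh]
        refine H s' κ hHc ⟨hg.1, ?_, fun j => (h3 j).hk, h4⟩ h3 (by omega) e fun j => ⟨h1 j, h2 j⟩
        intro j
        rcases h3 j with h | h | h
        · exact Or.inl h.1
        · exact Or.inr (Or.inl h.1)
        · exact Or.inr (Or.inr h.1)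

lemma UU_WW {s' : Fin t → ℤ} {κ : Fin t → K} (hκ : Kap p m d s eps s' κ) : UU p m d s' κ ≤ WW K p m d s eps (∑ j, s' j) := by
  refine Submodule.span_le.mpr ?_
  rintro f ⟨h, hg, rfl⟩
  exact fn_mem_WW (hg.gen hκ) le_rfl

/-- the top layer is the sum of the fine pieces -/
lemma WW_le_UU (hy : Hy K p t m d) (hs : Hc p t m d s) {M : Submodule K (VV K m → K)} {n : ℤ}
    (hW : WW K p m d s eps (n - 1) ≤ M)
    (H : ∀ (s' : Fin t → ℤ) (κ : Fin t → K), Kap p m d s eps s' κ →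
      (∀ j, Full K (cc p t m d s' j) (κ j)) → ∑ j, s' j = n → UU p m d s' κ ≤ M) :
    WW K p m d s eps n ≤ M := by
  refine WW_le_good hy hs fun s' κ hHc hκ hF hsum e he => ?_
  have hm : fn p (fun j => SS m p (κ j) (mo K (e j))) ∈ UU p m d s' κ :=
    Submodule.subset_span ⟨_, fun j => SS_DD (hF j).hk (mon_mem_CH _ (he j).2), rfl⟩
  rcases hsum.lt_or_eq with h | h
  · exact hW (WW_mono s eps (by omega) (UU_WW hκ hm))
  · exact H s' κ hκ hF h hm

lemma UU_stab (p m d : ℕ) [Fact p.Prime] [CharP K p] (s' : Fin t → ℤ) (κ : Fin t → K) : Stab (UU p m d s' κ) := by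
  apply stab_span
  rintro f ⟨h, hg, rfl⟩ u c
  rw [fn_tv]
  exact Submodule.subset_span ⟨_, fun j => DD_th u c (hg j), rfl⟩

lemma Stab.sup {M N : Submodule K (VV K m → K)} (hM : Stab M) (hN : Stab N) : Stab (M ⊔ N) := by
  intro u c f hf
  obtain ⟨x, hx, y, hy', rfl⟩ := Submodule.mem_sup.mp hf
  exact Submodule.add_mem_sup (hM u c x hx) (hN u c y hy')

/-- radical -/
def SR (M : Submodule K (VV K m → K)) : Submodule K (VV K m → K) :=
  M ⊓ sInf {N | N < M ∧ Stab N ∧ ∀ N', Stab N' → N < N' → N' ≤ M → N' = M}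

theorem SR_WW (hy : Hy K p t m d) (hs : Hc p t m d s) {n : ℤ} (hn : n ≤ ∑ j, s j) :
    SR (WW K p m d s eps n) = WW K p m d s eps (n - 1) := by
  have hle : WW K p m d s eps (n - 1) ≤ WW K p m d s eps n := WW_mono s eps (by omega)
  apply le_antisymm
  · intro x hx
    obtain ⟨hx1, hx2⟩ := Submodule.mem_inf.mp hx
    by_contra hxn
    have hne : {N : Submodule K (VV K m → K) | Stab N ∧ WW K p m d s eps (n - 1) ≤ N ∧ N ≤ WW K p m d s eps n ∧ x ∉ N}.Nonempty :=
      ⟨_, WW_stab _, le_rfl, hle, hxn⟩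
    obtain ⟨N, ⟨hN1, hN2, hN3, hN4⟩, hmax⟩ := (wellFounded_gt (α := Submodule K (VV K m → K))).has_min _ hne
    have hxN' : ∀ N', Stab N' → N < N' → N' ≤ WW K p m d s eps n → x ∈ N' := by
      intro N' h1 h2 h3
      by_contra h4
      exact hmax N' ⟨h1, hN2.trans h2.le, h3, h4⟩ h2
    refine hN4 ((Submodule.mem_sInf.mp hx2) N ⟨?_, hN1, ?_⟩)
    · exact lt_of_le_of_ne hN3 fun h => hN4 (h ▸ hx1)
    · intro N' h1 h2 h3
      by_contra h4
      have h5 : ¬ WW K p m d s eps n ≤ N' := fun h => h4 (le_antisymm h3 h)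
      have h6 : ∃ (s' : Fin t → ℤ) (κ : Fin t → K), Kap p m d s eps s' κ ∧
          (∀ j, Full K (cc p t m d s' j) (κ j)) ∧ ∑ j, s' j = n ∧ ¬ UU p m d s' κ ≤ N' := by
        by_contra h7
        push Not at h7
        exact h5 (WW_le_UU hy hs (hN2.trans h2.le) h7)
      obtain ⟨s', κ, hκ, hF, hsum, hU⟩ := h6
      subst hsum
      have h8 : x ∈ N ⊔ UU p m d s' κ := hxN' _ (hN1.sup (UU_stab p m d s' κ))
        (lt_of_le_of_ne le_sup_left fun h => hU (le_trans (h ▸ le_sup_right) h2.le)) (sup_le hN3 (UU_WW hκ))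
      obtain ⟨a, ha, u, hu, hau⟩ := Submodule.mem_sup.mp h8
      have hx' := hxN' N' h1 h2 h3
      have hu' : u ∈ N' := by
        have : u = x - a := by rw [← hau, add_sub_cancel_left]
        rw [this]; exact Submodule.sub_mem _ hx' (h2.le ha)
      by_cases h9 : u ∈ WW K p m d s eps (∑ j, s' j - 1)
      · exact hN4 (hau ▸ Submodule.add_mem _ ha (hN2 h9))
      · exact hU (simple_layer hy hκ hF h1 (hN2.trans h2.le) hu' (Submodule.mem_sup_left hu) h9)
  · refine le_inf hle (le_sInf ?_)
    rintro N ⟨hN1, hN2, hN3⟩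
    by_contra hcon
    have e1 : N ⊔ WW K p m d s eps (n - 1) = WW K p m d s eps n :=
      hN3 _ (hN2.sup (WW_stab _)) (lt_of_le_of_ne le_sup_left fun h => hcon (h ▸ le_sup_right)) (sup_le hN1.le hle)
    have e2 : ∀ k : ℕ, WW K p m d s eps (n - k) ≤ N ⊔ WW K p m d s eps (n - k - 1) := by
      intro k
      induction k with
      | zero => simp [e1]
      | succ k ih =>
        have := claimC hy hs hN2 (by omega) ih
        push_cast
        rw [show n - ((k : ℤ) + 1) = n - k - 1 by ring, show n - (k : ℤ) - 1 - 1 = n - k - 2 by ring]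
        exact this
    have e3 : ∀ k : ℕ, WW K p m d s eps n ≤ N ⊔ WW K p m d s eps (n - k - 1) := by
      intro k
      induction k with
      | zero => simp [e1]
      | succ k ih =>
        refine ih.trans (sup_le le_sup_left ?_)
        have := e2 (k + 1)
        push_cast at this ⊢
        rwa [show n - ((k : ℤ) + 1) = n - k - 1 by ring] at this ⊢
    have e4 := e3 n.toNat
    rw [WW_neg (n := n - (n.toNat : ℤ) - 1) s eps (by omega), sup_bot_eq] at e4
    exact absurd hN1 (not_lt_of_ge e4)

end goodgen

end RS

namespace RS

section fin
open MvPolynomial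
variable {p t m d : ℕ} [NeZero t] {s : Fin t → ℤ} {eps : Finset (Fin t)} [hp : Fact p.Prime]

lemma lamN_iff (hp3 : 3 ≤ p) (s' : Fin t → ℤ) (j : Fin t) : lamOfN p t d s' j = m * (p - 1) ↔ cc p t m d s' j = 0 := by
  have : ((m * (p - 1) : ℕ) : ℤ) = m * ((p : ℤ) - 1) := by
    rw [Nat.cast_mul, Nat.cast_sub (by omega)]; simp
  rw [← Int.natCast_inj, this, cc, sub_eq_zero]

lemma Jset_iff {s' : Fin t → ℤ} {j : Fin t} (h0 : 0 ≤ lamOf p t d s' j) : j ∈ Jset p t m d s' ↔ cc p t m d s' j = 0 := by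
  rw [Jset, Finset.mem_filter, cc, lamOfN, Int.toNat_of_nonneg h0, sub_eq_zero]
  simp

/-- sign vector of a signature -/
def kap (p t m d : ℕ) [NeZero t] [Fact p.Prime] (s' : Fin t → ℤ) (eps' : Finset (Fin t)) (j : Fin t) : GaloisField p t :=
  kk p t m (lamOfN p t d s' j) (j ∈ eps')

lemma kap_Full (hp3 : 3 ≤ p) (s' : Fin t → ℤ) (eps' : Finset (Fin t)) (j : Fin t) :
    Full (GaloisField p t) (cc p t m d s' j) (kap p t m d s' eps' j) := by
  rw [kap, kk]
  by_cases h : lamOfN p t d s' j = m * (p - 1)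
  · rw [if_pos h]
    have hc := (lamN_iff hp3 s' j).mp h
    by_cases h2 : j ∈ eps'
    · rw [if_pos h2]; exact Or.inr (Or.inl ⟨rfl, hc⟩)
    · rw [if_neg h2]; exact Or.inr (Or.inr ⟨rfl, hc⟩)
  · rw [if_neg h]
    exact Or.inl ⟨rfl, fun hc => h ((lamN_iff hp3 s' j).mpr hc)⟩

lemma kap_Kap (hp3 : 3 ≤ p) {s' : Fin t → ℤ} {eps' : Finset (Fin t)} (hm : memCase p t m d s' eps')
    (hle : leSd p t m d s' eps' s eps) : Kap p m d s eps s' (kap p t m d s' eps') := by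
  have hHc := ((memCase_iff _ _).mp hm).1
  refine ⟨⟨hle.1, fun j => (hHc.1 j).1, fun j => (hHc.2 j).1⟩, fun j => ?_, fun j => (kap_Full hp3 s' eps' j).hk, fun j => ?_⟩
  · rcases kap_Full (m := m) (d := d) hp3 s' eps' j with h | h | h
    · exact Or.inl h.1
    · exact Or.inr (Or.inl h.1)
    · exact Or.inr (Or.inr h.1)
  · rw [mode]
    by_cases hZ : j ∈ Zset p t m d s' s
    · right
      rw [if_pos hZ]
      have h1 : j ∈ eps ↔ j ∈ eps' := by
        have := congrArg (fun S => j ∈ S) hle.2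
        simpa [Finset.mem_inter, hZ] using this
      have h2 : lamOf p t d s' j = m * ((p : ℤ) - 1) := by
        rw [Zset, Finset.mem_filter] at hZ
        exact hZ.2.2.2
      have h3 : lamOfN p t d s' j = m * (p - 1) := by
        rw [lamN_iff hp3, cc, lamOfN, Int.toNat_of_nonneg (hHc.2 j).1, h2, sub_self]
      rw [kap, kk, if_pos h3]
      by_cases h4 : j ∈ eps
      · rw [if_pos h4, if_pos (h1.mp h4)]
      · rw [if_neg h4, if_neg (fun h => h4 (h1.mpr h))]
    · left; rw [if_neg hZ]

lemma neg_one_ne (hp3 : 3 ≤ p) : (-1 : GaloisField p t) ≠ 1 := by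
  intro h
  have h2 : (2 : GaloisField p t) ≠ 0 := two_ne (p := p) hp3
  apply h2
  calc (2 : GaloisField p t) = 1 + 1 := one_add_one_eq_two.symm
    _ = -1 + 1 := by rw [h]
    _ = 0 := neg_add_cancel 1

lemma Kap_eps (hp3 : 3 ≤ p) {s' : Fin t → ℤ} {κ : Fin t → GaloisField p t} (hHc : Hc p t m d s')
    (hκ : Kap p m d s eps s' κ) (hF : ∀ j, Full (GaloisField p t) (cc p t m d s' j) (κ j)) :
    ∃ eps', memCase p t m d s' eps' ∧ leSd p t m d s' eps' s eps ∧ κ = kap p t m d s' eps' := by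
  refine ⟨Finset.univ.filter (fun j => κ j = 1), (memCase_iff _ _).mpr ⟨hHc, ?_⟩, ⟨hκ.adm.le, ?_⟩, ?_⟩
  · intro j hj
    rw [Jset_iff (hHc.2 j).1]
    have h1 : κ j = 1 := by simpa using hj
    rcases hF j with h | h | h
    · rw [h1] at h; exact absurd h.1 one_ne_zero
    · exact h.2
    · exact h.2
  · ext j
    simp only [Finset.mem_inter, Finset.mem_filter, Finset.mem_univ, true_and]
    refine and_congr_left fun hZ => ?_
    have := hκ.md j
    rw [mode, if_pos hZ] at this
    by_cases h : j ∈ eps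
    · rw [if_pos h] at this
      simp only [h, true_iff]
      rcases this with h | h
      · exact absurd h one_ne_zero
      · exact h.symm
    · rw [if_neg h] at this
      simp only [h, false_iff]
      rcases this with h | h
      · exact absurd h (neg_ne_zero.mpr one_ne_zero)
      · rw [← h]; exact neg_one_ne hp3
  · funext j
    rw [kap, kk]
    rcases hF j with h | h | h
    · rw [if_neg (fun hh => h.2 ((lamN_iff hp3 s' j).mp hh)), h.1]
    · rw [if_pos ((lamN_iff hp3 s' j).mpr h.2), if_pos (by simpa using h.1), h.1]
    · rw [if_pos ((lamN_iff hp3 s' j).mpr h.2), if_neg, h.1]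
      simp only [Finset.mem_filter, Finset.mem_univ, true_and, h.1]
      exact neg_one_ne hp3

lemma SBF_UU (hp3 : 3 ≤ p) {s' : Fin t → ℤ} {eps' : Finset (Fin t)} {f : SympV p t m → GaloisField p t}
    (hf : IsSBF p t m (lamOfN p t d s') eps' f) : f ∈ UU p m d s' (kap p t m d s' eps') := by
  obtain ⟨g, hg, rfl⟩ := hf
  choose h hh1 hh2 using fun j => digit_DD hp3 (hg j)
  refine Submodule.subset_span ⟨h, hh1, ?_⟩
  funext v
  rw [fn]
  exact Finset.prod_congr rfl fun j _ => by rw [hh2]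

lemma fn_SBF (hp3 : 3 ≤ p) {s' : Fin t → ℤ} {eps' : Finset (Fin t)} (hm : memCase p t m d s' eps') (e : Fin t → (ZZ m →₀ ℕ))
    (he : ∀ j, red p (e j) ∧ chg (e j) = cc p t m d s' j) :
    ∃ c : GaloisField p t, ∃ f, (c = 0 ∨ IsSBF p t m (lamOfN p t d s') eps' f) ∧
      fn p (fun j => SS m p (kap p t m d s' eps' j) (mo _ (e j))) = c • f := by
  obtain ⟨hHc, hJ⟩ := (memCase_iff _ _).mp hm
  have hpl : ∀ j, lamOfN p t d s' j ≠ m * (p - 1) → ¬ (j ∈ eps') := fun j h hj =>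
    h ((lamN_iff hp3 s' j).mpr ((Jset_iff (hHc.2 j).1).mp (hJ hj)))
  by_cases h0 : ∃ j, (ev (SS m p (kap p t m d s' eps' j) (mo _ (e j))) : SympV p t m → GaloisField p t) = 0
  · obtain ⟨j, hj⟩ := h0
    refine ⟨0, 0, Or.inl rfl, ?_⟩
    rw [zero_smul]
    funext v
    rw [fn]
    refine Finset.prod_eq_zero (Finset.mem_univ j) ?_
    rw [hj]
    exact zero_pow (pow_ne_zero _ hp.out.ne_zero)
  · have : ∀ j, ∃ c : GaloisField p t, ∃ g, IsDigit p t m (lamOfN p t d s' j) (j ∈ eps') g ∧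
      (ev (SS m p (kap p t m d s' eps' j) (mo _ (e j))) : SympV p t m → GaloisField p t) = c • g := by
      intro j
      rcases DD_digit hp3 (hpl j) (he j).1 (he j).2 with h | h
      · exact absurd ⟨j, h⟩ h0
      · exact h
    choose c g hg1 hg2 using this
    refine ⟨∏ j, c j ^ (p ^ (j : ℕ)), fun v => ∏ j, (g j v) ^ (p ^ (j : ℕ)), Or.inr ⟨g, hg1, rfl⟩, ?_⟩
    funext v
    rw [fn, Pi.smul_apply, smul_eq_mul, ← Finset.prod_mul_distrib]
    refine Finset.prod_congr rfl fun j _ => ?_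
    rw [hg2, Pi.smul_apply, smul_eq_mul, mul_pow]

/-- span of basis functions of bounded level -/
def SB (p t m d : ℕ) [NeZero t] [Fact p.Prime] (s : Fin t → ℤ) (eps : Finset (Fin t)) (n : ℤ) :
    Submodule (GaloisField p t) (SympV p t m → GaloisField p t) :=
  Submodule.span (GaloisField p t)
    {f | ∃ s' eps', memCase p t m d s' eps' ∧ leSd p t m d s' eps' s eps ∧ ∑ j, s' j ≤ n ∧
      IsSBF p t m (lamOfN p t d s') eps' f}

lemma SB_eq [Fintype (GaloisField p t)] (hy : Hy (GaloisField p t) p t m d) (hm : memCase p t m d s eps) (n : ℤ) :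
    SB p t m d s eps n = WW (GaloisField p t) p m d s eps n := by
  apply le_antisymm
  · refine Submodule.span_le.mpr ?_
    rintro f ⟨s', eps', h1, h2, h3, h4⟩
    exact WW_mono s eps h3 (UU_WW (kap_Kap hy.hp3 h1 h2) (SBF_UU hy.hp3 h4))
  · refine WW_le_good hy ((memCase_iff _ _).mp hm).1 ?_
    intro s' κ hHc hκ hF hsum e he
    obtain ⟨eps', h1, h2, rfl⟩ := Kap_eps hy.hp3 hHc hκ hF
    obtain ⟨c, f, h3, h4⟩ := fn_SBF hy.hp3 h1 e he
    rw [h4]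
    rcases h3 with rfl | h3
    · rw [zero_smul]; exact Submodule.zero_mem _
    · exact Submodule.smul_mem _ _ (Submodule.subset_span ⟨s', eps', h1, h2, hsum, h3⟩)

lemma SB_Y : Ymod p t m d s eps = SB p t m d s eps (∑ j, s j) := by
  apply le_antisymm
  · refine Submodule.span_le.mpr ?_
    rintro f ⟨s', eps', h1, h2, h4⟩
    exact Submodule.subset_span ⟨s', eps', h1, h2, Finset.sum_le_sum fun j _ => h2.1 j, h4⟩
  · refine Submodule.span_le.mpr ?_
    rintro f ⟨s', eps', h1, h2, _, h4⟩
    exact Submodule.subset_span ⟨s', eps', h1, h2, h4⟩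

lemma SB_sup (hp3 : 3 ≤ p) (ht : 1 < t) (hm2 : 2 ≤ m) (hd : d ≤ p ^ t - 2) (hm : memCase p t m d s eps) (i : ℕ) :
    SB p t m d s eps (∑ j, s j - i) = ⨆ (s'' : Fin t → ℤ) (eps'' : Finset (Fin t))
          (_ : memCase p t m d s'' eps'' ∧ leSd p t m d s'' eps'' s eps ∧
            (∑ j, s'' j) = (∑ j, s j) - (i : ℤ)),
          Ymod p t m d s'' eps'' := by
  apply le_antisymm
  · refine Submodule.span_le.mpr ?_
    rintro f ⟨s', eps', h1, h2, h3, h4⟩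
    obtain ⟨s'', e'', g1, g2, g3, g4⟩ := interm hp3 ht hm2 hd hm (∑ j, s j - i - ∑ j, s' j).toNat s' eps' h1 h2 (by omega)
    have hle : Ymod p t m d s'' e'' ≤ ⨆ (s'' : Fin t → ℤ) (eps'' : Finset (Fin t))
          (_ : memCase p t m d s'' eps'' ∧ leSd p t m d s'' eps'' s eps ∧
            (∑ j, s'' j) = (∑ j, s j) - (i : ℤ)),
          Ymod p t m d s'' eps'' :=
      le_iSup_of_le s'' (le_iSup_of_le e'' (le_iSup_of_le ⟨g1, g3, by omega⟩ le_rfl))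
    exact hle (Submodule.subset_span ⟨s', eps', h1, g2, h4⟩)
  · refine iSup_le fun s'' => iSup_le fun e'' => iSup_le fun ⟨g1, g2, g3⟩ => Submodule.span_le.mpr ?_
    rintro f ⟨s', eps', h1, h2, h4⟩
    refine Submodule.subset_span ⟨s', eps', h1, leSd_trans h2 g2, ?_, h4⟩
    rw [← g3]
    exact Finset.sum_le_sum fun j _ => h2.1 j

lemma stab_iff (M : Submodule (GaloisField p t) (SympV p t m → GaloisField p t)) : SpStable M ↔ Stab M := by
  constructor
  · intro h u c f hf
    have h1 := h (tvE u (-c)) (fun v w => tv_sf u (-c) v w) f hf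
    have h2 : (fun v => f ((tvE u (-c)).symm v)) = fun v => f (tv u c v) := by
      funext v
      have : (tvE u (-c)).symm v = tv u (-(-c)) v := rfl
      rw [this, neg_neg]
    rwa [h2] at h1
  · intro h g hg f hf
    refine stable_of_tv M h (g.symm : SympV p t m →ₗ[GaloisField p t] SympV p t m) ?_ f hf
    intro v w
    have := hg (g.symm v) (g.symm w)
    rw [g.apply_symm_apply, g.apply_symm_apply] at this
    exact this.symm

lemma SpRad_eq (M : Submodule (GaloisField p t) (SympV p t m → GaloisField p t)) : SpRad p t m M = SR M := by
  simp only [SpRad, SR, stab_iff]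

end fin

end RS

/-- The radical series of `Y(s,ε)[d]` (resp. `Y(s,ε)` for `d = 0`) is given by digit
sums: `rad^i(Y(s,ε)[d]) = Σ Y(s'',ε'')[d]`, the sum over all `(s'',ε'') ≤ (s,ε)` in
`S[d]` (resp. `S`) with `|s''| = |s| − i`. -/
theorem radical_series (p t m d : ℕ) [Fact p.Prime] [NeZero t]
    (hodd : Odd p) (ht : 1 < t) (hm : 2 ≤ m) (hd : d ≤ p ^ t - 2)
    (s : Fin t → ℤ) (eps : Finset (Fin t))
    (hmem : memCase p t m d s eps) :
    ∀ i : ℕ,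
      SpRadIter p t m (Ymod p t m d s eps) i =
        ⨆ (s'' : Fin t → ℤ) (eps'' : Finset (Fin t))
          (_ : memCase p t m d s'' eps'' ∧ leSd p t m d s'' eps'' s eps ∧
            (∑ j, s'' j) = (∑ j, s j) - (i : ℤ)),
          Ymod p t m d s'' eps'' := by
  intro i
  haveI : Finite (GaloisField p t) := inferInstance
  letI : Fintype (GaloisField p t) := Fintype.ofFinite _
  have hp2 := (Fact.out : p.Prime).two_le
  have hp3 : 3 ≤ p := by
    obtain ⟨k, hk⟩ := hodd
    omega
  have hy : RS.Hy (GaloisField p t) p t m d :=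
    ⟨hp3, ht, hm, hd, by rw [Fintype.card_eq_nat_card]; exact GaloisField.card p t (by omega)⟩
  have hs := ((RS.memCase_iff s eps).mp hmem).1
  rw [← RS.SB_sup hp3 ht hm hd hmem i]
  induction i with
  | zero =>
    rw [SpRadIter, RS.SB_Y]
    simp
  | succ i ih =>
    rw [SpRadIter, ih, RS.SpRad_eq, RS.SB_eq hy hmem, RS.SB_eq hy hmem, RS.SR_WW hy hs (by omega)]
    congr 1
    push_cast
    ring

end
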